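/- Let d ≥ 3 and p ∈ (p_c^site(ℤ^d), 1 − p_c^site(ℤ^d)). There exists an integer l = l(d,p) such that ℙ_p-almost surely, every word ξ ∈ Ξ is seen from some vertex of the slab ℤ² × [0,l]^{d−2} along an infinite self-avoiding path entirely contained in that slab. -/

import Mathlib

open MeasureTheory Set

namespace PercWords

/-- Vertices of the hypercubic lattice `ℤ^d`. -/
abbrev Vtx (d : ℕ) := Fin d → ℤ

/-- Site percolation configurations on `ℤ^d` (`true` = state 1, `false` = state 0). -/
abbrev Config (d : ℕ) := Vtx d → Bool

/-- `u ∼ v` : the Euclidean distance between `u` and `v` is `1`. -/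
def adj {d : ℕ} (u v : Vtx d) : Prop := (∑ i, (u i - v i) ^ 2) = 1

/-- `μ` is Bernoulli site percolation with parameter `p` on the index set `ι`:
a probability measure under which, independently, each site has state `true`
with probability `p` and state `false` with probability `1 - p`. -/
def IsBernoulliFam {ι : Type} (p : ℝ) (μ : Measure (ι → Bool)) : Prop :=
  IsProbabilityMeasure μ ∧
    ∀ (s : Finset ι) (f : ι → Bool),
      μ {ω | ∀ v ∈ s, ω v = f v} =
        ∏ v ∈ s, ENNReal.ofReal (if f v then p else 1 - p)

/-- The word `ξ` is seen from `v` along an infinite self-avoiding path all of whose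
vertices lie in `A`. -/
def seesWordIn {d : ℕ} (ω : Config d) (ξ : ℕ → Bool) (A : Set (Vtx d)) (v : Vtx d) : Prop :=
  ∃ γ : ℕ → Vtx d, γ 0 = v ∧ Function.Injective γ ∧
    (∀ i, adj (γ i) (γ (i + 1))) ∧ (∀ i, γ i ∈ A) ∧ (∀ i, ω (γ i) = ξ i)

/-- The word `ξ` is seen from `v` in the configuration `ω`. -/
def seesWord {d : ℕ} (ω : Config d) (ξ : ℕ → Bool) (v : Vtx d) : Prop :=
  seesWordIn ω ξ Set.univ v

/-- `v` lies in an infinite connected set of `1`-vertices of `ω`. -/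
def PercolatesAt {d : ℕ} (ω : Config d) (v : Vtx d) : Prop :=
  ∃ C : Set (Vtx d), v ∈ C ∧ C.Infinite ∧ (∀ u ∈ C, ω u = true) ∧
    ∀ u₁ ∈ C, ∀ u₂ ∈ C, ∃ n : ℕ, ∃ γ : ℕ → Vtx d,
      γ 0 = u₁ ∧ γ n = u₂ ∧ (∀ i < n, adj (γ i) (γ (i + 1))) ∧ (∀ i ≤ n, γ i ∈ C)

/-- The critical point of Bernoulli site percolation on `ℤ^d`, relative to a family
`ℙ p` of Bernoulli site percolation measures: the infimum of the set of parameters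
for which the origin lies in an infinite connected set of `1`-vertices with positive
probability. -/
noncomputable def pcSite (d : ℕ) (ℙ : ℝ → Measure (Config d)) : ℝ :=
  sInf {p : ℝ | p ∈ Set.Icc (0 : ℝ) 1 ∧ 0 < ℙ p {ω | PercolatesAt ω (fun _ => 0)}}

/-- The slab `ℤ² × [0, l]^{d−2}` inside `ℤ^d`. -/
def slab2 (d l : ℕ) : Set (Vtx d) :=
  {x | ∀ i : Fin d, 2 ≤ (i : ℕ) → 0 ≤ x i ∧ x i ≤ (l : ℤ)}

set_option linter.all false

section A
variable {ι Z : Type} [Fintype Z] [MeasurableSpace Z] [DiscreteMeasurableSpace Z]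

noncomputable def Pm (w : ι → PMF Z) : Measure (ι → Z) :=
  Measure.infinitePi fun v => (w v).toMeasure

instance (w : ι → PMF Z) : IsProbabilityMeasure (Pm w) := by unfold Pm; infer_instance

theorem eq_Pm {w : ι → PMF Z} {μ : Measure (ι → Z)} (h : ∀ (s : Finset ι) (f : ι → Z),
    μ {ω | ∀ v ∈ s, ω v = f v} = ∏ v ∈ s, w v (f v)) (hZ : Nonempty Z) : μ = Pm w := by
  refine ((Measure.isProjectiveLimit_infinitePi fun v => (w v).toMeasure).unique ?_).symm
  intro s
  refine Measure.ext_of_singleton fun f => ?_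
  obtain ⟨z⟩ := hZ
  classical
  rw [Measure.map_apply (by fun_prop) (by measurability), Measure.pi_singleton]
  have := h s (fun v => if hv : v ∈ s then f ⟨v, hv⟩ else z)
  convert this using 2
  · ext ω
    simp only [mem_preimage, mem_singleton_iff, mem_setOf_eq, funext_iff]
    constructor
    · intro h v hv; simpa [hv] using h ⟨v, hv⟩
    · rintro h ⟨v, hv⟩; simpa [hv] using h v hv
  · rw [← Finset.prod_coe_sort s]
    refine Finset.prod_congr rfl fun v _ => ?_
    rw [PMF.toMeasure_apply_singleton _ _ (by measurability)]; simp

theorem Pm_cyl (w : ι → PMF Z) (s : Finset ι) (f : ι → Z) :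
    (Pm w) {ω | ∀ v ∈ s, ω v = f v} = ∏ v ∈ s, w v (f v) := by
  have := Measure.infinitePi_pi (fun v => (w v).toMeasure) (s := s) (t := fun v => {f v})
    (fun _ _ => by measurability)
  have e : {ω : ι → Z | ∀ v ∈ s, ω v = f v} = (s : Set ι).pi fun v => {f v} := by
    ext ω; simp [Set.pi]
  rw [Pm, e, this]
  refine Finset.prod_congr rfl fun v _ => ?_
  rw [PMF.toMeasure_apply_singleton _ _ (by measurability)]

def dep (A : Set (ι → Z)) (s : Set ι) : Prop :=
  ∀ ω ω' : ι → Z, (∀ v ∈ s, ω v = ω' v) → ω ∈ A → ω' ∈ A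

theorem dep.mono {A : Set (ι → Z)} {s t : Set ι} (h : dep A s) (st : s ⊆ t) : dep A t :=
  fun ω ω' e => h ω ω' fun v hv => e v (st hv)
theorem dep.compl {A : Set (ι → Z)} {s : Set ι} (h : dep A s) : dep Aᶜ s :=
  fun ω ω' e ha ha' => ha (h ω' ω (fun v hv => (e v hv).symm) ha')
theorem dep.inter {A B : Set (ι → Z)} {s : Set ι} (h : dep A s) (h' : dep B s) : dep (A ∩ B) s :=
  fun ω ω' e ha => ⟨h ω ω' e ha.1, h' ω ω' e ha.2⟩
theorem dep.iff {A : Set (ι → Z)} {s : Set ι} (h : dep A s) {ω ω' : ι → Z}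
    (e : ∀ v ∈ s, ω v = ω' v) : ω ∈ A ↔ ω' ∈ A :=
  ⟨h _ _ e, h _ _ fun v hv => (e v hv).symm⟩

theorem dep.eq_pre [Nonempty Z] {A : Set (ι → Z)} {s : Finset ι} (h : dep A s) :
    A = s.restrict ⁻¹' (s.restrict '' A) := by
  refine subset_antisymm (subset_preimage_image _ _) ?_
  rintro ω ⟨ω', h', e⟩
  exact h ω' ω (fun v hv => congrFun e ⟨v, hv⟩) h'

theorem dep.meas [Nonempty Z] {A : Set (ι → Z)} {s : Set ι} (h : dep A s) (hs : s.Finite) : MeasurableSet A := by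
  lift s to Finset ι using hs
  rw [h.eq_pre]
  exact (Finset.measurable_restrict _) (Set.toFinite _).measurableSet

theorem Pm_indep [Nonempty Z] (w : ι → PMF Z) {A B : Set (ι → Z)} {s t : Set ι} (hA : dep A s) (hB : dep B t)
    (hs : s.Finite) (ht : t.Finite) (st : Disjoint s t) :
    (Pm w).real (A ∩ B) = (Pm w).real A * (Pm w).real B := by
  lift s to Finset ι using hs
  lift t to Finset ι using ht
  have h1 : ProbabilityTheory.iIndepFun (fun (i : ι) (ω : ι → Z) => ω i) (Pm w) :=
    ProbabilityTheory.iIndepFun_infinitePi (P := fun v => (w v).toMeasure)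
      (X := fun i x => x) (fun i => measurable_id)
  have h2 := h1.indepFun_finset s t (by simpa using st) (fun i => by fun_prop)
  have h3 := (ProbabilityTheory.indepFun_iff_measure_inter_preimage_eq_mul.1 h2)
    (s.restrict '' A) (t.restrict '' B) (Set.toFinite _).measurableSet (Set.toFinite _).measurableSet
  have e1 := hA.eq_pre
  have e2 := hB.eq_pre
  have h4 : (Pm w) (A ∩ B) = (Pm w) A * (Pm w) B := by
    rw [e1, e2]; exact h3
  simp [measureReal_def, h4]

/-- fiber lemma -/
theorem Pm_fiber_fin [Nonempty Z] (w : ι → PMF Z) {α : Type*} (S : (ι → Z) → α) (hr : (range S).Finite)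
    (E : Set α) (A : Set (ι → Z)) (ε : ℝ)
    (H : ∀ σ ∈ E, ∃ I J : Set ι, ∃ A' : Set (ι → Z), I.Finite ∧ J.Finite ∧ Disjoint I J ∧
      dep {ω | S ω = σ} I ∧ dep A' J ∧ (Pm w).real A' ≤ ε ∧ {ω | S ω = σ} ∩ A ⊆ A') :
    (Pm w).real ({ω | S ω ∈ E} ∩ A) ≤ ε * (Pm w).real {ω | S ω ∈ E} := by
  classical
  let T := hr.toFinset.filter (· ∈ E)
  have e1 : {ω | S ω ∈ E} = ⋃ σ ∈ T, {ω | S ω = σ} := by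
    ext ω; simp [T]
  have hd : Set.PairwiseDisjoint (T : Set α) (fun σ => {ω | S ω = σ}) := by
    intro a _ b _ hab
    exact Set.disjoint_left.2 fun ω h1 h2 => hab (h1.symm.trans h2)
  have e2 : (Pm w).real {ω | S ω ∈ E} = ∑ σ ∈ T, (Pm w).real {ω | S ω = σ} := by
    rw [e1, measureReal_biUnion_finset hd fun σ hσ => ?_]
    obtain ⟨I, J, A', hI, hJ, hIJ, d1, d2, d3, d4⟩ := H σ (Finset.mem_filter.1 hσ).2
    exact d1.meas hI
  have e3 : (Pm w).real ({ω | S ω ∈ E} ∩ A) ≤ ∑ σ ∈ T, (Pm w).real ({ω | S ω = σ} ∩ A) := by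
    rw [e1, iUnion₂_inter]
    exact measureReal_biUnion_finset_le _ _
  rw [e2, Finset.mul_sum]
  refine e3.trans (Finset.sum_le_sum fun σ hσ => ?_)
  obtain ⟨I, J, A', hI, hJ, hIJ, d1, d2, d3, d4⟩ := H σ (Finset.mem_filter.1 hσ).2
  calc _ ≤ (Pm w).real ({ω | S ω = σ} ∩ A') :=
        measureReal_mono (fun ω h => ⟨h.1, d4 h⟩)
    _ = _ := Pm_indep w d1 d2 hI hJ hIJ
    _ ≤ _ := by rw [mul_comm]; gcongr

theorem Pm_fiber [Nonempty Z] (w : ι → PMF Z) {α : Type*} (S : (ι → Z) → α) {I0 : Set ι} (hI0 : I0.Finite)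
    (hS : ∀ σ, dep {ω | S ω = σ} I0) (E : Set α) (A : Set (ι → Z)) (ε : ℝ)
    (H : ∀ σ ∈ E, ∃ I J : Set ι, ∃ A' : Set (ι → Z), I.Finite ∧ J.Finite ∧ Disjoint I J ∧
      dep {ω | S ω = σ} I ∧ dep A' J ∧ (Pm w).real A' ≤ ε ∧ {ω | S ω = σ} ∩ A ⊆ A') :
    (Pm w).real ({ω | S ω ∈ E} ∩ A) ≤ ε * (Pm w).real {ω | S ω ∈ E} := by
  classical
  refine Pm_fiber_fin w S ?_ E A ε H
  lift I0 to Finset ι using hI0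
  obtain ⟨z⟩ := ‹Nonempty Z›
  let g : (I0 → Z) → α := fun f => S fun v => if h : v ∈ I0 then f ⟨v, h⟩ else z
  refine (Set.finite_range g).subset ?_
  rintro _ ⟨ω, rfl⟩
  refine ⟨fun v => ω v, ?_⟩
  exact hS (S ω) ω _ (fun v hv => by simp at hv; simp [hv]) rfl

theorem Pm_map [Nonempty Z] (w : PMF Z) (e : ι ≃ ι) {A : Set (ι → Z)} (hA : MeasurableSet A) :
    (Pm fun _ : ι => w).real ((fun ω => ω ∘ e) ⁻¹' A) = (Pm fun _ : ι => w).real A := by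
  classical
  have hm : Measurable (fun ω : ι → Z => ω ∘ e) := by
    rw [measurable_pi_iff]; intro v; exact measurable_pi_apply _
  have : (Pm fun _ : ι => w).map (fun ω => ω ∘ e) = Pm fun _ : ι => w := by
    refine eq_Pm (fun s f => ?_) ‹_›
    rw [Measure.map_apply hm]
    · have := Pm_cyl (fun _ : ι => w) (s.map e.toEmbedding) (f ∘ e.symm)
      rw [Finset.prod_map] at this
      simp only [Equiv.coe_toEmbedding, Function.comp, Equiv.symm_apply_apply] at this
      rw [← this]; congr 1; ext ω
      simp only [mem_preimage, mem_setOf_eq, Finset.mem_map_equiv]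
      exact ⟨fun h v hv => by simpa using h _ hv, fun h v hv => by simpa using h (e v) (by simpa)⟩
    · have : dep {ω : ι → Z | ∀ v ∈ s, ω v = f v} s := fun ω ω' h h' v hv => by
        rw [← h v hv]; exact h' v hv
      exact this.meas s.finite_toSet
  conv_rhs => rw [← this, measureReal_def, Measure.map_apply hm hA]
  rfl

open Classical in
theorem Pm_sum [Nonempty Z] (w : ι → PMF Z) (z : Z) {A : Set (ι → Z)} {s : Finset ι} (hA : dep A s) :
    (Pm w).real A = ∑ f : s → Z,
      if (fun v => if h : v ∈ s then f ⟨v, h⟩ else z) ∈ A then ∏ v : s, (w v (f v)).toReal else 0 := by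
  have e : A = ⋃ f ∈ (Finset.univ.filter fun f : s → Z => (fun v => if h : v ∈ s then f ⟨v, h⟩ else z) ∈ A),
      {ω : ι → Z | ∀ v ∈ s, ω v = if h : v ∈ s then f ⟨v, h⟩ else z} := by
    ext ω
    simp only [Finset.mem_filter, Finset.mem_univ, true_and, mem_iUnion, mem_setOf_eq, exists_prop]
    constructor
    · intro h; exact ⟨fun v => ω v, hA ω _ (fun v hv => by simp at hv; simp [hv]) h, fun v hv => by simp [hv]⟩
    · rintro ⟨f, hf, h⟩; exact hA _ ω (fun v hv => (h v hv).symm) hf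
  rw [← Finset.sum_filter]
  conv_lhs => rw [e]
  rw [measureReal_biUnion_finset]
  · refine Finset.sum_congr rfl fun f _ => ?_
    rw [measureReal_def, Pm_cyl w s (fun v => if h : v ∈ s then f ⟨v, h⟩ else z), ENNReal.toReal_prod,
      ← Finset.prod_coe_sort s]
    refine Finset.prod_congr rfl fun v _ => ?_
    simp
  · intro f _ g _ hfg
    refine Set.disjoint_left.2 fun ω h1 h2 => hfg ?_
    ext ⟨v, hv⟩; have := (h1 v hv).symm.trans (h2 v hv); simpa [hv] using this
  · intro f _
    refine dep.meas (s := s) (fun ω ω' h h' v hv => ?_) s.finite_toSet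
    rw [← h v hv]; exact h' v hv

/-- Harris for increasing events (true = high). -/
theorem harris (w : ι → PMF Bool) {A B : Set (ι → Bool)} {s : Set ι} (hs : s.Finite) (hA : dep A s) (hB : dep B s)
    (mA : ∀ ω ω' : ι → Bool, ω ≤ ω' → ω' ∈ A → ω ∈ A) (mB : ∀ ω ω' : ι → Bool, ω ≤ ω' → ω' ∈ B → ω ∈ B) :
    (Pm w).real A * (Pm w).real B ≤ (Pm w).real (A ∩ B) := by
  classical
  lift s to Finset ι using hs
  let x : (s → Bool) → ι → Bool := fun f v => if h : v ∈ s then !(f ⟨v, h⟩) else false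
  have hx : ∀ f g, f ≤ g → x g ≤ x f := by
    intro f g h v
    simp only [x]; split_ifs with hv
    · have := h ⟨v, hv⟩
      revert this; cases f ⟨v, hv⟩ <;> cases g ⟨v, hv⟩ <;> simp
    · exact le_refl _
  let W : (s → Bool) → ℝ := fun f => ∏ v : s, (w v (!(f v))).toReal
  have key : ∀ A : Set (ι → Bool), dep A s → (Pm w).real A = ∑ f, W f * (if x f ∈ A then 1 else 0) := by
    intro A hA
    rw [Pm_sum w false hA]
    refine Fintype.sum_equiv (Equiv.piCongrRight fun _ => Equiv.boolNot) _ _ fun f => ?_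
    simp [x, W, Equiv.boolNot]
  have h1 : ∑ f, W f = 1 := by
    have := key univ (fun _ _ _ _ => trivial)
    simpa using this.symm
  have := fkg (μ := W) (f := fun f => if x f ∈ A then 1 else 0) (g := fun f => if x f ∈ B then 1 else 0)
    (fun f => Finset.prod_nonneg fun _ _ => ENNReal.toReal_nonneg)
    (fun f => by dsimp; split_ifs <;> simp) (fun f => by dsimp; split_ifs <;> simp)
    (fun f g h => by
      dsimp; split_ifs with h1 h2
      · rfl
      · exact absurd (mA _ _ (hx f g h) h1) h2
      · simp
      · rfl)
    (fun f g h => by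
      dsimp; split_ifs with h1 h2
      · rfl
      · exact absurd (mB _ _ (hx f g h) h1) h2
      · simp
      · rfl)
    (fun f g => by
      simp only [W]; rw [← Finset.prod_mul_distrib, ← Finset.prod_mul_distrib]
      refine le_of_eq (Finset.prod_congr rfl fun v _ => ?_)
      simp only [Pi.inf_apply, Pi.sup_apply]
      cases f v <;> cases g v <;> simp [mul_comm])
  rw [key A hA, key B hB, key _ (hA.inter hB)]
  rw [h1, one_mul] at this
  refine this.trans (le_of_eq (Finset.sum_congr rfl fun f _ => ?_))
  by_cases a : x f ∈ A <;> by_cases b : x f ∈ B <;> simp [a, b]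
end A
section B1
variable {d : ℕ}

theorem adj_symm {u v : Vtx d} (h : adj u v) : adj v u := by
  unfold adj at *; rw [← h]; exact Finset.sum_congr rfl fun i _ => by ring

theorem adj_le {u v : Vtx d} (h : adj u v) (i : Fin d) : |u i - v i| ≤ 1 := by
  unfold adj at h
  have := Finset.single_le_sum (f := fun i => (u i - v i) ^ 2) (fun i _ => sq_nonneg _) (Finset.mem_univ i)
  simp only [h] at this
  exact abs_le_one_iff_mul_self_le_one.2 (by nlinarith)

theorem adj_ex {u v : Vtx d} (h : adj u v) : ∃ i, |u i - v i| = 1 ∧ ∀ j ≠ i, u j = v j := by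
  have h1 := adj_le h
  by_contra! hc
  unfold adj at h
  have hne : ∃ i, u i ≠ v i := by
    by_contra! h0; simp [h0] at h
  obtain ⟨i, hi⟩ := hne
  have hi1 : |u i - v i| = 1 := le_antisymm (h1 i) (Int.one_le_abs (sub_ne_zero.2 hi))
  obtain ⟨j, hj, hj'⟩ := hc i hi1
  have hj1 : |u j - v j| = 1 := le_antisymm (h1 j) (Int.one_le_abs (sub_ne_zero.2 hj'))
  have := Finset.sum_le_sum_of_subset_of_nonneg (f := fun i => (u i - v i) ^ 2)
    (Finset.subset_univ ({j, i} : Finset (Fin d))) (fun i _ _ => sq_nonneg _)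
  rw [Finset.sum_pair hj, h, ← sq_abs, hj1, ← sq_abs (u i - v i), hi1] at this
  norm_num at this

theorem adj_of {u v : Vtx d} (i : Fin d) (h : |u i - v i| = 1) (h' : ∀ j ≠ i, u j = v j) : adj u v := by
  unfold adj
  rw [Finset.sum_eq_single i]
  · rw [← sq_abs, h]; rfl
  · intro j _ hj; simp [h' j hj]
  · simp

inductive Rch (O S : Set (Vtx d)) : Vtx d → Prop
  | base {v} : v ∈ S → Rch O S v
  | step {u v} : Rch O S u → adj u v → v ∈ O → Rch O S v

theorem Rch.mono {O O' S S' : Set (Vtx d)} (hO : O ⊆ O') (hS : S ⊆ S') {v} (h : Rch O S v) : Rch O' S' v := by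
  induction h with
  | base h => exact .base (hS h)
  | step _ a h ih => exact .step ih a (hO h)

theorem Rch.mem {O S : Set (Vtx d)} {v} (h : Rch O S v) : v ∈ S ∪ O := by
  cases h with
  | base h => exact .inl h
  | step _ a h => exact .inr h

theorem Rch.trans {O S S' : Set (Vtx d)} (hS : ∀ v ∈ S', Rch O S v) {v} (h : Rch O S' v) : Rch O S v := by
  induction h with
  | base h => exact hS _ h
  | step _ a h ih => exact .step ih a h

theorem Rch.map (φ : Vtx d → Vtx d) (hφ : ∀ u v, adj u v → adj (φ u) (φ v)) {O S O' S' : Set (Vtx d)}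
    (hO : ∀ v ∈ O, φ v ∈ O') (hS : ∀ v ∈ S, φ v ∈ S') {v} (h : Rch O S v) : Rch O' S' (φ v) := by
  induction h with
  | base h => exact .base (hS _ h)
  | step _ a h ih => exact .step ih (hφ _ _ a) (hO _ h)

def bx (c : Vtx d) (n : ℕ) : Set (Vtx d) := {y | ∀ i, |y i - c i| ≤ n}

theorem bx_fin (c : Vtx d) (n : ℕ) : (bx c n).Finite := by
  refine (Set.finite_Icc (fun i => c i - n) (fun i => c i + n)).subset fun y hy => ⟨fun i => ?_, fun i => ?_⟩ <;>
  · have := abs_le.1 (hy i); simp only; omega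

theorem bx_mono (c : Vtx d) {m n : ℕ} (h : m ≤ n) : bx c m ⊆ bx c n := fun y hy i => by
  have := hy i; omega

theorem bx_self (c : Vtx d) (n : ℕ) : c ∈ bx c n := fun i => by simp

theorem bx_adj {c u x : Vtx d} {n : ℕ} (h : u ∈ bx c n) (a : adj u x) : x ∈ bx c (n + 1) := fun i => by
  have h1 := h i; have h2 := adj_le a i
  rw [abs_le] at *; push_cast; omega

def op (ω : Config d) : Set (Vtx d) := {v | ω v = true}

/-- exits from `bx c n` reachable from `bx c m` -/
def Nx (c : Vtx d) (m n : ℕ) (O : Set (Vtx d)) : Set (Vtx d) :=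
  {x | x ∉ bx c n ∧ ∃ u ∈ bx c n, adj u x ∧ Rch (O ∩ bx c n) (bx c m) u}

theorem Nx_sub (c : Vtx d) (m n : ℕ) (O : Set (Vtx d)) : Nx c m n O ⊆ bx c (n + 1) :=
  fun _ ⟨_, _, hu, a, _⟩ => bx_adj hu a

theorem Nx_fin (c : Vtx d) (m n : ℕ) (O : Set (Vtx d)) : (Nx c m n O).Finite :=
  (bx_fin c (n + 1)).subset (Nx_sub c m n O)

theorem Nx_mono (c : Vtx d) (m n : ℕ) {O O' : Set (Vtx d)} (h : O ⊆ O') : Nx c m n O ⊆ Nx c m n O' :=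
  fun _ ⟨h0, u, hu, a, r⟩ => ⟨h0, u, hu, a, r.mono (inter_subset_inter_left _ h) subset_rfl⟩

theorem op_inter_congr {B : Set (Vtx d)} {ω ω' : Config d} (h : ∀ v ∈ B, ω v = ω' v) :
    op ω ∩ B = op ω' ∩ B := by
  ext v; simp only [op, mem_inter_iff, mem_setOf_eq]
  constructor <;> rintro ⟨a, b⟩ <;> simp_all

theorem Nx_dep (c : Vtx d) (m n : ℕ) (E : Set (Vtx d) → Prop) :
    dep {ω : Config d | E (Nx c m n (op ω))} (bx c n) := by
  intro ω ω' h h'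
  have := op_inter_congr h
  simp only [mem_setOf_eq, Nx] at *
  rwa [← this]

/-- If exits of box `bx c n` from `bx c m` are all closed, then exploration is confined. -/
theorem confine {c c' : Vtx d} {m m' n n' : ℕ} (hmn : m ≤ n) {O : Set (Vtx d)} (hN : ∀ x ∈ Nx c m n O, x ∉ O)
    (h1 : bx c' m' ⊆ bx c m) {u} (h : Rch (O ∩ bx c' n') (bx c' m') u) :
    u ∈ bx c n ∧ Rch (O ∩ bx c n) (bx c m) u := by
  induction h with
  | base h => exact ⟨bx_mono c hmn (h1 h), .base (h1 h)⟩
  | @step u v _ a hv ih =>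
    by_cases hvn : v ∈ bx c n
    · exact ⟨hvn, .step ih.2 a ⟨hv.1, hvn⟩⟩
    · exact absurd hv.1 (hN v ⟨hvn, u, ih.1, a, ih.2⟩)

theorem Nx_empty {c c' : Vtx d} {m m' n n' : ℕ} (hmn : m ≤ n) {O : Set (Vtx d)} (hN : Nx c m n O = ∅)
    (h1 : bx c' m' ⊆ bx c m) (h2 : bx c n ⊆ bx c' n') : Nx c' m' n' O = ∅ := by
  refine eq_empty_iff_forall_notMem.2 ?_
  rintro x ⟨hx, u, hu, a, r⟩
  obtain ⟨k1, k2⟩ := confine hmn (by simp [hN]) h1 r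
  have : x ∈ Nx c m n O := ⟨fun h => hx (h2 h), u, k1, a, k2⟩
  simp [hN] at this

noncomputable def bern (q : unitInterval) : PMF Bool :=
  PMF.ofFintype (fun b => ENNReal.ofReal (if b then (q : ℝ) else 1 - q)) (by
    simp [← ENNReal.ofReal_add q.2.1 (sub_nonneg.2 q.2.2)])

theorem bern_true (q : unitInterval) : (bern q true).toReal = q := by
  simp [bern, q.2.1]
theorem bern_false (q : unitInterval) : (bern q false).toReal = 1 - q := by
  simp [bern, q.2.2]

noncomputable abbrev PB (d : ℕ) (q : unitInterval) : Measure (Config d) := Pm fun _ => bern q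

theorem dep_pre {ι : Type} {A : Set (ι → Bool)} {s : Set ι} (h : dep A s) (e : ι ≃ ι) :
    dep ((fun ω => ω ∘ e) ⁻¹' A) (e '' s) := fun ω ω' h' hA =>
  h _ _ (fun v hv => h' (e v) ⟨v, hv, rfl⟩) hA

def tr (c : Vtx d) : Vtx d ≃ Vtx d := Equiv.addRight c

theorem adj_tr (c u v : Vtx d) : adj (tr c u) (tr c v) ↔ adj u v := by
  simp [adj, tr]

theorem Nx_tr (c : Vtx d) (m n : ℕ) (O : Set (Vtx d)) :
    Nx c m n O = ∅ ↔ Nx 0 m n (tr c ⁻¹' O) = ∅ := by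
  have hb : ∀ n v, tr c v ∈ bx c n ↔ v ∈ bx 0 n := by intro n v; simp [bx, tr]
  have hs : ∀ n v, (tr c).symm v ∈ bx 0 n ↔ v ∈ bx c n := by intro n v; rw [← hb]; simp
  simp only [eq_empty_iff_forall_notMem, not_iff_not, Nx, mem_setOf_eq]
  constructor
  · rintro h x ⟨hx, u, hu, a, r⟩
    refine h (tr c x) ⟨by rwa [hb], tr c u, by rwa [hb], by rwa [adj_tr], ?_⟩
    exact r.map (O' := O ∩ bx c n) (S' := bx c m) (tr c) (fun _ _ => (adj_tr _ _ _).2) (fun v hv => ⟨hv.1, (hb _ _).2 hv.2⟩) (fun v => (hb _ _).2)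
  · rintro h x ⟨hx, u, hu, a, r⟩
    refine h ((tr c).symm x) ⟨by rwa [hs], (tr c).symm u, by rwa [hs], by rw [← adj_tr c]; simpa, ?_⟩
    exact r.map (O' := tr c ⁻¹' O ∩ bx 0 n) (S' := bx 0 m) (tr c).symm (fun u v h => by rw [← adj_tr c]; simpa)
      (fun v hv => ⟨by simpa using hv.1, (hs _ _).2 hv.2⟩) (fun v => (hs _ _).2)

noncomputable def fE (q : unitInterval) (d m n : ℕ) : ℝ :=
  (PB d q).real {ω | Nx 0 m n (op ω) = ∅}

theorem fE_tr (q : unitInterval) (c : Vtx d) (m n : ℕ) :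
    (PB d q).real {ω | Nx c m n (op ω) = ∅} = fE q d m n := by
  rw [fE, ← Pm_map (bern q) (tr c) ((Nx_dep 0 m n (· = ∅)).meas (bx_fin 0 n))]
  congr 1; ext ω; simp only [mem_setOf_eq, mem_preimage]; rw [Nx_tr]; rfl

theorem lem1a [NeZero d] (q : unitInterval) {θ : ℝ} (hθ : 0 < θ) (h0 : ∀ n, fE q d 0 n ≤ 1 - θ) {ε : ℝ} (hε : 0 < ε) :
    ∃ m, ∀ n, m ≤ n → fE q d m n < ε := by
  let f : ℕ → ℕ → ℝ := fun m j => fE q d m (m + j)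
  have f1 : ∀ m j, f m j ≤ 1 := fun m j => measureReal_le_one
  have f0 : ∀ m j, 0 ≤ f m j := fun m j => measureReal_nonneg
  have bd : ∀ m, BddAbove (range (f m)) := fun m => ⟨1, by rintro _ ⟨j, rfl⟩; exact f1 m j⟩
  let F : ℕ → ℝ := fun m => ⨆ j, f m j
  have F0 : ∀ m, 0 ≤ F m := fun m => (f0 m 0).trans (le_ciSup (bd m) 0)
  have bF : BddBelow (range F) := ⟨0, by rintro _ ⟨j, rfl⟩; exact F0 j⟩
  set a := ⨅ m, F m with ha
  have a0 : 0 ≤ a := le_ciInf F0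
  have key : ∀ m δ, 0 < δ → a ≤ F m ^ 2 + 2 * δ := by
    intro m δ hδ
    obtain ⟨j, hj⟩ := exists_lt_of_lt_ciSup (show F m - δ < ⨆ j, f m j by simp only [F]; linarith)
    set n := m + j with hn
    set K := 2 * n + 3
    let c : Vtx d := fun i => if i = 0 then (K : ℤ) else 0
    refine (ciInf_le bF (m + K)).trans (ciSup_le fun j' => ?_)
    let A : ℕ → Set (Config d) := fun n => {ω | Nx 0 m n (op ω) = ∅}
    let B : ℕ → Set (Config d) := fun n => {ω | Nx c m n (op ω) = ∅}
    have dA : ∀ n, dep (A n) (bx 0 n) := fun n => Nx_dep 0 m n (· = ∅)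
    have dB : ∀ n, dep (B n) (bx c n) := fun n => Nx_dep c m n (· = ∅)
    have mA : ∀ n, MeasurableSet (A n) := fun n => (dA n).meas (bx_fin _ _)
    have mB : ∀ n, MeasurableSet (B n) := fun n => (dB n).meas (bx_fin _ _)
    set n' := m + K + j'
    set n2 := n' + K
    have hc : ∀ i, 0 ≤ c i ∧ c i ≤ K := fun i => by simp only [c]; split_ifs <;> simp
    have s1 : {ω | Nx 0 (m + K) n' (op ω) = ∅} ⊆ A n2 ∩ B n2 := by
      intro ω h
      refine ⟨Nx_empty (by omega) h (bx_mono _ (by omega)) (bx_mono _ (by omega)),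
        Nx_empty (by omega) h (fun y hy i => ?_) (fun y hy i => ?_)⟩ <;>
      · have h1 := hy i; have h2 := hc i; simp only [Pi.zero_apply, sub_zero, abs_le] at *; push_cast [n2] at *; omega
    have s2 : A n2 ∩ B n2 ⊆ (A n ∩ B n) ∪ (A n2 \ A n) ∪ (B n2 \ B n) := by
      rintro ω ⟨h1, h2⟩
      by_cases h3 : ω ∈ A n <;> by_cases h4 : ω ∈ B n <;> simp [h1, h2, h3, h4]
    have e1 : (PB d q).real (A n ∩ B n) = f m j ^ 2 := by
      rw [Pm_indep _ (dA n) (dB n) (bx_fin _ _) (bx_fin _ _), sq]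
      · congr 1; exact fE_tr q c m n
      · refine disjoint_left.2 fun y h1 h2 => ?_
        have h1 := h1 0; have h2 := h2 0; simp only [c, Pi.zero_apply, sub_zero, abs_le, if_true] at *
        push_cast [K] at *; omega
    have e2 : (PB d q).real (A n2 \ A n) ≤ δ := by
      have hs : A n ⊆ A n2 := fun ω h => Nx_empty (by omega) h subset_rfl (bx_mono _ (by omega))
      rw [measureReal_sdiff hs (mA n)]
      have : (PB d q).real (A n2) ≤ F m := by
        have := le_ciSup (bd m) (n2 - m); simp only [f] at this
        rwa [show m + (n2 - m) = n2 by omega] at this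
      have e : (PB d q).real (A n) = f m j := rfl
      linarith
    have e3 : (PB d q).real (B n2 \ B n) ≤ δ := by
      have hs : B n ⊆ B n2 := fun ω h => Nx_empty (by omega) h subset_rfl (bx_mono _ (by omega))
      rw [measureReal_sdiff hs (mB n),
        fE_tr, fE_tr]
      have : fE q d m n2 ≤ F m := by
        have := le_ciSup (bd m) (n2 - m); simp only [f] at this
        rwa [show m + (n2 - m) = n2 by omega] at this
      have e : fE q d m n = f m j := rfl
      linarith
    have : f (m + K) j' ≤ f m j ^ 2 + δ + δ := by
      calc _ ≤ (PB d q).real ((A n ∩ B n) ∪ (A n2 \ A n) ∪ (B n2 \ B n)) := measureReal_mono (s1.trans s2)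
        _ ≤ (PB d q).real ((A n ∩ B n) ∪ (A n2 \ A n)) + (PB d q).real (B n2 \ B n) := measureReal_union_le _ _
        _ ≤ _ := by
          have := measureReal_union_le (μ := PB d q) (A n ∩ B n) (A n2 \ A n)
          linarith
    have : f m j ^ 2 ≤ F m ^ 2 := pow_le_pow_left₀ (f0 _ _) (le_ciSup (bd m) j) 2
    linarith
  have key2 : ∀ m, a ≤ F m ^ 2 := fun m => le_of_forall_pos_le_add fun δ hδ => by
    have := key m (δ / 2) (by linarith); linarith
  have key3 : a ≤ a ^ 2 := by
    refine le_of_forall_pos_le_add fun δ hδ => ?_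
    obtain ⟨m, hm⟩ := exists_lt_of_ciInf_lt (show ⨅ m, F m < a + min 1 (δ / (2 * a + 1)) by
      have : 0 < δ / (2 * a + 1) := by positivity
      rw [← ha]; linarith [lt_min one_pos this])
    set η := min 1 (δ / (2 * a + 1))
    have h1 : η ≤ 1 := min_le_left _ _
    have h2 : η * (2 * a + 1) ≤ δ := (le_div_iff₀ (by positivity)).1 (min_le_right _ _)
    have h3 : 0 ≤ η := le_min zero_le_one (by positivity)
    have := key2 m
    have : F m ^ 2 ≤ (a + η) ^ 2 := pow_le_pow_left₀ (F0 _) hm.le 2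
    nlinarith
  have a1 : a ≤ 1 - θ := (ciInf_le bF 0).trans (ciSup_le fun j => h0 _)
  have a2 : a = 0 := by nlinarith
  obtain ⟨m, hm⟩ := exists_lt_of_ciInf_lt (show ⨅ m, F m < ε by rw [← ha, a2]; exact hε)
  refine ⟨m, fun n hn => lt_of_le_of_lt ?_ hm⟩
  have := le_ciSup (bd m) (n - m); simp only [f] at this
  rwa [show m + (n - m) = n by omega] at this
end B1
section B2
variable {d : ℕ}

theorem dep_const {ι : Type} (s : Finset ι) (c : Bool) : dep {ω : ι → Bool | ∀ v ∈ s, ω v = c} s :=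
  fun ω ω' h h' v hv => by rw [← h v hv]; exact h' v hv

theorem P_closed {ι : Type} (q : unitInterval) (s : Finset ι) :
    (Pm fun _ : ι => bern q).real {ω | ∀ v ∈ s, ω v = false} = (1 - (q : ℝ)) ^ s.card := by
  rw [measureReal_def, Pm_cyl (fun _ => bern q) s (fun _ => false), ENNReal.toReal_prod]
  simp [bern_false]
theorem P_open {ι : Type} (q : unitInterval) (s : Finset ι) :
    (Pm fun _ : ι => bern q).real {ω | ∀ v ∈ s, ω v = true} = (q : ℝ) ^ s.card := by
  rw [measureReal_def, Pm_cyl (fun _ => bern q) s (fun _ => true), ENNReal.toReal_prod]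
  simp [bern_true]

theorem lem1b (q : unitInterval) (hq : (q : ℝ) < 1) (m a k : ℕ) (ha : 0 < a) {η : ℝ} (hη : 0 < η) :
    ∃ r, 1 ≤ r ∧ (PB d q).real {ω | (Nx 0 m (a * r + m) (op ω)).Nonempty ∧
      (Nx 0 m (a * r + m) (op ω)).ncard < k} ≤ η := by
  by_contra! hc
  set g := (1 - (q : ℝ)) ^ k with hg
  have g0 : 0 < g := pow_pos (by linarith) _
  obtain ⟨R, hR⟩ := exists_nat_gt (1 / (g * η))
  let n : ℕ → ℕ := fun r => a * (r + 1) + m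
  let D : ℕ → Set (Config d) := fun r => {ω | (Nx 0 m (n r) (op ω)).Nonempty ∧ ∀ x ∈ Nx 0 m (n r) (op ω), ω x = false}
  have dN : ∀ r σ, dep {ω : Config d | Nx 0 m (n r) (op ω) = σ} (bx 0 (n r)) := fun r σ => Nx_dep 0 m (n r) (· = σ)
  have dD : ∀ r, dep (D r) (bx 0 (n r + 1)) := by
    intro r ω ω' h h'
    have e : Nx 0 m (n r) (op ω') = Nx 0 m (n r) (op ω) :=
      (dN r _).iff (fun v hv => h v (bx_mono _ (Nat.le_succ _) hv)) |>.1 rfl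
    simp only [D, mem_setOf_eq, e] at *
    exact ⟨h'.1, fun x hx => by rw [← h x (Nx_sub _ _ _ _ hx)]; exact h'.2 x hx⟩
  have mD : ∀ r, MeasurableSet (D r) := fun r => (dD r).meas (bx_fin _ _)
  have disj : ∀ r r', r < r' → Disjoint (D r) (D r') := by
    intro r r' hr
    refine disjoint_left.2 fun ω h1 h2 => ?_
    obtain ⟨x, hx, u, hu, a', ru⟩ := h2.1
    have := confine (m := m) (n := n r) (n' := n r') (Nat.le_add_left m _) (fun x hx => by simp [op, h1.2 x hx]) (subset_refl (bx 0 m)) ru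
    exact hx (bx_mono _ (by simp only [n]; nlinarith) (bx_adj this.1 a'))
  have low : ∀ r, g * η ≤ (PB d q).real (D r) := by
    intro r
    have h1 := hc (r + 1) (by omega)
    let E : Set (Set (Vtx d)) := {σ | σ.Nonempty ∧ σ.ncard < k ∧ σ.Finite ∧ Disjoint (bx 0 (n r)) σ}
    have hE : ∀ ω : Config d, (Nx 0 m (n r) (op ω)).Nonempty ∧ (Nx 0 m (n r) (op ω)).ncard < k →
        Nx 0 m (n r) (op ω) ∈ E := fun ω h => ⟨h.1, h.2, Nx_fin _ _ _ _, disjoint_right.2 fun x hx => hx.1⟩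
    have := Pm_fiber (fun _ => bern q) (fun ω : Config d => Nx 0 m (n r) (op ω)) (bx_fin 0 (n r)) (dN r) E
      (D r)ᶜ (1 - g) (by
        rintro σ ⟨s1, s2, s3, s4⟩
        lift σ to Finset (Vtx d) using s3
        refine ⟨bx 0 (n r), σ, {ω | ∀ v ∈ σ, ω v = false}ᶜ, bx_fin _ _, σ.finite_toSet, s4, dN r _,
          (dep_const σ false).compl, ?_, ?_⟩
        · rw [probReal_compl_eq_one_sub ((dep_const σ false).meas σ.finite_toSet), P_closed]
          rw [ncard_coe_finset] at s2
          have := pow_le_pow_of_le_one (a := 1 - (q : ℝ)) (by linarith) (by linarith [q.2.1]) s2.le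
          linarith
        · rintro ω ⟨h1, h2⟩ h3
          simp only [mem_setOf_eq] at h1 h3
          exact h2 ⟨by rw [h1]; exact s1, by rw [h1]; simpa using h3⟩)
    set T := {ω : Config d | Nx 0 m (n r) (op ω) ∈ E}
    have mT : η ≤ (PB d q).real T := h1.le.trans (measureReal_mono fun ω h => hE ω h)
    have hs : T ⊆ (T ∩ (D r)ᶜ) ∪ D r := fun ω h => by
      by_cases h' : ω ∈ D r <;> simp [h, h']
    have := (measureReal_mono (μ := PB d q) hs).trans (measureReal_union_le _ _)
    nlinarith
  have hsum : ∑ r ∈ Finset.range R, (PB d q).real (D r) ≤ 1 := by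
    rw [← measureReal_biUnion_finset (fun r _ r' _ hrr => ?_) (fun r _ => mD r)]
    · exact measureReal_le_one
    · rcases lt_or_gt_of_ne hrr with h | h
      · exact disj _ _ h
      · exact (disj _ _ h).symm
  have := (Finset.sum_le_sum fun r (_ : r ∈ Finset.range R) => low r).trans hsum
  rw [Finset.sum_const, Finset.card_range, nsmul_eq_mul] at this
  rw [div_lt_iff₀ (by positivity)] at hR
  linarith

variable [NeZero d]
/-- frame -/
def fr (b : Vtx d) (i : Fin d) (s : Fin d → ℤˣ) : Vtx d ≃ Vtx d where
  toFun x j := b j + s j * x (Equiv.swap i 0 j)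
  invFun y k := s (Equiv.swap i 0 k) * (y (Equiv.swap i 0 k) - b (Equiv.swap i 0 k))
  left_inv x := by
    funext k; simp only [Equiv.swap_apply_self, add_sub_cancel_left, ← mul_assoc, Int.units_coe_mul_self, one_mul]
  right_inv y := by
    funext k; simp only [Equiv.swap_apply_self, ← mul_assoc, Int.units_coe_mul_self]; ring

theorem fr_adj (b : Vtx d) (i : Fin d) (s : Fin d → ℤˣ) {u v : Vtx d} (h : adj u v) : adj (fr b i s u) (fr b i s v) := by
  obtain ⟨k, h1, h2⟩ := adj_ex h
  refine adj_of (Equiv.swap i 0 k) ?_ fun j hj => ?_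
  · simp only [fr, Equiv.coe_fn_mk, Equiv.swap_apply_self, add_sub_add_left_eq_sub, ← mul_sub, abs_mul, h1]
    rcases Int.units_eq_one_or (s (Equiv.swap i 0 k)) with h | h <;> simp [h]
  · simp only [fr, Equiv.coe_fn_mk]; rw [h2]; rintro rfl; simp at hj

theorem unit_abs (e : ℤˣ) (x : ℤ) : |(e : ℤ) * x| = |x| := by
  rcases Int.units_eq_one_or e with h | h <;> simp [h]

theorem fr_symm_adj (b : Vtx d) (i : Fin d) (s : Fin d → ℤˣ) {u v : Vtx d} (h : adj u v) :
    adj ((fr b i s).symm u) ((fr b i s).symm v) := by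
  obtain ⟨k, h1, h2⟩ := adj_ex h
  refine adj_of (Equiv.swap i 0 k) ?_ fun j hj => ?_
  · simp only [fr, Equiv.coe_fn_symm_mk, Equiv.swap_apply_self, ← mul_sub, unit_abs]
    rw [← h1]; congr 1; ring
  · simp only [fr, Equiv.coe_fn_symm_mk]; rw [h2]; rintro rfl; simp at hj

theorem fr_bx (b : Vtx d) (i : Fin d) (s : Fin d → ℤˣ) (n : ℕ) (c x : Vtx d) :
    fr b i s x ∈ bx (fr b i s c) n ↔ x ∈ bx c n := by
  simp only [bx, mem_setOf_eq, fr, Equiv.coe_fn_mk, add_sub_add_left_eq_sub, ← mul_sub, unit_abs]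
  exact ⟨fun h k => by simpa using h (Equiv.swap i 0 k), fun h k => h _⟩

theorem fr_zero (b : Vtx d) (i : Fin d) (s : Fin d → ℤˣ) : fr b i s 0 = b := by
  funext k; simp [fr]

/-- standard piece of the exit set -/
def N0 (m ρ : ℕ) (O : Set (Vtx d)) : Set (Vtx d) :=
  {x | x ∈ Nx 0 m ρ O ∧ x 0 = ρ + 1 ∧ ∀ j ≠ 0, 0 ≤ x j ∧ x j ≤ ρ}

theorem N0_cover {m ρ : ℕ} {O : Set (Vtx d)} {x} (hx : x ∈ Nx 0 m ρ O) :
    ∃ i s, (fr 0 i s).symm x ∈ N0 m ρ (fr 0 i s ⁻¹' O) := by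
  obtain ⟨h1, u, hu, a, r⟩ := hx
  have h2 : ∃ i, (ρ : ℤ) < |x i| := by simpa [bx] using h1
  obtain ⟨i, hi⟩ := h2
  have hx1 : ∀ j, |x j| ≤ ρ + 1 := fun j => by simpa using bx_adj hu a j
  obtain ⟨k, hk, hk'⟩ := adj_ex a
  have hki : k = i := by
    by_contra hne
    have := hu i; rw [hk' i (Ne.symm hne)] at this; simp at this; omega
  subst hki
  let s : Fin d → ℤˣ := fun j => if 0 ≤ x j then 1 else -1
  have hs : ∀ j, (s j : ℤ) * x j = |x j| := by
    intro j; simp only [s]; split_ifs with h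
    · simp [abs_of_nonneg h]
    · simp [abs_of_neg (not_le.1 h)]
  have hb : ∀ n v, (fr 0 k s).symm v ∈ bx 0 n ↔ v ∈ bx 0 n := by
    intro n v; rw [← fr_bx 0 k s]; simp [fr_zero]
  refine ⟨k, s, ⟨by rwa [hb], (fr 0 k s).symm u, by rwa [hb], fr_symm_adj _ _ _ a, ?_⟩, ?_, ?_⟩
  · exact r.map (O' := fr 0 k s ⁻¹' O ∩ bx 0 ρ) (S' := bx 0 m) _ (fun _ _ => fr_symm_adj _ _ _) (fun v hv => ⟨by simpa using hv.1, (hb _ _).2 hv.2⟩)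
      (fun v => (hb _ _).2)
  · simp only [fr, Equiv.coe_fn_symm_mk, Equiv.swap_apply_right, Pi.zero_apply, sub_zero, hs]
    have := hx1 k; omega
  · intro j hj
    simp only [fr, Equiv.coe_fn_symm_mk, Pi.zero_apply, sub_zero, hs]
    refine ⟨abs_nonneg _, ?_⟩
    have hne : Equiv.swap k 0 j ≠ k := by
      intro h; apply hj; have := congrArg (Equiv.swap k 0) h; simpa using this
    have := hu (Equiv.swap k 0 j); rw [hk' _ hne] at this; simpa using this

theorem N0_dep (m ρ : ℕ) (E : Set (Vtx d) → Prop) : dep {ω : Config d | E (N0 m ρ (op ω))} (bx 0 ρ) :=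
  Nx_dep 0 m ρ (fun σ => E {x | x ∈ σ ∧ x 0 = ρ + 1 ∧ ∀ j ≠ 0, 0 ≤ x j ∧ x j ≤ ρ})

theorem N0_fin (m ρ : ℕ) (O : Set (Vtx d)) : (N0 m ρ O).Finite := (Nx_fin 0 m ρ O).subset fun _ h => h.1

theorem harris_prod {ι κ : Type} (w : ι → PMF Bool) (s : Set ι) (hs : s.Finite) (T : Finset κ) (A : κ → Set (ι → Bool))
    (hA : ∀ k, dep (A k) s) (mA : ∀ k, ∀ ω ω' : ι → Bool, ω ≤ ω' → ω' ∈ A k → ω ∈ A k) :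
    ∏ k ∈ T, (Pm w).real (A k) ≤ (Pm w).real {ω | ∀ k ∈ T, ω ∈ A k} := by
  classical
  induction T using Finset.induction_on with
  | empty => simp
  | insert k T hk ih =>
    rw [Finset.prod_insert hk]
    have := harris w hs (A := A k) (B := {ω | ∀ k ∈ T, ω ∈ A k}) (hA k)
      (fun ω ω' h h' k hk => hA k ω ω' h (h' k hk)) (mA k) (fun ω ω' h h' k hk => mA k ω ω' h (h' k hk))
    refine (mul_le_mul_of_nonneg_left ih measureReal_nonneg).trans (this.trans (measureReal_mono ?_))
    rintro ω ⟨h1, h2⟩ k' hk'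
    rcases Finset.mem_insert.1 hk' with rfl | h
    exacts [h1, h2 _ h]

theorem lem1c (q : unitInterval) (m ρ k : ℕ) {ε : ℝ} (h0 : 0 ≤ ε)
    (h : (PB d q).real {ω | (Nx 0 m ρ (op ω)).ncard < Fintype.card (Fin d × (Fin d → ℤˣ)) * k} ≤
      ε ^ Fintype.card (Fin d × (Fin d → ℤˣ))) (hk : 0 < k) :
    (PB d q).real {ω | (N0 m ρ (op ω)).ncard < k} ≤ ε := by
  classical
  let A : Fin d × (Fin d → ℤˣ) → Set (Config d) := fun F => (fun ω => ω ∘ fr 0 F.1 F.2) ⁻¹' {ω | (N0 m ρ (op ω)).ncard < k}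
  have d0 : dep {ω : Config d | (N0 m ρ (op ω)).ncard < k} (bx 0 ρ) := N0_dep m ρ (fun σ => σ.ncard < k)
  have hA : ∀ F, dep (A F) (bx 0 ρ) := by
    intro F
    refine (dep_pre d0 (fr 0 F.1 F.2)).mono ?_
    rintro _ ⟨x, hx, rfl⟩
    have := (fr_bx 0 F.1 F.2 ρ 0 x).2 hx; rwa [fr_zero] at this
  have mA : ∀ F, ∀ ω ω' : Config d, ω ≤ ω' → ω' ∈ A F → ω ∈ A F := by
    intro F ω ω' hle h'
    refine lt_of_le_of_lt (ncard_le_ncard ?_ (N0_fin _ _ _)) h'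
    rintro x ⟨h1, h2⟩
    refine ⟨Nx_mono _ _ _ ?_ h1, h2⟩
    intro v hv
    have := hle (fr 0 F.1 F.2 v)
    simp only [op, mem_setOf_eq, Function.comp] at *
    rw [hv] at this; exact Bool.eq_true_of_true_le this
  have h1 := harris_prod (fun _ => bern q) (bx 0 ρ) (bx_fin _ _) Finset.univ A hA mA
  have h2 : ∀ F, (PB d q).real (A F) = (PB d q).real {ω | (N0 m ρ (op ω)).ncard < k} :=
    fun F => Pm_map (bern q) _ (d0.meas (bx_fin _ _))
  simp only [h2, Finset.prod_const, Finset.card_univ] at h1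
  have h3 : {ω : Config d | ∀ F ∈ Finset.univ, ω ∈ A F} ⊆
      {ω | (Nx 0 m ρ (op ω)).ncard < Fintype.card (Fin d × (Fin d → ℤˣ)) * k} := by
    intro ω hω
    simp only [Finset.mem_univ, true_imp_iff, mem_setOf_eq] at hω ⊢
    have hs : Nx 0 m ρ (op ω) ⊆ ⋃ F : Fin d × (Fin d → ℤˣ), fr 0 F.1 F.2 '' N0 m ρ (op (ω ∘ fr 0 F.1 F.2)) := by
      intro x hx
      obtain ⟨i, s, h⟩ := N0_cover hx
      exact mem_iUnion.2 ⟨(i, s), _, h, by simp⟩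
    have hc := (ncard_le_ncard hs (finite_iUnion fun F => (N0_fin _ _ _).image _))
    have hc2 : (⋃ F : Fin d × (Fin d → ℤˣ), fr 0 F.1 F.2 '' N0 m ρ (op (ω ∘ fr 0 F.1 F.2))).ncard ≤
        ∑ F : Fin d × (Fin d → ℤˣ), (fr 0 F.1 F.2 '' N0 m ρ (op (ω ∘ fr 0 F.1 F.2))).ncard := by
      exact ncard_iUnion_le_of_fintype _
    refine (hc.trans hc2).trans_lt ?_
    calc _ < ∑ F : Fin d × (Fin d → ℤˣ), k := by
          refine Finset.sum_lt_sum_of_nonempty ⟨(0, 1), Finset.mem_univ _⟩ fun F _ => ?_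
          exact (ncard_image_le (N0_fin _ _ _)).trans_lt (hω F)
      _ = _ := by simp
  exact le_of_pow_le_pow_left₀ Fintype.card_ne_zero h0 (h1.trans ((measureReal_mono h3).trans h))
end B2
section B3
variable {d : ℕ} [NeZero d]

theorem P_none {ι κ : Type} [DecidableEq ι] (q : unitInterval) (T : Finset κ) (s : κ → Finset ι)
    (hs : ∀ c ∈ T, ∀ c' ∈ T, c ≠ c' → Disjoint (s c) (s c')) :
    (Pm fun _ : ι => bern q).real {ω | ∀ c ∈ T, ¬ ∀ v ∈ s c, ω v = true} = ∏ c ∈ T, (1 - (q : ℝ) ^ (s c).card) := by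
  classical
  induction T using Finset.induction_on with
  | empty => simp
  | insert k T hk ih =>
    rw [Finset.prod_insert hk, ← ih fun c hc c' hc' => hs c (by simp [hc]) c' (by simp [hc']), ← P_open q (s k),
      ← probReal_compl_eq_one_sub ((dep_const (s k) true).meas (s k).finite_toSet),
      ← Pm_indep (s := s k) (t := T.biUnion s) _ (dep_const (s k) true).compl _ (s k).finite_toSet (Finset.finite_toSet _)]
    · congr 1; ext ω; simp
    · rw [Finset.disjoint_coe, Finset.disjoint_biUnion_right]
      exact fun c hc => hs k (by simp) c (by simp [hc]) (by rintro rfl; exact hk hc)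
    · intro ω ω' h h' c hc h2
      refine h' c hc fun v hv => ?_
      rw [h v (by simp only [Finset.coe_biUnion, mem_iUnion]; exact ⟨c, hc, hv⟩)]; exact h2 v hv

def rho (m r : ℕ) : ℕ := (2 * m + 1) * r + m
def hh (m r : ℕ) : ℕ := rho m r + 2 + m

def lay0 (d m r : ℕ) [NeZero d] : Set (Vtx d) := {x | x 0 = rho m r + 1 ∧ ∀ j ≠ 0, -(m : ℤ) ≤ x j ∧ x j ≤ rho m r}
def zone0 (d m r : ℕ) [NeZero d] : Set (Vtx d) :=
  {x | ((rho m r : ℤ) + 2 ≤ x 0 ∧ x 0 ≤ rho m r + 2 + 2 * m) ∧ ∀ j ≠ 0, -(m : ℤ) ≤ x j ∧ x j ≤ rho m r}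
def grid0 (d m r : ℕ) [NeZero d] : Set (Vtx d) :=
  {c | c 0 = hh m r ∧ ∀ j ≠ 0, ∃ k : ℤ, 0 ≤ k ∧ k ≤ r ∧ c j = (2 * m + 1) * k}
def G0 (m r : ℕ) (O : Set (Vtx d)) : Prop :=
  ∃ c ∈ grid0 d m r, bx c m ⊆ O ∧ ∃ x ∈ lay0 d m r, x ∈ O ∧ (∀ j ≠ 0, |x j - c j| ≤ m) ∧
    ∃ u ∈ bx 0 (rho m r), adj u x ∧ Rch (O ∩ bx 0 (rho m r)) (bx 0 m) u
def Lam0 (d m r : ℕ) [NeZero d] : Set (Vtx d) := bx 0 (rho m r) ∪ lay0 d m r ∪ zone0 d m r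

theorem Lam0_sub (d m r : ℕ) [NeZero d] : Lam0 d m r ⊆ bx 0 (rho m r + 2 + 2 * m) := by
  rintro x ((h | h) | h) j
  · have := h j; push_cast; omega
  all_goals
    simp only [Pi.zero_apply, sub_zero, abs_le]
    by_cases hj : j = 0
    · subst hj; have := h.1; push_cast; omega
    · have := h.2 j hj; push_cast; omega

theorem Lam0_fin (d m r : ℕ) [NeZero d] : (Lam0 d m r).Finite := (bx_fin _ _).subset (Lam0_sub d m r)

theorem grid_zone {m r : ℕ} {c : Vtx d} (hc : c ∈ grid0 d m r) : bx c m ⊆ zone0 d m r := by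
  intro y hy
  have h0 := abs_le.1 (hy 0); rw [hc.1] at h0
  refine ⟨by simp only [hh] at h0; push_cast at h0; omega, fun j hj => ?_⟩
  obtain ⟨k, k0, k1, e⟩ := hc.2 j hj
  have h1 := abs_le.1 (hy j); rw [e] at h1
  have h2 : (2 * (m : ℤ) + 1) * k ≤ (2 * m + 1) * r := by gcongr
  have h3 : 0 ≤ (2 * (m : ℤ) + 1) * k := by positivity
  simp only [rho]; push_cast; omega

theorem G0_dep (m r : ℕ) : dep {ω : Config d | G0 m r (op ω)} (Lam0 d m r) := by
  rintro ω ω' h ⟨c, hc, h1, x, hx, h2, h3, u, hu, a, R⟩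
  refine ⟨c, hc, fun y hy => ?_, x, hx, ?_, h3, u, hu, a, ?_⟩
  · have := h1 hy; simp only [op, mem_setOf_eq] at *; rw [← h y (.inr (grid_zone hc hy))]; exact this
  · simp only [op, mem_setOf_eq] at *; rw [← h x (.inl (.inr hx))]; exact h2
  · rwa [← op_inter_congr fun v hv => h v (.inl (.inl hv))]

theorem seed_std (q : unitInterval) (m r M : ℕ) (N : ℕ) (hN : ∀ c : Vtx d, (bx c m).ncard = N) :
    (PB d q).real {ω | ¬ G0 m r (op ω)} ≤
      (PB d q).real {ω : Config d | (N0 m (rho m r) (op ω)).ncard < N * M} + (1 - (q : ℝ) ^ (1 + N)) ^ M := by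
  classical
  set ρ := rho m r with hρ
  set β := (q : ℝ) ^ (1 + N)
  have b0 : 0 ≤ β := pow_nonneg q.2.1 _
  have b1 : β ≤ 1 := pow_le_one₀ q.2.1 q.2.2
  let E : Set (Set (Vtx d)) := {σ | N * M ≤ σ.ncard ∧ ∃ ω : Config d, σ = N0 m ρ (op ω)}
  have := Pm_fiber (fun _ => bern q) (fun ω : Config d => N0 m ρ (op ω)) (bx_fin 0 ρ)
    (fun σ => N0_dep m ρ (· = σ)) E {ω | ¬ G0 m r (op ω)} ((1 - β) ^ M) (by
      rintro σ ⟨h1, ω0, e0⟩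
      have hσ : ∀ x ∈ σ, x 0 = ρ + 1 ∧ ∀ j ≠ 0, 0 ≤ x j ∧ x j ≤ ρ := by rw [e0]; exact fun x hx => hx.2
      have hfin : σ.Finite := by rw [e0]; exact N0_fin _ _ _
      lift σ to Finset (Vtx d) using hfin
      rw [ncard_coe_finset] at h1
      let cell : Vtx d → Vtx d := fun x j => if j = 0 then (hh m r : ℤ) else (2 * m + 1) * ((x j + m) / (2 * m + 1))
      have hcell : ∀ x, ∀ j ≠ 0, |x j - cell x j| ≤ m := by
        intro x j hj
        simp only [cell, hj, if_false]
        have e1 := Int.emod_add_mul_ediv (x j + m) (2 * m + 1)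
        have e2 := Int.emod_nonneg (x j + m) (show (2 * (m : ℤ) + 1) ≠ 0 by omega)
        have e3 := Int.emod_lt_of_pos (x j + m) (show 0 < (2 * (m : ℤ) + 1) by omega)
        rw [abs_le]; constructor <;> linarith
      have hgrid : ∀ x ∈ σ, cell x ∈ grid0 d m r := by
        intro x hx
        refine ⟨by simp [cell], fun j hj => ⟨(x j + m) / (2 * m + 1), ?_, ?_, by simp [cell, hj]⟩⟩
        · have := ((hσ x hx).2 j hj).1; positivity
        · have := ((hσ x hx).2 j hj).2
          rw [← Int.lt_add_one_iff]
          refine Int.ediv_lt_of_lt_mul (by omega) ?_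
          simp only [hρ, rho] at this; push_cast at this; nlinarith
      let T := σ.image cell
      have hT : M ≤ T.card := by
        by_cases hN0 : N = 0
        · have := hN 0; rw [hN0, ncard_eq_zero (bx_fin _ _)] at this
          exact absurd (bx_self 0 m) (by rw [this]; simp)
        have := Finset.card_le_mul_card_image (f := cell) σ N (by
          intro c hc
          let c' : Vtx d := fun j => if j = 0 then (ρ : ℤ) + 1 else c j
          rw [← hN c', ← ncard_coe_finset]
          refine ncard_le_ncard ?_ (bx_fin _ _)
          intro x hx j
          simp only [Finset.coe_filter, mem_setOf_eq] at hx
          by_cases hj : j = 0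
          · subst hj; simp [c', (hσ x hx.1).1]
          · simp only [c', hj, if_false, ← hx.2]; exact hcell x j hj)
        exact Nat.le_of_mul_le_mul_left (h1.trans this) (Nat.pos_of_ne_zero hN0)
      have hrep : ∀ c : Vtx d, ∃ x, c ∈ T → x ∈ σ ∧ cell x = c := fun c => by
        by_cases h : c ∈ T
        · obtain ⟨x, hx⟩ := Finset.mem_image.1 h; exact ⟨x, fun _ => hx⟩
        · exact ⟨0, fun h' => absurd h' h⟩
      choose rep hrep using hrep
      let s : Vtx d → Finset (Vtx d) := fun c => insert (rep c) (bx_fin c m).toFinset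
      have hs1 : ∀ c ∈ T, rep c ∉ (bx_fin c m).toFinset := by
        intro c hc h
        have h := (bx_fin c m).mem_toFinset.1 h 0
        obtain ⟨x1, x2⟩ := hrep c hc
        rw [(hσ _ x1).1, ← x2, abs_le] at h
        simp only [cell, if_true, hh] at h; push_cast at h; omega
      have h0 : ∀ c ∈ T, c 0 = hh m r := fun c hc => by
        rw [← (hrep c hc).2]; simp [cell]
      have hcard : ∀ c ∈ T, (s c).card = 1 + N := by
        intro c hc
        rw [Finset.card_insert_of_notMem (hs1 c hc), ← hN c, ncard_eq_toFinset_card _ (bx_fin c m)]; ring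
      have hdisj : ∀ c ∈ T, ∀ c' ∈ T, c ≠ c' → Disjoint (s c) (s c') := by
        intro c hc c' hc' hne
        obtain ⟨x1, x2⟩ := hrep c hc
        obtain ⟨y1, y2⟩ := hrep c' hc'
        rw [Finset.disjoint_left]
        intro y h1 h2
        simp only [s, Finset.mem_insert, Finite.mem_toFinset] at h1 h2
        rcases h1 with rfl | h1 <;> rcases h2 with h2 | h2
        · exact hne (by rw [← x2, ← y2, h2])
        · have := h2 0; rw [(hσ _ x1).1, h0 _ hc', abs_le] at this; simp only [hh] at this; push_cast at this; omega
        · rw [h2] at h1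
          have := h1 0; rw [(hσ _ y1).1, h0 _ hc, abs_le] at this; simp only [hh] at this; push_cast at this; omega
        · apply hne; funext j
          by_cases hj : j = 0
          · rw [hj, h0 _ hc, h0 _ hc']
          · have e1 := abs_le.1 (h1 j); have e2 := abs_le.1 (h2 j)
            rw [← x2, ← y2] at *
            simp only [cell, hj, if_false] at *
            set A := (rep c j + ↑m) / (2 * ↑m + 1)
            set B := (rep c' j + ↑m) / (2 * ↑m + 1)
            congr 1
            by_contra hAB
            rcases lt_or_gt_of_ne hAB with h | h
            · have : (2 * (m : ℤ) + 1) * (A + 1) ≤ (2 * m + 1) * B := by gcongr; omega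
              nlinarith
            · have : (2 * (m : ℤ) + 1) * (B + 1) ≤ (2 * m + 1) * A := by gcongr; omega
              nlinarith
      refine ⟨bx 0 ρ, T.biUnion s, {ω | ∀ c ∈ T, ¬ ∀ v ∈ s c, ω v = true}, bx_fin _ _, Finset.finite_toSet _, ?_,
        N0_dep m ρ (· = (σ : Set (Vtx d))), ?_, ?_, ?_⟩
      · refine disjoint_left.2 fun y hy h => ?_
        simp only [Finset.coe_biUnion, mem_iUnion] at h
        obtain ⟨c, hc, h⟩ := h
        have hy0 := abs_le.1 (hy 0)
        simp only [Pi.zero_apply, sub_zero] at hy0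
        simp only [s, Finset.coe_insert, Finite.coe_toFinset, mem_insert_iff] at h
        rcases h with rfl | h
        · have := (hσ _ (hrep c hc).1).1; omega
        · have := h 0; rw [h0 _ hc, abs_le] at this; simp only [hh] at this; push_cast at this; omega
      · intro ω ω' h h' c hc h2
        refine h' c hc fun v hv => ?_
        rw [h v (by simp only [Finset.coe_biUnion, mem_iUnion]; exact ⟨c, hc, hv⟩)]; exact h2 v hv
      · rw [P_none q T s hdisj, Finset.prod_congr rfl (fun c hc => by rw [hcard c hc]), Finset.prod_const]
        exact pow_le_pow_of_le_one (by linarith) (by linarith) hT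
      · rintro ω ⟨e, hG⟩ c hc hop
        apply hG
        obtain ⟨x1, x2⟩ := hrep c hc
        refine ⟨c, by rw [← x2]; exact hgrid _ x1, fun y hy => hop y (by simp [s, hy]), rep c, ⟨(hσ _ x1).1, fun j hj => ?_⟩,
          hop _ (by simp [s]), fun j hj => ?_, ?_⟩
        · have := (hσ _ x1).2 j hj; constructor <;> omega
        · have := hcell (rep c) j hj; rwa [x2] at this
        · have : rep c ∈ N0 m ρ (op ω) := by rw [show N0 m ρ (op ω) = σ from e]; exact x1
          exact this.1.2)
  have hs : {ω : Config d | ¬ G0 m r (op ω)} ⊆ {ω | (N0 m ρ (op ω)).ncard < N * M} ∪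
      ({ω | N0 m ρ (op ω) ∈ E} ∩ {ω | ¬ G0 m r (op ω)}) := by
    intro ω h
    by_cases h' : (N0 m ρ (op ω)).ncard < N * M
    · exact .inl h'
    · exact .inr ⟨⟨not_lt.1 h', ω, rfl⟩, h⟩
  have h2 := (measureReal_mono (μ := PB d q) hs).trans (measureReal_union_le _ _)
  have h3 : (1 - β) ^ M * (PB d q).real {ω | N0 m ρ (op ω) ∈ E} ≤ (1 - β) ^ M :=
    mul_le_of_le_one_right (pow_nonneg (by linarith) _) measureReal_le_one
  linarith

theorem bx_card (c : Vtx d) (m : ℕ) : (bx c m).ncard = (bx (0 : Vtx d) m).ncard := by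
  have : bx c m = tr c '' bx 0 m := by
    ext y; simp only [bx, tr, mem_image, mem_setOf_eq]
    exact ⟨fun h => ⟨y - c, by simpa using h, by simp⟩, by rintro ⟨x, hx, rfl⟩; simpa using hx⟩
  rw [this, ncard_image_of_injective _ (tr c).injective]

theorem lemma1 (q : unitInterval) (hq0 : 0 < (q : ℝ)) (hq : (q : ℝ) < 1) {θ : ℝ} (hθ : 0 < θ)
    (h0 : ∀ n, fE q d 0 n ≤ 1 - θ) {ε : ℝ} (hε : 0 < ε) :
    ∃ m r, 1 ≤ r ∧ (PB d q).real {ω | ¬ G0 m r (op ω)} ≤ ε := by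
  set D := Fintype.card (Fin d × (Fin d → ℤˣ))
  obtain ⟨m, hm⟩ := lem1a q hθ h0 (show 0 < (ε / 2) ^ D / 2 by positivity)
  set N := (bx (0 : Vtx d) m).ncard with hN
  have N0 : 0 < N := (ncard_pos (bx_fin _ _)).2 ⟨0, bx_self 0 m⟩
  have hβ : 0 < (q : ℝ) ^ (1 + N) := by positivity
  obtain ⟨M, hM⟩ := exists_pow_lt_of_lt_one (show 0 < ε / 2 by positivity) (show 1 - (q : ℝ) ^ (1 + N) < 1 by linarith)
  obtain ⟨r, r1, hr⟩ := lem1b (d := d) q hq m (2 * m + 1) (D * (N * (M + 1))) (by omega) (show 0 < (ε / 2) ^ D / 2 by positivity)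
  refine ⟨m, r, r1, (seed_std q m r (M + 1) N (fun c => bx_card c m)).trans ?_⟩
  have h1 : (1 - (q : ℝ) ^ (1 + N)) ^ (M + 1) ≤ ε / 2 := by
    refine le_trans (pow_le_pow_of_le_one ?_ ?_ (Nat.le_succ M)) hM.le
    · linarith [pow_le_one₀ (n := 1 + N) q.2.1 q.2.2]
    · linarith
  have h2 := lem1c (d := d) q m (rho m r) (N * (M + 1)) (show 0 ≤ ε / 2 by positivity) (by
    have hs : {ω : Config d | (Nx 0 m (rho m r) (op ω)).ncard < D * (N * (M + 1))} ⊆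
        {ω | Nx 0 m (rho m r) (op ω) = ∅} ∪ {ω | (Nx 0 m ((2 * m + 1) * r + m) (op ω)).Nonempty ∧
      (Nx 0 m ((2 * m + 1) * r + m) (op ω)).ncard < D * (N * (M + 1))} := by
      intro ω h
      rcases eq_empty_or_nonempty (Nx 0 m (rho m r) (op ω)) with h' | h'
      · exact .inl h'
      · exact .inr ⟨h', h⟩
    have h3 := (measureReal_mono (μ := PB d q) hs).trans (measureReal_union_le _ _)
    have h4 := hm (rho m r) (by simp [rho])
    rw [fE] at h4
    linarith) (by positivity)
  linarith
end B3
section C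
variable {d : ℕ}

def nb (C : Set (Vtx d)) : Set (Vtx d) := {w | w ∉ C ∧ ∃ u ∈ C, adj u w}
def cl (C : Set (Vtx d)) : Set (Vtx d) := C ∪ nb C

theorem cl_mono {C C' : Set (Vtx d)} (h : C ⊆ C') : cl C ⊆ cl C' := by
  rintro v (hv | ⟨hv, u, hu, a⟩)
  · exact .inl (h hv)
  · by_cases h' : v ∈ C'
    · exact .inl h'
    · exact .inr ⟨h', u, h hu, a⟩

theorem bx_conn {c y v : Vtx d} {m : ℕ} (hy : y ∈ bx c m) (hv : v ∈ bx c m) : Rch (bx c m) {y} v := by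
  obtain ⟨n, hn⟩ : ∃ n : ℕ, ∑ i, (v i - y i).natAbs = n := ⟨_, rfl⟩
  induction n using Nat.strong_induction_on generalizing v with
  | _ n ih =>
    by_cases h : v = y
    · exact .base h
    obtain ⟨i, hi⟩ := Function.ne_iff.1 h
    let v' : Vtx d := Function.update v i (if v i < y i then v i + 1 else v i - 1)
    have e : v' i = if v i < y i then v i + 1 else v i - 1 := by simp [v']
    have e' : ∀ j ≠ i, v' j = v j := fun j hj => by simp [v', hj]
    have hv' : v' ∈ bx c m := by
      intro j
      by_cases hj : j = i
      · subst hj; rw [e]; have h1 := abs_le.1 (hv j); have h2 := abs_le.1 (hy j)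
        rw [abs_le]; split_ifs <;> omega
      · rw [e' j hj]; exact hv j
    have ha : adj v' v := adj_of i (by rw [e]; split_ifs <;> simp) e'
    have hlt : ∑ j, (v' j - y j).natAbs < n := by
      rw [← hn]
      refine Finset.sum_lt_sum (fun j _ => ?_) ⟨i, Finset.mem_univ _, ?_⟩
      · by_cases hj : j = i
        · subst hj; rw [e]; split_ifs <;> omega
        · rw [e' j hj]
      · rw [e]; split_ifs <;> omega
    exact .step (ih _ hlt hv' rfl) ha hv

theorem last_exit {O S C : Set (Vtx d)} (hS : S ⊆ C) {v} (h : Rch O S v) (hv : v ∉ C) :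
    ∃ w ∈ nb C ∩ O, Rch (O \ cl C) {w} v := by
  induction h with
  | base h => exact absurd (hS h) hv
  | @step u v h a ho ih =>
    by_cases h' : v ∈ nb C
    · exact ⟨v, ⟨h', ho⟩, .base rfl⟩
    · obtain ⟨w, hw, r⟩ := ih fun hu => h' ⟨hv, u, hu, a⟩
      exact ⟨w, hw, .step r a ⟨ho, by rintro (h | h); exacts [hv h, h' h]⟩⟩

variable [NeZero d]

theorem det_std {m r : ℕ} {O C : Set (Vtx d)} (hC : bx 0 m ⊆ C) (hz : ∀ z ∈ zone0 d m r, z ∉ cl C) (hG : G0 m r O) :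
    ∃ w ∈ nb C ∩ Lam0 d m r ∩ O, ∃ c ∈ grid0 d m r, ∀ v ∈ bx c m, Rch ((O ∩ Lam0 d m r) \ cl C) {w} v := by
  obtain ⟨c, hc, h1, x, hx, h2, h3, u, hu, a, R⟩ := hG
  have R1 : Rch (O ∩ Lam0 d m r) (bx 0 m) x :=
    .step (R.mono (inter_subset_inter_right _ fun v hv => .inl (.inl hv)) subset_rfl) a ⟨h2, .inl (.inr hx)⟩
  let y : Vtx d := Function.update x 0 (x 0 + 1)
  have y0 : y 0 = rho m r + 2 := by simp [y, hx.1]; ring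
  have yj : ∀ j ≠ 0, y j = x j := fun j hj => by simp [y, hj]
  have hy : y ∈ bx c m := by
    intro j
    by_cases hj : j = 0
    · subst hj; rw [y0, hc.1, hh, abs_le]; push_cast; omega
    · rw [yj j hj]; exact h3 j hj
  have hbz : ∀ v ∈ bx c m, v ∈ (O ∩ Lam0 d m r) \ cl C := fun v hv =>
    ⟨⟨h1 hv, .inr (grid_zone hc hv)⟩, hz v (grid_zone hc hv)⟩
  have R2 : Rch (O ∩ Lam0 d m r) (bx 0 m) y :=
    .step R1 (adj_of 0 (by simp [y]) fun j hj => (yj j hj).symm) (hbz y hy).1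
  obtain ⟨w, hw, R3⟩ := last_exit hC R2 fun h => (hbz y hy).2 (.inl h)
  refine ⟨w, ⟨⟨hw.1, hw.2.2⟩, hw.2.1⟩, c, hc, fun v hv => ?_⟩
  refine Rch.trans (S' := {y}) (by rintro _ rfl; exact R3) ((bx_conn hy hv).mono hbz subset_rfl)

def LamF (b : Vtx d) (i : Fin d) (s : Fin d → ℤˣ) (m r : ℕ) : Set (Vtx d) := fr b i s '' Lam0 d m r

variable {K : ℕ}
abbrev Bits (d K : ℕ) := Vtx d × Fin (K + 1) → Bool
def O0 (ω : Bits d K) : Set (Vtx d) := {v | ω (v, 0) = true}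

def newC (C L : Set (Vtx d)) (c : Fin (K + 1)) (ω : Bits d K) : Set (Vtx d) :=
  C ∪ {v | Rch ((O0 ω ∩ L) \ cl C) {w | w ∈ nb C ∩ L ∧ ω (w, c) = true} v}

def succ (b : Vtx d) (i : Fin d) (s : Fin d → ℤˣ) (m r : ℕ) (C : Set (Vtx d)) : Prop :=
  ∃ c ∈ grid0 d m r, bx (fr b i s c) m ⊆ C

noncomputable def wt (d K : ℕ) (q s : unitInterval) (x : Vtx d × Fin (K + 1)) : PMF Bool :=
  bern (if x.2 = 0 then q else s)

theorem P_lvl (q s : unitInterval) (c : Fin (K + 1)) (σ : Finset (Vtx d)) :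
    (Pm (wt d K q s)).real {ω | ∀ v ∈ σ, ω (v, c) = false} = (1 - ((if c = 0 then q else s : unitInterval) : ℝ)) ^ σ.card := by
  classical
  have := Pm_cyl (wt d K q s) (σ.map ⟨fun v => (v, c), fun _ _ h => (Prod.ext_iff.1 h).1⟩) (fun _ => false)
  rw [Finset.prod_map] at this
  simp only [Finset.mem_map, forall_exists_index, and_imp, forall_apply_eq_imp_iff₂, Function.Embedding.coeFn_mk,
    wt] at this
  have this : (Pm (wt d K q s)) {ω | ∀ v ∈ σ, ω (v, c) = false} = ∏ x ∈ σ, bern (if c = 0 then q else s) false := this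
  rw [Finset.prod_const] at this
  rw [measureReal_def, this, ENNReal.toReal_pow, bern_false]

theorem dep_lvl (c : Fin (K + 1)) (σ : Finset (Vtx d)) (b : Bool) :
    dep {ω : Bits d K | ∀ v ∈ σ, ω (v, c) = b} ((fun v => (v, c)) '' (σ : Set (Vtx d))) :=
  fun ω ω' h h' v hv => by rw [← h (v, c) ⟨v, hv, rfl⟩]; exact h' v hv

theorem P_lvl0 (q s : unitInterval) {A : Set (Config d)} (hA : MeasurableSet A) :
    (Pm (wt d K q s)).real {ω | (fun v => ω (v, 0)) ∈ A} = (PB d q).real A := by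
  classical
  have hm : Measurable (fun (ω : Bits d K) v => ω (v, 0)) := by
    rw [measurable_pi_iff]; intro v; exact measurable_pi_apply _
  have : (Pm (wt d K q s)).map (fun ω v => ω (v, 0)) = PB d q := by
    refine eq_Pm (fun σ f => ?_) inferInstance
    rw [Measure.map_apply hm]
    · have := Pm_cyl (wt d K q s) (σ.map ⟨fun v => (v, 0), fun _ _ h => (Prod.ext_iff.1 h).1⟩) (fun x => f x.1)
      rw [Finset.prod_map] at this
      simp only [Finset.mem_map, forall_exists_index, and_imp, forall_apply_eq_imp_iff₂, Function.Embedding.coeFn_mk,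
        wt, if_true] at this
      exact this
    · have : dep {ω : Config d | ∀ v ∈ σ, ω v = f v} σ := fun ω ω' h h' v hv => by
        rw [← h v hv]; exact h' v hv
      exact this.meas σ.finite_toSet
  rw [← this, measureReal_def, measureReal_def, Measure.map_apply hm hA]; rfl

theorem LamF_fin (b : Vtx d) (i : Fin d) (s : Fin d → ℤˣ) (m r : ℕ) : (LamF b i s m r).Finite :=
  (Lam0_fin d m r).image _

theorem nb_fin {C : Set (Vtx d)} (hC : C.Finite) : (nb C).Finite := by
  refine (hC.biUnion fun u _ => bx_fin u 1).subset ?_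
  rintro w ⟨_, u, hu, a⟩
  have := bx_adj (bx_self u 0) a
  exact mem_biUnion hu this

theorem cl_fin {C : Set (Vtx d)} (hC : C.Finite) : (cl C).Finite := hC.union (nb_fin hC)

theorem newC_fin {C L : Set (Vtx d)} (hC : C.Finite) (hL : L.Finite) (c : Fin (K + 1)) (ω : Bits d K) :
    (newC C L c ω).Finite := by
  refine hC.union (hL.subset fun v hv => ?_)
  rcases Rch.mem hv with h | h
  exacts [h.1.2, h.1.2]

theorem newC_dep {C L : Set (Vtx d)} (c : Fin (K + 1)) (E : Set (Vtx d) → Prop) :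
    dep {ω : Bits d K | E (newC C L c ω)} ((fun v => (v, 0)) '' (L \ cl C) ∪ (fun v => (v, c)) '' (nb C ∩ L)) := by
  intro ω ω' h h'
  have e1 : (O0 ω ∩ L) \ cl C = (O0 ω' ∩ L) \ cl C := by
    ext v
    by_cases hv : v ∈ L \ cl C
    · have := h (v, 0) (.inl ⟨v, hv, rfl⟩)
      simp [O0, this]
    · simp only [mem_diff, mem_inter_iff] at *; tauto
  have e2 : {w | w ∈ nb C ∩ L ∧ ω (w, c) = true} = {w | w ∈ nb C ∩ L ∧ ω' (w, c) = true} := by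
    ext v
    by_cases hv : v ∈ nb C ∩ L
    · have := h (v, c) (.inr ⟨v, hv, rfl⟩)
      simp [this]
    · simp only [mem_setOf_eq]; tauto
  simpa only [mem_setOf_eq, newC, e1, e2] using h'

theorem lemma2_aux (q s0 : unitInterval) (hq : (q : ℝ) < 1) (m r t : ℕ) {ε : ℝ}
    (hG : (PB d q).real {ω | ¬ G0 m r (op ω)} ≤ ε)
    (c : Fin (K + 1)) (hc : c ≠ 0) (b : Vtx d) (i : Fin d) (s : Fin d → ℤˣ) (C : Set (Vtx d)) (hCf : C.Finite)
    (hC : bx b m ⊆ C) (hz : ∀ z ∈ zone0 d m r, fr b i s z ∉ cl C) :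
    (Pm (wt d K q s0)).real {ω | ¬ succ b i s m r (newC C (LamF b i s m r) c ω)} ≤
      ε / (1 - (q : ℝ)) ^ t + (1 - (s0 : ℝ)) ^ t := by
  classical
  set φ := fr b i s with hφ
  set L := LamF b i s m r with hL
  set μ := Pm (wt d K q s0)
  let W : Bits d K → Set (Vtx d) := fun ω => {w | w ∈ nb C ∩ L ∧ ∃ c ∈ grid0 d m r, ∀ v ∈ bx (φ c) m,
    Rch ((O0 ω ∩ L) \ cl C) {w} v}
  have hLf : L.Finite := LamF_fin _ _ _ _ _
  have Wf : ∀ ω, (W ω).Finite := fun ω => hLf.subset fun w h => h.1.2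
  let I0 : Set (Vtx d × Fin (K + 1)) := (fun v => (v, 0)) '' (L \ cl C)
  have I0f : I0.Finite := (hLf.subset diff_subset).image _
  have dW : ∀ σ, dep {ω | W ω = σ} I0 := by
    intro σ ω ω' h h'
    have e1 : (O0 ω ∩ L) \ cl C = (O0 ω' ∩ L) \ cl C := by
      ext v
      by_cases hv : v ∈ L \ cl C
      · have := h (v, 0) ⟨v, hv, rfl⟩
        simp [O0, this]
      · simp only [mem_diff, mem_inter_iff] at *; tauto
    simpa only [mem_setOf_eq, W, e1] using h'
  let Gd : Set (Bits d K) := {ω | G0 m r (φ ⁻¹' O0 ω)}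
  have hGd : μ.real Gdᶜ ≤ ε := by
    refine le_trans (le_of_eq ?_) hG
    have m1 : MeasurableSet {ω : Config d | ¬ G0 m r (op ω)} := ((G0_dep m r).compl).meas (Lam0_fin _ _ _)
    have m2 : MeasurableSet ((fun ω : Config d => ω ∘ φ) ⁻¹' {ω : Config d | ¬ G0 m r (op ω)}) :=
      (dep_pre ((G0_dep m r).compl) φ).meas ((Lam0_fin _ _ _).image _)
    rw [← Pm_map (bern q) φ m1, ← P_lvl0 (K := K) q s0 m2]; rfl
  have hdet : ∀ ω ∈ Gd, ∃ w ∈ W ω, ω (w, 0) = true := by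
    intro ω h
    have e : ∀ {v}, v ∈ cl (φ ⁻¹' C) → φ v ∈ cl C := by
      rintro v (h | ⟨h1, u, hu, a⟩)
      · exact .inl h
      · exact .inr ⟨h1, φ u, hu, fr_adj _ _ _ a⟩
    have e' : ∀ {v}, φ v ∈ cl C → v ∈ cl (φ ⁻¹' C) := by
      rintro v (h | ⟨h1, u, hu, a⟩)
      · exact .inl h
      · refine .inr ⟨h1, φ.symm u, by simpa using hu, ?_⟩
        have := fr_symm_adj b i s a; rwa [← hφ, Equiv.symm_apply_apply] at this
    obtain ⟨w, ⟨⟨w1, w2⟩, w3⟩, c, hc, hr⟩ := det_std (C := φ ⁻¹' C)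
      (fun y hy => hC (by have := (fr_bx b i s m 0 y).2 hy; rwa [fr_zero] at this)) (fun z h1 h2 => hz z h1 (e h2)) h
    refine ⟨φ w, ⟨⟨⟨w1.1, ?_⟩, w, w2, rfl⟩, c, hc, fun v hv => ?_⟩, w3⟩
    · obtain ⟨u, hu, a⟩ := w1.2; exact ⟨φ u, hu, fr_adj _ _ _ a⟩
    · have hv' : φ.symm v ∈ bx c m := by rw [← fr_bx b i s, ← hφ]; simpa using hv
      have := (hr _ hv').map φ (O' := (O0 ω ∩ L) \ cl C) (S' := {φ w}) (fun _ _ => fr_adj _ _ _)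
        (fun y hy => ⟨⟨hy.1.1, y, hy.1.2, rfl⟩, fun h => hy.2 (e' h)⟩) (fun y hy => by rw [mem_singleton_iff.1 hy]; rfl)
      simpa using this
  -- few gates
  have hW : ∀ ω, W ω ⊆ nb C := fun ω w h => h.1.1
  have I0d : ∀ (σ : Finset (Vtx d)) (c : Fin (K + 1)), (σ : Set (Vtx d)) ⊆ nb C →
      Disjoint I0 ((fun v => (v, c)) '' (σ : Set (Vtx d))) := by
    intro σ c h
    refine disjoint_left.2 ?_
    rintro _ ⟨v, hv, rfl⟩ ⟨w, hw, e⟩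
    simp only [Prod.mk.injEq] at e
    exact hv.2 (.inr (h (e.1 ▸ hw)))
  have p0 : 0 < (1 - (q : ℝ)) ^ t := pow_pos (by linarith) t
  have F1 := Pm_fiber (wt d K q s0) W I0f dW {σ | σ.ncard < t ∧ σ.Finite ∧ σ ⊆ nb C} Gd (1 - (1 - (q : ℝ)) ^ t) (by
    rintro σ ⟨h1, h2, h3⟩
    lift σ to Finset (Vtx d) using h2
    refine ⟨I0, (fun v => (v, 0)) '' (σ : Set (Vtx d)), {ω : Bits d K | ∀ v ∈ σ, ω (v, 0) = false}ᶜ, I0f,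
      σ.finite_toSet.image _, I0d σ 0 h3, dW _, (dep_lvl 0 σ false).compl, ?_, ?_⟩
    · rw [probReal_compl_eq_one_sub ((dep_lvl 0 σ false).meas (σ.finite_toSet.image _)), P_lvl]
      rw [ncard_coe_finset] at h1
      have := pow_le_pow_of_le_one (a := 1 - (q : ℝ)) (by linarith) (by linarith [q.2.1]) h1.le
      simp only [if_true]; linarith
    · rintro ω ⟨h4, h5⟩ h6
      obtain ⟨w, hw, hw'⟩ := hdet ω h5
      rw [show W ω = σ from h4] at hw
      simp only [mem_setOf_eq] at h6
      rw [h6 w hw] at hw'; simp at hw')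
  have F2 := Pm_fiber (wt d K q s0) W I0f dW {σ | t ≤ σ.ncard ∧ σ.Finite ∧ σ ⊆ nb C}
      {ω | ¬ succ b i s m r (newC C L c ω)} ((1 - (s0 : ℝ)) ^ t) (by
    rintro σ ⟨h1, h2, h3⟩
    lift σ to Finset (Vtx d) using h2
    refine ⟨I0, (fun v => (v, c)) '' (σ : Set (Vtx d)), {ω : Bits d K | ∀ v ∈ σ, ω (v, c) = false}, I0f,
      σ.finite_toSet.image _, I0d σ c h3, dW _, (dep_lvl c σ false), ?_, ?_⟩
    · rw [P_lvl]
      rw [ncard_coe_finset] at h1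
      simp only [hc, if_false]
      exact pow_le_pow_of_le_one (a := 1 - (s0 : ℝ)) (by linarith [s0.2.2]) (by linarith [s0.2.1]) h1
    · rintro ω ⟨h4, h5⟩ w hw
      by_contra hcc
      rw [Bool.not_eq_false] at hcc
      have hw1 : w ∈ W ω := by rw [show W ω = σ from h4]; exact hw
      obtain ⟨hw2, c', hc', hr⟩ := hw1
      exact h5 ⟨c', hc', fun v hv => .inr ((hr v hv).mono subset_rfl (by rintro _ rfl; exact ⟨hw2, hcc⟩))⟩)
  set T1 := {ω | W ω ∈ {σ : Set (Vtx d) | σ.ncard < t ∧ σ.Finite ∧ σ ⊆ nb C}}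
  set T2 := {ω | W ω ∈ {σ : Set (Vtx d) | t ≤ σ.ncard ∧ σ.Finite ∧ σ ⊆ nb C}}
  have k1 : μ.real T1 ≤ μ.real (T1 ∩ Gd) + μ.real Gdᶜ := by
    refine (measureReal_mono (fun ω h => ?_)).trans (measureReal_union_le _ _)
    by_cases h' : ω ∈ Gd <;> simp [h, h']
  have k2 : μ.real T1 ≤ ε / (1 - (q : ℝ)) ^ t := by
    rw [le_div_iff₀ p0]; linarith
  have k3 : μ.real {ω | ¬ succ b i s m r (newC C L c ω)} ≤
      μ.real T1 + μ.real (T2 ∩ {ω | ¬ succ b i s m r (newC C L c ω)}) := by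
    refine (measureReal_mono (fun ω h => ?_)).trans (measureReal_union_le _ _)
    by_cases h' : (W ω).ncard < t
    · exact .inl ⟨h', Wf ω, hW ω⟩
    · exact .inr ⟨⟨not_lt.1 h', Wf ω, hW ω⟩, h⟩
  have k4 : (1 - (s0 : ℝ)) ^ t * μ.real T2 ≤ (1 - (s0 : ℝ)) ^ t :=
    mul_le_of_le_one_right (pow_nonneg (by linarith [s0.2.2]) _) measureReal_le_one
  linarith

theorem lemma2 (q s0 : unitInterval) (hq0 : 0 < (q : ℝ)) (hq : (q : ℝ) < 1) (hs : 0 < (s0 : ℝ)) {θ : ℝ} (hθ : 0 < θ)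
    (h0 : ∀ n, fE q d 0 n ≤ 1 - θ) {ε : ℝ} (hε : 0 < ε) : ∃ m r, 1 ≤ r ∧
    ∀ (K : ℕ) (c : Fin (K + 1)), c ≠ 0 → ∀ (b : Vtx d) (i : Fin d) (s : Fin d → ℤˣ) (C : Set (Vtx d)), C.Finite →
    bx b m ⊆ C → (∀ z ∈ zone0 d m r, fr b i s z ∉ cl C) →
    (Pm (wt d K q s0)).real {ω | ¬ succ b i s m r (newC C (LamF b i s m r) c ω)} ≤ ε := by
  obtain ⟨t, ht⟩ := exists_pow_lt_of_lt_one (show 0 < ε / 2 by positivity) (show 1 - (s0 : ℝ) < 1 by linarith)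
  have p0 : 0 < (1 - (q : ℝ)) ^ t := pow_pos (by linarith) t
  obtain ⟨m, r, r1, h⟩ := lemma1 (d := d) q hq0 hq hθ h0 (show 0 < ε / 2 * (1 - (q : ℝ)) ^ t by positivity)
  refine ⟨m, r, r1, fun K c hc b i s C hCf hC hz => (lemma2_aux q s0 hq m r t h c hc b i s C hCf hC hz).trans ?_⟩
  rw [mul_div_assoc, div_self p0.ne']
  linarith
end C
section E1

def king (v w : ℤ × ℤ) : Prop := |v.1 - w.1| ≤ 1 ∧ |v.2 - w.2| ≤ 1

theorem king_self (v : ℤ × ℤ) : king v v := by simp [king]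

theorem ivt1 (S : ℤ → Prop) {a c x y : ℤ} (hx : x ∈ Finset.Ico a c) (hy : y ∈ Finset.Ico a c) (hS : S x) (hS' : ¬ S y) :
    ∃ z ∈ Finset.Ico a c, ¬ S z ∧ ∃ z', S z' ∧ |z' - z| ≤ 1 := by
  obtain ⟨n, hn⟩ : ∃ n : ℕ, (x - y).natAbs = n := ⟨_, rfl⟩
  induction n generalizing y with
  | zero => exact absurd (by rwa [show y = x by omega]) hS'
  | succ n ih =>
    let y' := if y < x then y + 1 else y - 1
    simp only [Finset.mem_Ico] at *
    by_cases h : S y'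
    · exact ⟨y, hy, hS', y', h, by simp only [y', abs_le]; split_ifs <;> omega⟩
    · exact ih (y := y') (by simp only [y']; split_ifs <;> omega) h (by simp only [y']; split_ifs <;> omega)

theorem gainA (I J : Finset ℤ) (A G : Finset (ℤ × ℤ)) (Mx : Finset ℤ) (hM : Mx ⊆ J)
    (h : ∀ y ∈ Mx, ∃ x ∈ I, (x, y) ∉ A ∧ (x, y) ∈ G) (hA : A ⊆ G) : A.card + Mx.card ≤ G.card := by
  classical
  choose! g g1 g2 g3 using h
  have : Mx.card ≤ (G \ A).card := Finset.card_le_card_of_injOn (fun y => (g y, y))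
    (fun y hy => by simp [g2 y hy, g3 y hy]) (fun y _ y' _ e => (Prod.ext_iff.1 e).2)
  rw [Finset.card_sdiff_of_subset hA] at this
  have := Finset.card_le_card hA
  omega

theorem rows_le (I J : Finset ℤ) (A : Finset (ℤ × ℤ)) (hA : A ⊆ I ×ˢ J) (Mx : Finset ℤ)
    (h : ∀ x y, (x, y) ∈ A → y ∈ Mx) : A.card ≤ I.card * Mx.card := by
  rw [← Finset.card_product]
  refine Finset.card_le_card fun ⟨x, y⟩ hv => ?_
  have := hA hv
  simp only [Finset.mem_product] at *
  exact ⟨this.1, h _ _ hv⟩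

theorem expand (b : ℕ) (a c : ℤ) (A G : Finset (ℤ × ℤ))
    (hA : A ⊆ Finset.Ico a (a + 3 * b) ×ˢ Finset.Ico c (c + 3 * b))
    (hG : ∀ v ∈ A, ∀ w ∈ Finset.Ico a (a + 3 * b) ×ˢ Finset.Ico c (c + 3 * b), king v w → w ∈ G)
    (h1 : b ^ 2 ≤ 4 * A.card) (h2 : 4 * A.card + b ^ 2 ≤ 36 * b ^ 2) : 12 * A.card + b ≤ 12 * G.card := by
  classical
  set I := Finset.Ico a (a + 3 * b) with hI
  set J := Finset.Ico c (c + 3 * b) with hJ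
  have cI : I.card = 3 * b := by rw [hI, Int.card_Ico]; omega
  have cJ : J.card = 3 * b := by rw [hJ, Int.card_Ico]; omega
  have hAG : A ⊆ G := fun v hv => hG v hv v (hA hv) (king_self v)
  have rowM : ∀ y ∈ J, (∃ x ∈ I, (x, y) ∈ A) → (∃ x ∈ I, (x, y) ∉ A) → ∃ x ∈ I, (x, y) ∉ A ∧ (x, y) ∈ G := by
    rintro y hy ⟨x, hx, h⟩ ⟨x', hx', h'⟩
    obtain ⟨z, hz, k1, z', k2, k3⟩ := ivt1 (fun x => (x, y) ∈ A) hx hx' h h'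
    exact ⟨z, hz, k1, hG _ k2 _ (Finset.mem_product.2 ⟨hz, hy⟩) ⟨k3, by simp⟩⟩
  by_cases hE : ∃ y ∈ J, ∀ x ∈ I, (x, y) ∉ A
  · by_cases hF : ∃ y ∈ J, ∀ x ∈ I, (x, y) ∈ A
    · obtain ⟨y, hy, e⟩ := hE
      obtain ⟨y', hy', f⟩ := hF
      have := gainA J I (A.map (Equiv.prodComm ℤ ℤ).toEmbedding) (G.map (Equiv.prodComm ℤ ℤ).toEmbedding) I subset_rfl (by
        intro x hx
        obtain ⟨z, hz, k1, z', k2, k3⟩ := ivt1 (fun y => (x, y) ∈ A) hy' hy (f x hx) (e x hx)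
        refine ⟨z, hz, by simpa using k1, ?_⟩
        have := hG _ k2 (x, z) (Finset.mem_product.2 ⟨hx, hz⟩) ⟨by simp, k3⟩
        simpa using this) (Finset.map_subset_map.2 hAG)
      rw [Finset.card_map, Finset.card_map] at this
      omega
    · push Not at hF
      have := gainA I J A G (J.filter fun y => ∃ x ∈ I, (x, y) ∈ A) (Finset.filter_subset _ _) (by
        intro y hy
        rw [Finset.mem_filter] at hy
        exact rowM y hy.1 hy.2 (hF y hy.1)) hAG
      have k := rows_le I J A hA (J.filter fun y => ∃ x ∈ I, (x, y) ∈ A) (fun x y h => by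
        have := Finset.mem_product.1 (hA h)
        exact Finset.mem_filter.2 ⟨this.2, x, this.1, h⟩)
      rw [cI] at k
      rcases Nat.eq_zero_or_pos b with rfl | hb
      · omega
      · have : b ≤ 12 * (J.filter fun y => ∃ x ∈ I, (x, y) ∈ A).card := by nlinarith
        omega
  · push Not at hE
    have := gainA I J A G (J.filter fun y => ∃ x ∈ I, (x, y) ∉ A) (Finset.filter_subset _ _) (by
      intro y hy
      rw [Finset.mem_filter] at hy
      exact rowM y hy.1 (hE y hy.1) hy.2) hAG
    have k := rows_le I J (I ×ˢ J \ A) Finset.sdiff_subset (J.filter fun y => ∃ x ∈ I, (x, y) ∉ A) (fun x y h => by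
      rw [Finset.mem_sdiff, Finset.mem_product] at h
      exact Finset.mem_filter.2 ⟨h.1.2, x, h.1.1, h.2⟩)
    rw [Finset.card_sdiff_of_subset hA, Finset.card_product, cI, cJ] at k
    have hc := Finset.card_le_card hA
    rw [Finset.card_product, cI, cJ] at hc
    rcases Nat.eq_zero_or_pos b with rfl | hb
    · omega
    · have : b ≤ 12 * (J.filter fun y => ∃ x ∈ I, (x, y) ∉ A).card := by
        zify [hc] at k h1 h2 ⊢
        nlinarith
      omega

def StepP (Rg : Set (ℤ × ℤ)) (R : ℕ → Set (ℤ × ℤ)) (Bd : Set (ℕ × (ℤ × ℤ))) : Prop :=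
  ∀ t v w, v ∈ R t → king v w → w ∈ Rg → (t + 1, w) ∉ Bd → w ∈ R (t + 1)

noncomputable def reg (b : ℕ) (Z : ℤ × ℤ) : Finset (ℤ × ℤ) :=
  Finset.Ico (b * Z.1 - b) (b * Z.1 - b + 3 * b) ×ˢ Finset.Ico (b * Z.2 - b) (b * Z.2 - b + 3 * b)
noncomputable def blk (b : ℕ) (Z : ℤ × ℤ) : Finset (ℤ × ℤ) :=
  Finset.Ico (b * Z.1) (b * Z.1 + b) ×ˢ Finset.Ico (b * Z.2) (b * Z.2 + b)

theorem blk_card (b : ℕ) (Z) : (blk b Z).card = b ^ 2 := by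
  simp [blk, Finset.card_product, Int.card_Ico, sq]
theorem reg_card (b : ℕ) (Z) : (reg b Z).card = 9 * b ^ 2 := by
  have e : ∀ a : ℤ, (a + 3 * (b : ℤ) - a).toNat = 3 * b := fun a => by omega
  simp only [reg, Finset.card_product, Int.card_Ico, e]; ring
theorem blk_reg (b : ℕ) {Z Z'} (h : king Z Z') : blk b Z ⊆ reg b Z' := by
  rintro ⟨x, y⟩ hv
  have h1 := abs_le.1 h.1
  have h2 := abs_le.1 h.2
  have hb : (0 : ℤ) ≤ b := by positivity
  simp only [blk, reg, Finset.mem_product, Finset.mem_Ico] at *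
  refine ⟨⟨?_, ?_⟩, ?_, ?_⟩ <;> nlinarith

open Classical in
noncomputable def sp (b : ℕ) (Z : ℕ × (ℤ × ℤ)) : Finset (ℕ × (ℤ × ℤ)) :=
  Finset.Ioc (108 * b * (Z.1 - 1)) (108 * b * Z.1) ×ˢ reg b Z.2

open Classical in
def Bd' (b : ℕ) (Bd : Set (ℕ × (ℤ × ℤ))) : Set (ℕ × (ℤ × ℤ)) := {Z | b ^ 2 < 4 * ((sp b Z).filter (· ∈ Bd)).card}
open Classical in
def R' (b : ℕ) (R : ℕ → Set (ℤ × ℤ)) (t : ℕ) : Set (ℤ × ℤ) :=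
  {Z | b ^ 2 ≤ 2 * ((blk b Z).filter (· ∈ R (108 * b * t))).card}

theorem level {b : ℕ} {Rg R Bd} (h : StepP Rg R Bd) : StepP {Z | (reg b Z : Set (ℤ × ℤ)) ⊆ Rg} (R' b R) (Bd' b Bd) := by
  classical
  intro τ Z Z' hZ hk hr hb
  simp only [Bd', mem_setOf_eq, not_lt] at hb
  let A : ℕ → Finset (ℤ × ℤ) := fun i => (reg b Z').filter (· ∈ R (108 * b * τ + i))
  let bd : ℕ → Finset (ℕ × (ℤ × ℤ)) := fun i =>
    (Finset.Ioc (108 * b * τ) (108 * b * τ + i) ×ˢ reg b Z').filter (· ∈ Bd)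
  have hbd : ∀ i ≤ 108 * b, 4 * (bd i).card ≤ b ^ 2 := by
    intro i hi
    refine le_trans (Nat.mul_le_mul_left 4 (Finset.card_le_card ?_)) hb
    refine Finset.filter_subset_filter _ (Finset.product_subset_product_left ?_)
    simp only [Nat.add_sub_cancel]
    exact Finset.Ioc_subset_Ioc_right (by nlinarith)
  -- one step
  have step1 : ∀ i, ∀ v ∈ A i, ∀ w ∈ reg b Z', king v w →
      w ∈ A (i + 1) ∪ ((reg b Z').filter fun w => (108 * b * τ + i + 1, w) ∈ Bd) := by
    intro i v hv w hw k
    rw [Finset.mem_union, Finset.mem_filter, Finset.mem_filter]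
    by_cases hB : (108 * b * τ + i + 1, w) ∈ Bd
    · exact .inr ⟨hw, hB⟩
    · exact .inl ⟨hw, h _ v w (Finset.mem_filter.1 hv).2 k (hr hw) hB⟩
  have step2 : ∀ i, (bd i).card + ((reg b Z').filter fun w => (108 * b * τ + i + 1, w) ∈ Bd).card ≤ (bd (i + 1)).card := by
    intro i
    rw [← Finset.card_map (s := (reg b Z').filter fun w => (108 * b * τ + i + 1, w) ∈ Bd)
      ⟨fun w => (108 * b * τ + i + 1, w), fun _ _ e => (Prod.ext_iff.1 e).2⟩, ← Finset.card_union_of_disjoint]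
    · refine Finset.card_le_card (Finset.union_subset ?_ ?_)
      · refine Finset.filter_subset_filter _ (Finset.product_subset_product_left ?_)
        exact Finset.Ioc_subset_Ioc_right (by omega)
      · intro x hx
        simp only [Finset.mem_map, Finset.mem_filter, Function.Embedding.coeFn_mk] at hx
        obtain ⟨w, ⟨h1, h2⟩, e⟩ := hx
        have e : (108 * b * τ + i + 1, w) = x := e
        subst e
        simp only [bd, Finset.mem_filter, Finset.mem_product, Finset.mem_Ioc]
        exact ⟨⟨⟨by omega, by omega⟩, h1⟩, h2⟩
    · rw [Finset.disjoint_left]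
      intro x h1 hx
      simp only [Finset.mem_map, Finset.mem_filter, Function.Embedding.coeFn_mk] at hx
      obtain ⟨w, ⟨_, h2⟩, e⟩ := hx
      have e : (108 * b * τ + i + 1, w) = x := e
      subst e
      simp only [bd, Finset.mem_filter, Finset.mem_product, Finset.mem_Ioc] at h1
      omega
  have a0 : b ^ 2 ≤ 2 * (A 0).card := by
    refine le_trans hZ (Nat.mul_le_mul_left 2 (Finset.card_le_card ?_))
    exact Finset.filter_subset_filter _ (blk_reg b hk)
  have main : ∀ i ≤ 108 * b, 36 * b ^ 2 ≤ 4 * (A i).card + 4 * (bd i).card + b ^ 2 ∨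
      6 * b ^ 2 + i * b ≤ 12 * (A i).card + 12 * (bd i).card := by
    intro i
    induction i with
    | zero => intro _; right; omega
    | succ i ih =>
      intro hi
      have ih := ih (by omega)
      have g := hbd i (by omega)
      have s2 := step2 i
      have cu : (A i).card ≤ (A (i + 1)).card + ((reg b Z').filter fun w => (108 * b * τ + i + 1, w) ∈ Bd).card :=
        (Finset.card_le_card fun v hv => step1 i v hv v (Finset.mem_filter.1 hv).1 (king_self v)).trans
          (Finset.card_union_le _ _)
      by_cases hbig : 4 * (A i).card + b ^ 2 ≤ 36 * b ^ 2
      · have ex := expand b _ _ (A i) _ (Finset.filter_subset _ _) (step1 i) (by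
          rcases ih with h | h
          · omega
          · nlinarith [Nat.zero_le (i * b)]) hbig
        have := Finset.card_union_le (A (i + 1)) ((reg b Z').filter fun w => (108 * b * τ + i + 1, w) ∈ Bd)
        rcases ih with h | h
        · left; omega
        · right; rw [add_mul, one_mul]; omega
      · left; omega
  have fin := main (108 * b) le_rfl
  have g := hbd _ (le_refl (108 * b))
  have fin2 : 34 * b ^ 2 ≤ 4 * (A (108 * b)).card := by
    rcases fin with h | h
    · omega
    · nlinarith
  have split : (A (108 * b)).card ≤ ((blk b Z').filter (· ∈ R (108 * b * (τ + 1)))).card + (reg b Z' \ blk b Z').card := by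
    refine (Finset.card_le_card fun v hv => ?_).trans (Finset.card_union_le _ _)
    have hv := Finset.mem_filter.1 hv
    rw [Finset.mem_union, Finset.mem_filter, Finset.mem_sdiff]
    by_cases hb : v ∈ blk b Z'
    · exact .inl ⟨hb, by rw [mul_add, mul_one]; exact hv.2⟩
    · exact .inr ⟨hv.1, hb⟩
  rw [Finset.card_sdiff_of_subset (blk_reg b (king_self _)), blk_card, reg_card] at split
  change b ^ 2 ≤ _
  omega
end E1
section E2

def Dom {Ω ι : Type*} [MeasurableSpace Ω] (μ : Measure Ω) (Bd : Ω → Set ι) (ε : ℝ) : Prop :=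
  ∀ D : Finset ι, μ.real {ω | (D : Set ι) ⊆ Bd ω} ≤ ε ^ D.card

theorem coarse {Ω ι ι' : Type*} [MeasurableSpace Ω] {μ : Measure Ω} [IsProbabilityMeasure μ] {Bd : Ω → Set ι}
    {e : ℕ} (h : Dom μ Bd ((1 / 2) ^ e)) (Bd2 : Ω → Set ι') (Reg : ι' → Finset ι) {j κ r e' : ℕ}
    (hB : ∀ ω, ∀ v ∈ Bd2 ω, ∃ S : Finset ι, S ⊆ Reg v ∧ (S : Set ι) ⊆ Bd ω ∧ j ≤ S.card)
    (hr : ∀ v, (Reg v).card ≤ r) (hκ : ∀ u, ∃ N : Finset ι', N.card ≤ κ ∧ ∀ v, u ∈ Reg v → v ∈ N)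
    (he : κ * (e' + r) ≤ e * j) (hκ0 : 0 < κ) : Dom μ Bd2 ((1 / 2) ^ e') := by
  classical
  intro D
  let RD := D.biUnion Reg
  let Us := RD.powerset.filter fun U => j * D.card ≤ U.card * κ
  have cov : {ω | (D : Set ι') ⊆ Bd2 ω} ⊆ ⋃ U ∈ Us, {ω | (U : Set ι) ⊆ Bd ω} := by
    intro ω hω
    choose! S s1 s2 s3 using hB ω
    have hS : ∀ v ∈ D, S v ⊆ D.biUnion S := fun v hv => Finset.subset_biUnion_of_mem S hv
    refine mem_biUnion (x := D.biUnion S) ?_ ?_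
    · refine Finset.mem_filter.2 ⟨Finset.mem_powerset.2 (Finset.biUnion_mono fun v hv => s1 v (hω hv)), ?_⟩
      set U := D.biUnion S
      calc j * D.card = ∑ v ∈ D, j := by rw [Finset.sum_const, smul_eq_mul, mul_comm]
        _ ≤ ∑ v ∈ D, (Finset.bipartiteAbove (fun v u => u ∈ Reg v) U v).card := by
          refine Finset.sum_le_sum fun v hv => (s3 v (hω hv)).trans (Finset.card_le_card fun u hu => ?_)
          exact Finset.mem_filter.2 ⟨hS v hv hu, s1 v (hω hv) hu⟩
        _ = ∑ u ∈ U, (Finset.bipartiteBelow (fun v u => u ∈ Reg v) D u).card :=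
          Finset.sum_card_bipartiteAbove_eq_sum_card_bipartiteBelow _
        _ ≤ ∑ u ∈ U, κ := by
          refine Finset.sum_le_sum fun u _ => ?_
          obtain ⟨N, h1, h2⟩ := hκ u
          exact (Finset.card_le_card fun v hv => h2 v (Finset.mem_filter.1 hv).2).trans h1
        _ = U.card * κ := by rw [Finset.sum_const, smul_eq_mul]
    · intro u hu
      obtain ⟨v, hv, hu⟩ := Finset.mem_biUnion.1 hu
      exact s2 v (hω hv) hu
  have RDc : RD.card ≤ r * D.card := by
    refine Finset.card_biUnion_le.trans ((Finset.sum_le_sum fun v _ => hr v).trans ?_)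
    rw [Finset.sum_const, smul_eq_mul, mul_comm]
  have Uc : (Us.card : ℝ) ≤ 2 ^ (r * D.card) := by
    have : Us.card ≤ 2 ^ (r * D.card) := by
      refine (Finset.card_filter_le _ _).trans ?_
      rw [Finset.card_powerset]
      exact Nat.pow_le_pow_right (by norm_num) RDc
    exact_mod_cast this
  calc μ.real {ω | (D : Set ι') ⊆ Bd2 ω} ≤ μ.real (⋃ U ∈ Us, {ω | (U : Set ι) ⊆ Bd ω}) :=
        measureReal_mono cov (measure_ne_top _ _)
    _ ≤ ∑ U ∈ Us, μ.real {ω | (U : Set ι) ⊆ Bd ω} := measureReal_biUnion_finset_le _ _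
    _ ≤ ∑ U ∈ Us, (1 / 2 : ℝ) ^ ((e' + r) * D.card) := by
        refine Finset.sum_le_sum fun U hU => (h U).trans ?_
        rw [← pow_mul]
        refine pow_le_pow_of_le_one (by norm_num) (by norm_num) ?_
        have hU := (Finset.mem_filter.1 hU).2
        refine Nat.le_of_mul_le_mul_left ?_ hκ0
        calc κ * ((e' + r) * D.card) = κ * (e' + r) * D.card := by ring
          _ ≤ e * j * D.card := Nat.mul_le_mul_right _ he
          _ = e * (j * D.card) := by ring
          _ ≤ e * (U.card * κ) := Nat.mul_le_mul_left _ hU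
          _ = κ * (e * U.card) := by ring
    _ = Us.card * (1 / 2 : ℝ) ^ ((e' + r) * D.card) := by rw [Finset.sum_const, nsmul_eq_mul]
    _ ≤ 2 ^ (r * D.card) * (1 / 2 : ℝ) ^ ((e' + r) * D.card) := by gcongr
    _ = ((1 / 2) ^ e') ^ D.card := by
        rw [add_mul, pow_add, ← pow_mul, mul_comm, mul_assoc, ← mul_pow]; norm_num

theorem dom_level {Ω : Type*} [MeasurableSpace Ω] {μ : Measure Ω} [IsProbabilityMeasure μ]
    {Bd : Ω → Set (ℕ × (ℤ × ℤ))} {e : ℕ} (h : Dom μ Bd ((1 / 2) ^ e)) (he : 10000000000 ≤ e) :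
    Dom μ (fun ω => Bd' 8000 (Bd ω)) ((1 / 2) ^ (1728000 * e)) := by
  classical
  refine coarse h _ (sp 8000) (j := 16000000) (κ := 9) (r := 497664000000000) ?_ ?_ ?_ (by linarith) (by norm_num)
  · intro ω v hv
    refine ⟨(sp 8000 v).filter (· ∈ Bd ω), Finset.filter_subset _ _, fun u hu => (Finset.mem_filter.1 hu).2, ?_⟩
    have : 8000 ^ 2 < 4 * ((sp 8000 v).filter (· ∈ Bd ω)).card := hv
    omega
  · intro v
    rw [sp, Finset.card_product, reg_card, Nat.card_Ioc]
    have : 108 * 8000 * v.1 - 108 * 8000 * (v.1 - 1) ≤ 864000 := by omega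
    calc _ ≤ 864000 * (9 * 8000 ^ 2) := Nat.mul_le_mul_right _ this
      _ ≤ _ := by norm_num
  · rintro ⟨t, x, y⟩
    refine ⟨{(t + 863999) / 864000} ×ˢ (Finset.Icc (x / 8000 - 1) (x / 8000 + 1) ×ˢ
      Finset.Icc (y / 8000 - 1) (y / 8000 + 1)), ?_, ?_⟩
    · rw [Finset.card_product, Finset.card_product, Finset.card_singleton, Int.card_Icc, Int.card_Icc]
      have : ∀ a : ℤ, (a + 1 + 1 - (a - 1)).toNat = 3 := fun a => by omega
      rw [this, this]
    · rintro ⟨s, X, Y⟩ hv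
      simp only [sp, reg, Finset.mem_product, Finset.mem_Ioc, Finset.mem_Ico, Finset.mem_singleton, Finset.mem_Icc,
        Nat.cast_ofNat] at hv ⊢
      omega

theorem dom_levels {Ω : Type*} [MeasurableSpace Ω] {μ : Measure Ω} [IsProbabilityMeasure μ]
    {Bd : Ω → Set (ℕ × (ℤ × ℤ))} {e : ℕ} (h : Dom μ Bd ((1 / 2) ^ e)) (he : 10000000000 ≤ e) (n : ℕ) :
    Dom μ (fun ω => (Bd' 8000)^[n] (Bd ω)) ((1 / 2) ^ (1728000 ^ n * e)) := by
  induction n with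
  | zero => simpa using h
  | succ n ih =>
    simp only [Function.iterate_succ_apply']
    rw [pow_succ', mul_assoc]
    refine dom_level ih (he.trans ?_)
    exact Nat.le_mul_of_pos_left _ (by positivity)

theorem level_local {b : ℕ} {Bd Bd2 : Set (ℕ × (ℤ × ℤ))} {τ : ℕ} (h : ∀ Z ∈ Bd, Z.1 ≤ 108 * b * τ → Z ∈ Bd2) :
    ∀ Z ∈ Bd' b Bd, Z.1 ≤ τ → Z ∈ Bd' b Bd2 := by
  classical
  intro Z hZ hτ
  refine lt_of_lt_of_le hZ (Nat.mul_le_mul_left 4 (Finset.card_le_card fun u hu => ?_))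
  rw [Finset.mem_filter] at hu ⊢
  refine ⟨hu.1, h u hu.2 ?_⟩
  have := (Finset.mem_Ioc.1 (Finset.mem_product.1 hu.1).1).2
  exact this.trans (Nat.mul_le_mul_left _ hτ)

theorem levels_local {b : ℕ} (n : ℕ) : ∀ {Bd Bd2 : Set (ℕ × (ℤ × ℤ))} {τ : ℕ},
    (∀ Z ∈ Bd, Z.1 ≤ (108 * b) ^ n * τ → Z ∈ Bd2) → ∀ Z ∈ (Bd' b)^[n] Bd, Z.1 ≤ τ → Z ∈ (Bd' b)^[n] Bd2 := by
  induction n with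
  | zero => intro Bd Bd2 τ h; simpa using h
  | succ n ih =>
    intro Bd Bd2 τ h
    simp only [Function.iterate_succ_apply']
    refine level_local (ih fun Z hZ hτ => h Z hZ ?_)
    rw [pow_succ, mul_assoc]; exact hτ

def Rg' (b : ℕ) (Rg : Set (ℤ × ℤ)) : Set (ℤ × ℤ) := {Z | (reg b Z : Set (ℤ × ℤ)) ⊆ Rg}
def box2 (X A : ℕ) : Set (ℤ × ℤ) := {v | |v.1| ≤ X ∧ |v.2| ≤ A}
def bf (a : ℕ) : ℕ := 8000 * (a + 2)

theorem levels {Rg R Bd} (h : StepP Rg R Bd) (b n : ℕ) : StepP ((Rg' b)^[n] Rg) ((R' b)^[n] R) ((Bd' b)^[n] Bd) := by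
  induction n with
  | zero => simpa using h
  | succ n ih => simp only [Function.iterate_succ_apply']; exact level ih

theorem reg_box (X A : ℕ) {Z} (hZ : Z ∈ box2 X A) : (reg 8000 Z : Set (ℤ × ℤ)) ⊆ box2 (bf X) (bf A) := by
  rintro ⟨x, y⟩ hv
  obtain ⟨h1, h2⟩ := hZ
  rw [abs_le] at h1 h2
  simp only [reg, Finset.coe_product, Finset.coe_Ico, mem_prod, mem_Ico, Nat.cast_ofNat] at hv
  simp only [box2, mem_setOf_eq, abs_le, bf]
  push_cast
  omega

theorem rg_box (n : ℕ) : ∀ {Rg X A}, box2 (bf^[n] X) (bf^[n] A) ⊆ Rg → box2 X A ⊆ (Rg' 8000)^[n] Rg := by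
  induction n with
  | zero => intro Rg X A h; simpa using h
  | succ n ih =>
    intro Rg X A h
    simp only [Function.iterate_succ_apply'] 
    simp only [Function.iterate_succ_apply] at h
    intro Z hZ
    exact (reg_box X A hZ).trans (ih h)

theorem r_box (n : ℕ) : ∀ {R X A}, box2 (bf^[n] X) (bf^[n] A) ⊆ R 0 → box2 X A ⊆ (R' 8000)^[n] R 0 := by
  classical
  induction n with
  | zero => intro Rg X A h; simpa using h
  | succ n ih =>
    intro R X A h
    simp only [Function.iterate_succ_apply'] 
    simp only [Function.iterate_succ_apply] at h
    intro Z hZ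
    have : ∀ v ∈ blk 8000 Z, v ∈ (R' 8000)^[n] R (108 * 8000 * 0) := fun v hv =>
      ih h (reg_box X A hZ (blk_reg _ (king_self Z) hv))
    change 8000 ^ 2 ≤ _
    rw [Finset.filter_true_of_mem this, blk_card]; norm_num

theorem r_nonempty (n : ℕ) : ∀ {R : ℕ → Set (ℤ × ℤ)} {τ}, ((R' 8000)^[n] R τ).Nonempty → (R ((108 * 8000) ^ n * τ)).Nonempty := by
  classical
  induction n with
  | zero => intro R τ h; simpa using h
  | succ n ih =>
    intro R τ h
    simp only [Function.iterate_succ_apply'] at h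
    obtain ⟨Z, hZ⟩ := h
    have hZ : 8000 ^ 2 ≤ 2 * ((blk 8000 Z).filter (· ∈ (R' 8000)^[n] R (108 * 8000 * τ))).card := hZ
    obtain ⟨v, hv⟩ : ((blk 8000 Z).filter (· ∈ (R' 8000)^[n] R (108 * 8000 * τ))).Nonempty := by
      rw [← Finset.card_pos]; omega
    have := ih ⟨v, (Finset.mem_filter.1 hv).2⟩
    rwa [pow_succ, mul_assoc]
end E2
section E3

def stp (m : Fin 4) (P : ℕ × ℤ) : ℕ × ℤ :=
  if m = 0 then (P.1, P.2 - 1) else if m = 1 then (P.1 - 1, P.2 + 1) else if m = 2 then (P.1, P.2 + 1) else (P.1 + 1, P.2 + 1)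

def Sn (Bd : Set (ℕ × ℤ)) : ℕ → ℕ × ℤ → Prop
  | 0, P => P.2 ≤ 0
  | n + 1, P => ∃ m : Fin 4, (m = 0 → P ∈ Bd) ∧ Sn Bd n (stp m P)

def Sd (Bd : Set (ℕ × ℤ)) (P : ℕ × ℤ) : Prop := ∃ n, Sn Bd n P

theorem Sd.pred {Bd P} (m : Fin 4) (hm : m = 0 → P ∈ Bd) (h : Sd Bd (stp m P)) : Sd Bd P :=
  h.elim fun n h => ⟨n + 1, m, hm, h⟩

theorem lip {Rg R Bd} (h : StepP Rg R Bd) (W : ℕ) (H : ℕ) (hR : ∀ x : ℤ, 0 ≤ x → x ≤ W → (x, (0 : ℤ)) ∈ R 0)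
    (hRg : ∀ x : ℤ, 0 ≤ x → x ≤ W + H → (x, (0 : ℤ)) ∈ Rg) (hS : ¬ Sd {P | (P.1, (P.2, (0 : ℤ))) ∈ Bd} (0, W)) :
    (R H).Nonempty := by
  set B := {P : ℕ × ℤ | (P.1, (P.2, (0 : ℤ))) ∈ Bd}
  have low : ∀ τ x, x ≤ 0 → Sd B (τ, x) := fun τ x hx => ⟨0, hx⟩
  have d1 : ∀ τ x, Sd B (τ, x + 1) → Sd B (τ + 1, x) := fun τ x h => Sd.pred 1 (by simp) (by simpa [stp] using h)
  have d3 : ∀ τ x, Sd B (τ + 1, x + 1) → Sd B (τ, x) := fun τ x h => Sd.pred 3 (by simp) (by simpa [stp] using h)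
  have up : ∀ τ x, Sd B (τ, x - 1) → (τ, (x, (0 : ℤ))) ∈ Bd → Sd B (τ, x) := fun τ x h hb =>
    Sd.pred 0 (fun _ => hb) (by simpa [stp] using h)
  have main : ∀ τ ≤ H, ∃ x : ℤ, x ≤ W + τ ∧ ¬ Sd B (τ, x) ∧ Sd B (τ, x - 1) ∧ (x, (0 : ℤ)) ∈ R τ := by
    intro τ
    induction τ with
    | zero =>
      intro _
      classical
      let P : ℕ → Prop := fun n => ¬ Sd B (0, (n : ℤ))
      have ex : ∃ n, P n := ⟨W, hS⟩
      have h1 := Nat.find_spec ex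
      have h2 : Nat.find ex ≤ W := Nat.find_min' ex hS
      have h3 : Sd B (0, (Nat.find ex : ℤ) - 1) := by
        by_cases h0 : Nat.find ex = 0
        · rw [h0]; exact low _ _ (by norm_num)
        · have := Nat.find_min ex (m := Nat.find ex - 1) (by omega)
          simp only [P, not_not] at this
          rwa [Nat.cast_sub (by omega), Nat.cast_one] at this
      exact ⟨Nat.find ex, by push_cast; omega, h1, h3, hR _ (by positivity) (by exact_mod_cast h2)⟩
    | succ τ ih =>
      intro hτ
      obtain ⟨x, x1, x2, x3, x4⟩ := ih (by omega)
      have n1 : ¬ Sd B (τ + 1, x + 1) := fun h => x2 (d3 _ _ h)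
      have n2 : Sd B (τ + 1, x - 1 - 1) := d1 _ _ (by simpa using x3)
      obtain ⟨x', k1, k2, k3⟩ : ∃ x', |x - x'| ≤ 1 ∧ ¬ Sd B (τ + 1, x') ∧ Sd B (τ + 1, x' - 1) := by
        by_cases c1 : Sd B (τ + 1, x)
        · exact ⟨x + 1, by simp, n1, by simpa using c1⟩
        by_cases c2 : Sd B (τ + 1, x - 1)
        · exact ⟨x, by simp, c1, c2⟩
        · exact ⟨x - 1, by simp, c2, n2⟩
      have hx' : 0 < x' := by by_contra hc; exact k2 (low _ _ (by omega))
      have ka := abs_le.1 k1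
      refine ⟨x', by push_cast; omega, k2, k3, h τ _ _ x4 ⟨k1, by simp⟩ (hRg _ hx'.le (by omega)) fun hb => k2 (up _ _ k3 hb)⟩
  obtain ⟨x, _, _, _, hx⟩ := main H le_rfl
  exact ⟨_, hx⟩

open Classical in
noncomputable def ups : List (Fin 4) → ℕ × ℤ → Finset (ℕ × ℤ)
  | [], _ => ∅
  | m :: l, P => if m = 0 then insert P (ups l (stp m P)) else ups l (stp m P)

theorem ups_time (l : List (Fin 4)) : ∀ P, ∀ Q ∈ ups l P, Q.1 ≤ P.1 + l.length := by
  classical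
  induction l with
  | nil => intro P Q h; simp [ups] at h
  | cons m l ih =>
    intro P Q h
    have h' : Q = P ∨ Q ∈ ups l (stp m P) := by
      simp only [ups] at h; split_ifs at h
      · simpa using h
      · exact .inr h
    rcases h' with rfl | h'
    · omega
    · have := ih _ _ h'
      have e : (stp m P).1 ≤ P.1 + 1 := by simp only [stp]; split_ifs <;> simp only [] <;> omega
      simp only [List.length_cons]; omega

theorem walk {Bd : Set (ℕ × ℤ)} (n : ℕ) : ∀ P, Sn Bd n P → (∀ k < n, ¬ Sn Bd k P) →
    ∃ l : List (Fin 4), l.length = n ∧ (ups l P : Set (ℕ × ℤ)) ⊆ Bd ∧ (n : ℤ) + P.2 ≤ 2 * (ups l P).card ∧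
      ∀ Q ∈ ups l P, ∃ k ≤ n, Sn Bd k Q ∧ ∀ k' < k, ¬ Sn Bd k' Q := by
  classical
  induction n with
  | zero => intro P h _; exact ⟨[], rfl, by simp [ups], by simpa [ups, Sn] using h, by simp [ups]⟩
  | succ n ih =>
    rintro P ⟨m, hm, h⟩ hmin
    obtain ⟨l, l1, l2, l3, l4⟩ := ih _ h fun k hk hc => hmin (k + 1) (by omega) ⟨m, hm, hc⟩
    by_cases h0 : m = 0
    · have hP : P ∉ ups l (stp m P) := fun hc => by
        obtain ⟨k, k1, k2, k3⟩ := l4 P hc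
        exact hmin k (by omega) k2
      have e : ups (m :: l) P = insert P (ups l (stp m P)) := by simp [ups, h0]
      have e2 : (stp m P).2 = P.2 - 1 := by simp [stp, h0]
      refine ⟨m :: l, by simp [l1], ?_, ?_, ?_⟩
      · rw [e, Finset.coe_insert, insert_subset_iff]; exact ⟨hm h0, l2⟩
      · rw [e, Finset.card_insert_of_notMem hP]; push_cast; omega
      · rw [e]
        intro Q hQ
        rcases Finset.mem_insert.1 hQ with rfl | hQ
        · exact ⟨n + 1, le_rfl, ⟨m, hm, h⟩, hmin⟩
        · obtain ⟨k, k1, k2⟩ := l4 Q hQ; exact ⟨k, by omega, k2⟩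
    · have e : ups (m :: l) P = ups l (stp m P) := by simp [ups, h0]
      have e2 : (stp m P).2 = P.2 + 1 := by simp only [stp, h0, if_false]; split_ifs <;> rfl
      refine ⟨m :: l, by simp [l1], by rw [e]; exact l2, by rw [e]; push_cast; omega, ?_⟩
      rw [e]
      intro Q hQ
      obtain ⟨k, k1, k2⟩ := l4 Q hQ; exact ⟨k, by omega, k2⟩

theorem ups_card (l : List (Fin 4)) : ∀ P, (ups l P).card ≤ l.length := by
  classical
  induction l with
  | nil => intro P; simp [ups]
  | cons m l ih =>
    intro P
    have := ih (stp m P)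
    simp only [ups]; split_ifs
    · have := Finset.card_insert_le P (ups l (stp m P)); simp only [List.length_cons]; omega
    · simp only [List.length_cons]; omega

theorem words_lip {Ω : Type*} [MeasurableSpace Ω] (μ : Measure Ω) [IsProbabilityMeasure μ]
    (Bd : (ℕ → Bool) → Ω → Set (ℕ × (ℤ × ℤ))) (T e : ℕ) (he : 2 * T + 3 ≤ e)
    (hD : ∀ ξ, Dom μ (Bd ξ) ((1 / 2) ^ (2 * e)))
    (hloc : ∀ ξ ξ' τ, (∀ i < T * (τ + 1), ξ i = ξ' i) → ∀ ω, ∀ Z ∈ Bd ξ ω, Z.1 ≤ τ → Z ∈ Bd ξ' ω) (W : ℕ) (hW : 1 ≤ W) :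
    μ {ω | ∃ ξ, Sd {P | (P.1, (P.2, (0 : ℤ))) ∈ Bd ξ ω} (0, W)} ≤ 2 * (1 / 2) ^ W := by
  classical
  let em : ℕ × ℤ ↪ ℕ × (ℤ × ℤ) := ⟨fun P => (P.1, (P.2, 0)), fun P Q h => by
    simp only [Prod.mk.injEq] at h; exact Prod.ext h.1 h.2.1⟩
  let pre (n : ℕ) (f : Fin (T * (n + 1)) → Bool) : ℕ → Bool := fun i => if h : i < T * (n + 1) then f ⟨i, h⟩ else false
  let Dl (n : ℕ) (l : List.Vector (Fin 4) n) : Finset (ℕ × (ℤ × ℤ)) := (ups l.1 (0, (W : ℤ))).map em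
  let E (n : ℕ) : Set Ω := ⋃ l : {l : List.Vector (Fin 4) n // n ≤ 2 * (Dl n l).card},
    ⋃ f : Fin (T * (n + 1)) → Bool, {ω | (Dl n l.1 : Set (ℕ × (ℤ × ℤ))) ⊆ Bd (pre n f) ω}
  have cov : {ω | ∃ ξ, Sd {P | (P.1, (P.2, (0 : ℤ))) ∈ Bd ξ ω} (0, W)} ⊆ ⋃ n, E (W + n) := by
    rintro ω ⟨ξ, hξ⟩
    have hn := Nat.find_spec hξ
    obtain ⟨l, l1, l2, l3, -⟩ := walk _ _ hn fun k hk => Nat.find_min hξ hk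
    set n := Nat.find hξ
    have lc := ups_card l (0, (W : ℤ))
    obtain ⟨n', hn'⟩ : ∃ n', n = W + n' := ⟨n - W, by simp only at l3; omega⟩
    simp only [mem_iUnion]
    refine ⟨n', ?_⟩
    rw [← hn']
    simp only [E, mem_iUnion]
    refine ⟨⟨⟨l, l1⟩, ?_⟩, fun i => ξ i, ?_⟩
    · simp only [Dl, Finset.card_map]; simp only at l3; omega
    · intro Z hZ
      simp only [Dl, Finset.coe_map, mem_image, Finset.mem_coe] at hZ
      obtain ⟨P, hP, rfl⟩ := hZ
      have ht := ups_time l _ P hP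
      refine hloc ξ _ n (fun i hi => by simp [pre, hi]) ω _ (l2 hP) ?_
      simp only [zero_add] at ht
      exact ht.trans l1.le
  have hE : ∀ n, W ≤ n → μ (E n) ≤ (1 / 2) ^ n := by
    intro n hn
    have : μ.real (E n) ≤ (1 / 2) ^ n := by
      calc μ.real (E n) ≤ ∑ l : {l : List.Vector (Fin 4) n // n ≤ 2 * (Dl n l).card},
            μ.real (⋃ f : Fin (T * (n + 1)) → Bool, {ω | (Dl n l.1 : Set (ℕ × (ℤ × ℤ))) ⊆ Bd (pre n f) ω}) :=
            measureReal_iUnion_fintype_le _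
        _ ≤ ∑ l : {l : List.Vector (Fin 4) n // n ≤ 2 * (Dl n l).card}, ∑ f : Fin (T * (n + 1)) → Bool,
            (1 / 2 : ℝ) ^ (e * n) := by
            refine Finset.sum_le_sum fun l _ => (measureReal_iUnion_fintype_le _).trans (Finset.sum_le_sum fun f _ => ?_)
            refine (hD _ _).trans ?_
            rw [← pow_mul]
            refine pow_le_pow_of_le_one (by norm_num) (by norm_num) ?_
            have := l.2
            nlinarith
        _ ≤ (4 : ℝ) ^ n * (2 ^ (T * (n + 1)) * (1 / 2 : ℝ) ^ (e * n)) := by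
            rw [Finset.sum_const, Finset.sum_const, nsmul_eq_mul, nsmul_eq_mul, Finset.card_univ, Finset.card_univ]
            have c1 : Fintype.card {l : List.Vector (Fin 4) n // n ≤ 2 * (Dl n l).card} ≤ 4 ^ n := by
              refine (Fintype.card_subtype_le _).trans ?_
              rw [card_vector]; simp
            have c2 : Fintype.card (Fin (T * (n + 1)) → Bool) = 2 ^ (T * (n + 1)) := by simp
            rw [c2]
            have c1' : (Fintype.card {l : List.Vector (Fin 4) n // n ≤ 2 * (Dl n l).card} : ℝ) ≤ 4 ^ n := by exact_mod_cast c1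
            push_cast
            gcongr
        _ ≤ (1 / 2) ^ n := by
            rw [show (4 : ℝ) = 2 ^ 2 by norm_num, ← pow_mul, ← mul_assoc, ← pow_add, one_div, inv_pow, inv_pow,
              ← div_eq_mul_inv, div_le_iff₀ (by positivity), inv_mul_eq_div, le_div_iff₀ (by positivity), ← pow_add]
            refine pow_le_pow_right₀ (by norm_num) ?_
            nlinarith
    rw [← ENNReal.ofReal_toReal (measure_ne_top μ (E n))]
    refine (ENNReal.ofReal_le_ofReal this).trans (le_of_eq ?_)
    rw [ENNReal.ofReal_pow (by norm_num), ENNReal.ofReal_div_of_pos (by norm_num)]; simp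
  calc _ ≤ μ (⋃ n, E (W + n)) := measure_mono cov
    _ ≤ ∑' n, μ (E (W + n)) := measure_iUnion_le _
    _ ≤ ∑' n, (1 / 2 : ENNReal) ^ W * (1 / 2) ^ n := ENNReal.tsum_le_tsum fun n => by
        rw [← pow_add]; exact hE _ (by omega)
    _ = 2 * (1 / 2) ^ W := by
        rw [ENNReal.tsum_mul_left, ENNReal.tsum_geometric, mul_comm]; simp
end E3
section E4

def StepB (Rg : Set (ℤ × ℤ)) (R : ℕ → Set (ℤ × ℤ)) (Bd : Set (ℕ × (ℤ × ℤ))) : Prop :=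
  ∀ t v w, v ∈ R t → (t % 2 = 0 → |v.1 - w.1| = 1 ∧ v.2 = w.2) → (t % 2 = 1 → v.1 = w.1 ∧ |v.2 - w.2| = 1) →
    w ∈ Rg → (t + 1, w) ∉ Bd → w ∈ R (t + 1)

def R0 (R : ℕ → Set (ℤ × ℤ)) (τ : ℕ) : Set (ℤ × ℤ) := {v | (2 * v.1, 2 * v.2) ∈ R (4 * τ)}
noncomputable def rg0 (Z : ℕ × (ℤ × ℤ)) : Finset (ℕ × (ℤ × ℤ)) :=
  Finset.Ioc (4 * Z.1 - 4) (4 * Z.1) ×ˢ (Finset.Icc (2 * Z.2.1 - 2) (2 * Z.2.1 + 2) ×ˢ Finset.Icc (2 * Z.2.2 - 2) (2 * Z.2.2 + 2))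
def Bd0 (Bd : Set (ℕ × (ℤ × ℤ))) : Set (ℕ × (ℤ × ℤ)) := {Z | ∃ u ∈ rg0 Z, u ∈ Bd}

theorem base_king {Rg R Bd} (h : StepB Rg R Bd) {X A : ℕ} (hR : box2 (2 * X + 2) (2 * A + 2) ⊆ Rg) :
    StepP (box2 X A) (R0 R) (Bd0 Bd) := by
  rintro τ ⟨v1, v2⟩ ⟨w1, w2⟩ hv ⟨k1, k2⟩ ⟨b1, b2⟩ hb
  simp only [R0, mem_setOf_eq, abs_le] at *

  have hb' : ∀ t : ℕ, 4 * τ < t → t ≤ 4 * τ + 4 → ∀ x y : ℤ, |x - 2 * w1| ≤ 2 → |y - 2 * w2| ≤ 2 → (t, (x, y)) ∉ Bd := by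
    intro t h1 h2 x y h3 h4 h5
    refine hb ⟨_, ?_, h5⟩
    rw [abs_le] at h3 h4
    simp only [rg0, Finset.mem_product, Finset.mem_Ioc, Finset.mem_Icc]
    omega
  have hg : ∀ x y : ℤ, |x - 2 * w1| ≤ 2 → |y - 2 * w2| ≤ 2 → (x, y) ∈ Rg := by
    intro x y h3 h4
    apply hR
    rw [abs_le] at h3 h4
    simp only [box2, mem_setOf_eq, abs_le]; push_cast; omega
  obtain ⟨a, ha, ha'⟩ : ∃ a : ℤ, |2 * v1 - a| = 1 ∧ |a - 2 * w1| = 1 := by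
    simp only [abs_eq (zero_le_one' ℤ)]
    rcases (by omega : v1 = w1 ∨ v1 = w1 + 1 ∨ v1 = w1 - 1) with h | h | h
    · exact ⟨2 * w1 + 1, by omega⟩
    · exact ⟨2 * w1 + 1, by omega⟩
    · exact ⟨2 * w1 - 1, by omega⟩
  obtain ⟨c, hc, hc'⟩ : ∃ a : ℤ, |2 * v2 - a| = 1 ∧ |a - 2 * w2| = 1 := by
    simp only [abs_eq (zero_le_one' ℤ)]
    rcases (by omega : v2 = w2 ∨ v2 = w2 + 1 ∨ v2 = w2 - 1) with h | h | h
    · exact ⟨2 * w2 + 1, by omega⟩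
    · exact ⟨2 * w2 + 1, by omega⟩
    · exact ⟨2 * w2 - 1, by omega⟩
  have e1 : |2 * v2 - 2 * w2| ≤ 2 := by rw [abs_le]; omega
  have s1 := h (4 * τ) _ (a, 2 * v2) hv (fun _ => ⟨ha, rfl⟩) (fun h => by omega) (hg _ _ (by omega) e1)
    (hb' _ (by omega) (by omega) _ _ (by omega) e1)
  have s2 := h (4 * τ + 1) _ (a, c) s1 (fun h => by omega) (fun _ => ⟨rfl, hc⟩) (hg _ _ (by omega) (by omega))
    (hb' _ (by omega) (by omega) _ _ (by omega) (by omega))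
  have s3 := h (4 * τ + 2) _ (2 * w1, c) s2 (fun _ => ⟨ha', rfl⟩) (fun h => by omega) (hg _ _ (by simp) (by omega))
    (hb' _ (by omega) (by omega) _ _ (by simp) (by omega))
  exact h (4 * τ + 3) _ (2 * w1, 2 * w2) s3 (fun h => by omega) (fun _ => ⟨rfl, hc'⟩) (hg _ _ (by simp) (by simp))
    (hb' _ (by omega) (by omega) _ _ (by simp) (by simp))

theorem base_dom {Ω : Type*} [MeasurableSpace Ω] {μ : Measure Ω} [IsProbabilityMeasure μ]
    {Bd : Ω → Set (ℕ × (ℤ × ℤ))} {e e' : ℕ} (h : Dom μ Bd ((1/2) ^ e)) (he : 50 * (e' + 100) ≤ e) :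
    Dom μ (fun ω => Bd0 (Bd ω)) ((1/2) ^ e') := by
  classical
  refine coarse (j := 1) (r := 100) (κ := 50) h _ rg0 ?_ ?_ ?_ (by omega) (by norm_num)
  · rintro ω Z ⟨u, hu, hu'⟩
    exact ⟨{u}, by simpa using hu, by simpa using hu', by simp⟩
  · intro Z
    simp only [rg0, Finset.card_product, Nat.card_Ioc, Int.card_Icc]
    have e1 : (2 * Z.2.1 + 2 + 1 - (2 * Z.2.1 - 2)).toNat = 5 := by omega
    have e2 : (2 * Z.2.2 + 2 + 1 - (2 * Z.2.2 - 2)).toNat = 5 := by omega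
    rw [e1, e2]; omega
  · intro u
    refine ⟨Finset.Icc ((u.1 + 3) / 4) ((u.1 + 3)/4) ×ˢ (Finset.Icc (u.2.1 / 2 - 1) (u.2.1 / 2 + 2) ×ˢ Finset.Icc (u.2.2 / 2 - 1) (u.2.2 / 2 + 1)), ?_, ?_⟩
    · simp only [Finset.card_product, Nat.card_Icc, Int.card_Icc]
      have e1 : (u.2.1 / 2 + 2 + 1 - (u.2.1 / 2 - 1)).toNat = 4 := by omega
      have e2 : (u.2.2 / 2 + 1 + 1 - (u.2.2 / 2 - 1)).toNat = 3 := by omega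
      rw [e1, e2]; omega
    · intro Z hZ
      simp only [rg0, Finset.mem_product, Finset.mem_Ioc, Finset.mem_Icc] at *
      omega

theorem base_local {Bd Bd2 : Set (ℕ × (ℤ × ℤ))} {τ : ℕ} (h : ∀ Z ∈ Bd, Z.1 ≤ 4 * τ → Z ∈ Bd2) :
    ∀ Z ∈ Bd0 Bd, Z.1 ≤ τ → Z ∈ Bd0 Bd2 := by
  rintro Z ⟨u, hu, hu'⟩ hZ
  refine ⟨u, hu, h _ hu' ?_⟩
  simp only [rg0, Finset.mem_product, Finset.mem_Ioc, Finset.mem_Icc] at *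
  omega

end E4
section D1
variable {d : ℕ} [NeZero d] {K : ℕ}

theorem adj_cl {C : Set (Vtx d)} {u v : Vtx d} (hu : u ∈ C) (a : adj u v) : v ∈ cl C := by
  by_cases h : v ∈ C
  exacts [.inl h, .inr ⟨h, u, hu, a⟩]

theorem newC_det {C L : Set (Vtx d)} {c : Fin (K + 1)} {ω ω' : Bits d K}
    (h0 : ∀ v ∈ cl (newC C L c ω), v ∈ L → ω (v, 0) = ω' (v, 0)) (h1 : ∀ v ∈ nb C ∩ L, ω (v, c) = ω' (v, c)) :
    newC C L c ω = newC C L c ω' := by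
  have hS : ∀ w, (w ∈ nb C ∩ L ∧ ω (w, c) = true) ↔ (w ∈ nb C ∩ L ∧ ω' (w, c) = true) := by
    intro w
    constructor <;> rintro ⟨h, h'⟩ <;> exact ⟨h, by simpa [h1 w h] using h'⟩
  unfold newC
  congr 1
  ext v
  constructor
  · intro h
    induction h with
    | base h => exact Rch.base ((hS _).1 h)
    | @step u v h a ho ih =>
      refine Rch.step ih a ⟨⟨?_, ho.1.2⟩, ho.2⟩
      have := h0 v (.inl (.inr (Rch.step h a ho))) ho.1.2
      simpa [O0, this] using ho.1.1
  · intro h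
    induction h with
    | base h => exact Rch.base ((hS _).2 h)
    | @step u v h a ho ih =>
      refine Rch.step ih a ⟨⟨?_, ho.1.2⟩, ho.2⟩
      have := h0 v (adj_cl (.inr ih) a) ho.1.2
      simpa [O0, this] using ho.1.1

abbrev Act (d : ℕ) := Option (Vtx d) ⊕ (Vtx d × Fin d × (Fin d → ℤˣ))
abbrev Pol (d : ℕ) := ℕ → (ℕ → Option (Vtx d)) → Act d

def LamA (m r : ℕ) (a : Vtx d × Fin d × (Fin d → ℤˣ)) : Set (Vtx d) := LamF a.1 a.2.1 a.2.2 m r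
open Classical in
noncomputable def sel (m r : ℕ) (a : Vtx d × Fin d × (Fin d → ℤˣ)) (C : Set (Vtx d)) : Option (Vtx d) :=
  if h : succ a.1 a.2.1 a.2.2 m r C then some (fr a.1 a.2.1 a.2.2 h.choose) else none

noncomputable def nxt (m r : ℕ) (col : ℕ → Fin (K + 1)) (ω : Bits d K) (k : ℕ) (σ : Set (Vtx d) × (ℕ → Option (Vtx d))) :
    Act d → Set (Vtx d) × (ℕ → Option (Vtx d))
  | .inl o => (σ.1, Function.update σ.2 k o)
  | .inr a => (newC σ.1 (LamA m r a) (col k) ω, Function.update σ.2 k (sel m r a (newC σ.1 (LamA m r a) (col k) ω)))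

noncomputable def St (B : Set (Vtx d)) (pol : Pol d) (m r : ℕ) (col : ℕ → Fin (K + 1)) (ω : Bits d K) :
    ℕ → Set (Vtx d) × (ℕ → Option (Vtx d))
  | 0 => (B, fun _ => none)
  | k + 1 => nxt m r col ω k (St B pol m r col ω k) (pol k (St B pol m r col ω k).2)

variable {B : Set (Vtx d)} {pol : Pol d} {m r : ℕ} {col : ℕ → Fin (K + 1)}

noncomputable def res (B : Set (Vtx d)) (pol : Pol d) (m r : ℕ) (col : ℕ → Fin (K + 1)) (ω : Bits d K) (k : ℕ) : Option (Vtx d) :=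
  (St B pol m r col ω (k + 1)).2 k

def PLoc (pol : Pol d) : Prop := ∀ k ρ ρ', (∀ j < k, ρ j = ρ' j) → pol k ρ = pol k ρ'

theorem nxt_ne (ω : Bits d K) (k σ) (x : Act d) {j} (hj : j ≠ k) : (nxt m r col ω k σ x).2 j = σ.2 j := by
  rcases x with o | a <;> simp [nxt, hj]

theorem St_res (ω : Bits d K) {j : ℕ} : ∀ {k}, j < k → (St B pol m r col ω k).2 j = res B pol m r col ω j := by
  intro k
  induction k with
  | zero => intro h; omega
  | succ k ih =>
    intro h
    by_cases hj : j = k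
    · subst hj; rfl
    · rw [St, nxt_ne _ _ _ _ hj]; exact ih (by omega)

theorem pol_res (hl : PLoc pol) (ω : Bits d K) (k j : ℕ) (h : j ≤ k) :
    pol j (St B pol m r col ω k).2 = pol j (res B pol m r col ω) :=
  hl _ _ _ fun i hi => St_res ω (by omega)

def Legal (m r : ℕ) (pol : Pol d) (ρ : ℕ → Option (Vtx d)) : Prop := ∀ k, (∀ o, pol k ρ = .inl o → ρ k = o) ∧
  ∀ a, pol k ρ = .inr a → ∀ x ∈ ρ k, ∃ c ∈ grid0 d m r, x = fr a.1 a.2.1 a.2.2 c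

theorem sel_spec {a : Vtx d × Fin d × (Fin d → ℤˣ)} {C x} (h : x ∈ sel m r a C) :
    (∃ c ∈ grid0 d m r, x = fr a.1 a.2.1 a.2.2 c) ∧ bx x m ⊆ C := by
  unfold sel at h
  split_ifs at h with h'
  · simp only [Option.mem_def, Option.some.injEq] at h
    subst h
    exact ⟨⟨_, h'.choose_spec.1, rfl⟩, h'.choose_spec.2⟩
  · simp at h

theorem St_inl (hl : PLoc pol) {ω : Bits d K} {k o} (h : pol k (res B pol m r col ω) = .inl o) :
    (St B pol m r col ω (k + 1)).1 = (St B pol m r col ω k).1 ∧ res B pol m r col ω k = o := by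
  rw [← pol_res hl ω k k le_rfl] at h
  simp only [res, St, h, nxt]; simp

theorem St_inr (hl : PLoc pol) {ω : Bits d K} {k a} (h : pol k (res B pol m r col ω) = .inr a) :
    (St B pol m r col ω (k + 1)).1 = newC (St B pol m r col ω k).1 (LamA m r a) (col k) ω ∧
      res B pol m r col ω k = sel m r a (St B pol m r col ω (k + 1)).1 := by
  rw [← pol_res hl ω k k le_rfl] at h
  simp only [res, St, h, nxt]; simp

theorem legal_res (hl : PLoc pol) (ω : Bits d K) : Legal m r pol (res B pol m r col ω) := by
  intro k
  refine ⟨fun o h => (St_inl hl h).2, fun a h x hx => ?_⟩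
  rw [(St_inr hl h).2] at hx
  exact (sel_spec hx).1

theorem St_mono (hl : PLoc pol) (ω : Bits d K) {j k : ℕ} (h : j ≤ k) :
    (St B pol m r col ω j).1 ⊆ (St B pol m r col ω k).1 := by
  induction k, h using Nat.le_induction with
  | base => exact subset_rfl
  | succ k _ ih =>
    refine ih.trans ?_
    rcases h : pol k (res B pol m r col ω) with o | a
    · rw [(St_inl hl h).1]
    · rw [(St_inr hl h).1]; exact subset_union_left

theorem seed_mem (hl : PLoc pol) (ω : Bits d K) {j k : ℕ} (h : j < k) {a x} (hj : pol j (res B pol m r col ω) = .inr a)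
    (hx : res B pol m r col ω j = some x) : bx x m ⊆ (St B pol m r col ω k).1 := by
  rw [(St_inr hl hj).2] at hx
  exact (sel_spec hx).2.trans (St_mono hl ω h)

theorem LamA_fin (a : Vtx d × Fin d × (Fin d → ℤˣ)) : (LamA m r a).Finite := LamF_fin _ _ _ _ _

theorem newC_sub {C L : Set (Vtx d)} {c : Fin (K + 1)} {ω : Bits d K} : newC C L c ω ⊆ C ∪ L := by
  rintro v (h | h)
  · exact .inl h
  · rcases Rch.mem h with h | h
    exacts [.inr h.1.2, .inr h.1.2]

theorem St_sub (hl : PLoc pol) (ω : Bits d K) (k : ℕ) : ∀ v ∈ (St B pol m r col ω k).1,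
    v ∈ B ∨ ∃ j < k, ∃ a, pol j (res B pol m r col ω) = .inr a ∧ v ∈ LamA m r a := by
  induction k with
  | zero => exact fun v hv => .inl hv
  | succ k ih =>
    intro v hv
    rcases h : pol k (res B pol m r col ω) with o | a
    · rw [(St_inl hl h).1] at hv
      exact (ih v hv).imp_right fun ⟨j, h, h'⟩ => ⟨j, by omega, h'⟩
    · rw [(St_inr hl h).1] at hv
      rcases newC_sub hv with hv | hv
      · exact (ih v hv).imp_right fun ⟨j, h, h'⟩ => ⟨j, by omega, h'⟩
      · exact .inr ⟨k, by omega, a, h, hv⟩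

theorem St_fin (hl : PLoc pol) (hB : B.Finite) (ω : Bits d K) (k : ℕ) : (St B pol m r col ω k).1.Finite := by
  induction k with
  | zero => exact hB
  | succ k ih =>
    rcases h : pol k (res B pol m r col ω) with o | a
    · rw [(St_inl hl h).1]; exact ih
    · rw [(St_inr hl h).1]; exact newC_fin ih (LamA_fin a) _ _

theorem St_range (hl : PLoc pol) (hB : B.Finite) (k : ℕ) : (range fun ω : Bits d K => St B pol m r col ω k).Finite := by
  induction k with
  | zero => exact (finite_singleton (B, fun _ => none)).subset (by rintro _ ⟨ω, rfl⟩; rfl)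
  | succ k ih =>
    have : range (fun ω : Bits d K => St B pol m r col ω (k + 1)) ⊆
        ⋃ σ ∈ range (fun ω : Bits d K => St B pol m r col ω k), range fun ω : Bits d K => nxt m r col ω k σ (pol k σ.2) := by
      rintro _ ⟨ω, rfl⟩
      exact mem_biUnion (mem_range_self ω) ⟨ω, rfl⟩
    refine (ih.biUnion fun σ hσ => ?_).subset this
    have hf : σ.1.Finite := by obtain ⟨ω, rfl⟩ := hσ; exact St_fin hl hB ω k
    rcases h : pol k σ.2 with o | a
    · exact (finite_singleton _).subset (by rintro _ ⟨ω, rfl⟩; rfl)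
    · refine (((hf.union (LamA_fin (m := m) (r := r) a)).finite_subsets).image
        fun C' => (C', Function.update σ.2 k (sel m r a C'))).subset ?_
      rintro _ ⟨ω, rfl⟩
      exact ⟨newC σ.1 (LamA m r a) (col k) ω, newC_sub, rfl⟩

theorem St_det (hl : PLoc pol) {ω ω' : Bits d K} {k : ℕ}
    (h1 : ∀ j < k, ∀ a, pol j (res B pol m r col ω) = .inr a → ∀ v ∈ cl (St B pol m r col ω k).1, v ∈ LamA m r a →
      ω (v, 0) = ω' (v, 0) ∧ ω (v, col j) = ω' (v, col j)) : St B pol m r col ω k = St B pol m r col ω' k := by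
  induction k with
  | zero => rfl
  | succ k ih =>
    have hm := cl_mono (St_mono (B := B) (m := m) (r := r) (col := col) hl ω (Nat.le_succ k))
    have e := ih fun j hj a ha v hv => h1 j (by omega) a ha v (hm hv)
    rcases h : pol k (res B pol m r col ω) with o | a
    · rw [St, St, ← e]
      rw [← pol_res hl ω k k le_rfl] at h
      rw [h]; rfl
    · have hn : newC (St B pol m r col ω k).1 (LamA m r a) (col k) ω = newC (St B pol m r col ω k).1 (LamA m r a) (col k) ω' := by
        refine newC_det ?_ fun v hv => (h1 k (by omega) a h v (hm (.inr hv.1)) hv.2).2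
        rw [← (St_inr hl h).1]; exact fun v hv hv' => (h1 k (by omega) a h v hv hv').1
      rw [St, St, ← e]
      rw [← pol_res hl ω k k le_rfl] at h
      rw [h]; simp only [nxt, hn]

/-- geometric hypotheses on an exploration policy -/
def Geo (B : Set (Vtx d)) (pol : Pol d) (m r : ℕ) (col : ℕ → Fin (K + 1)) (lev : ℕ → ℕ) : Prop :=
  ∀ ρ, Legal m r pol ρ → ∀ k a, pol k ρ = .inr a →
    col k ≠ 0 ∧ (bx a.1 m ⊆ B ∨ ∃ j < k, (∃ a', pol j ρ = .inr a') ∧ ρ j = some a.1) ∧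
    (∀ z ∈ zone0 d m r, fr a.1 a.2.1 a.2.2 z ∉ cl B) ∧
    ∀ j < k, ∀ a', pol j ρ = .inr a' → (∀ z ∈ zone0 d m r, fr a.1 a.2.1 a.2.2 z ∉ cl (LamA m r a')) ∧
      ∀ u ∈ LamA m r a, u ∈ cl (LamA m r a') → lev j < lev k ∧ col j ≠ col k

theorem cl_St (hl : PLoc pol) (ω : Bits d K) (k : ℕ) {v} (hv : v ∈ cl (St B pol m r col ω k).1) :
    v ∈ cl B ∨ ∃ j < k, ∃ a, pol j (res B pol m r col ω) = .inr a ∧ v ∈ cl (LamA m r a) := by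
  rcases hv with hv | ⟨_, u, hu, a⟩
  · exact (St_sub hl ω k v hv).imp .inl fun ⟨j, h, a, h1, h2⟩ => ⟨j, h, a, h1, .inl h2⟩
  · exact (St_sub hl ω k u hu).imp (fun h => adj_cl h a) fun ⟨j, h, b, h1, h2⟩ => ⟨j, h, b, h1, adj_cl h2 a⟩

theorem St_dom (q s0 : unitInterval) {ε : ℝ} (hε : 0 ≤ ε) {lev : ℕ → ℕ} (hl : PLoc pol) (hB : B.Finite) (hg : Geo B pol m r col lev)
    (hL : ∀ (c : Fin (K + 1)), c ≠ 0 → ∀ (b : Vtx d) (i : Fin d) (s : Fin d → ℤˣ) (C : Set (Vtx d)), C.Finite →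
    bx b m ⊆ C → (∀ z ∈ zone0 d m r, fr b i s z ∉ cl C) →
    (Pm (wt d K q s0)).real {ω | ¬ succ b i s m r (newC C (LamF b i s m r) c ω)} ≤ ε) :
    Dom (Pm (wt d K q s0)) (fun ω => {k | (∃ a, pol k (res B pol m r col ω) = .inr a) ∧ res B pol m r col ω k = none}) ε := by
  intro D
  induction D using Finset.induction_on_max with
  | empty => simp
  | insert k D hk ih =>
    rw [Finset.card_insert_of_notMem (fun h => (hk k h).ne rfl), pow_succ']
    let E : Set (Set (Vtx d) × (ℕ → Option (Vtx d))) :=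
      {σ | (∀ j ∈ D, (∃ a, pol j σ.2 = .inr a) ∧ σ.2 j = none) ∧ ∃ a, pol k σ.2 = .inr a}
    have hE : ∀ ω : Bits d K, St B pol m r col ω k ∈ E ↔ (∀ j ∈ D, (∃ a, pol j (res B pol m r col ω) = .inr a) ∧
        res B pol m r col ω j = none) ∧ ∃ a, pol k (res B pol m r col ω) = .inr a := by
      intro ω
      simp only [E, mem_setOf_eq, pol_res hl ω k k le_rfl]
      refine and_congr_left fun _ => forall₂_congr fun j hj => ?_
      rw [pol_res hl ω k j (hk j hj).le, St_res ω (hk j hj)]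
    have key := Pm_fiber_fin (wt d K q s0) (fun ω : Bits d K => St B pol m r col ω k) (St_range hl hB k) E
      {ω | res B pol m r col ω k = none} ε ?_
    · refine le_trans (measureReal_mono ?_) (key.trans (mul_le_mul_of_nonneg_left (le_trans (measureReal_mono ?_) ih) hε))
      · intro ω hω
        have h1 := hω (Finset.mem_insert_self k D)
        exact ⟨(hE ω).2 ⟨fun j hj => hω (Finset.mem_insert_of_mem hj), h1.1⟩, h1.2⟩
      · exact fun ω hω j hj => ((hE ω).1 hω).1 j hj
    · intro σ hσ
      by_cases hx : ∃ ω : Bits d K, St B pol m r col ω k = σ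
      swap
      · push Not at hx
        refine ⟨∅, ∅, ∅, finite_empty, finite_empty, by simp, fun ω ω' _ h => absurd h (hx ω), fun ω ω' _ h => h, by simpa using hε,
          fun ω h => absurd h.1 (hx ω)⟩
      obtain ⟨ω, rfl⟩ := hx
      obtain ⟨-, ⟨b, i, s⟩, ha⟩ := (hE ω).1 hσ
      obtain ⟨g1, g2, g3, g4⟩ := hg _ (legal_res hl ω) k _ ha
      set C := (St B pol m r col ω k).1 with hC
      have hCf : C.Finite := St_fin hl hB ω k
      refine ⟨(fun v => (v, 0)) '' cl C ∪ {x | x.1 ∈ cl C ∧ ∃ j < k, ∃ a, pol j (res B pol m r col ω) = .inr a ∧ x.1 ∈ LamA m r a ∧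
          x.2 = col j}, _, {ω | ¬ succ b i s m r (newC C (LamF b i s m r) (col k) ω)}, ?_, ?_, ?_, ?_,
          newC_dep (col k) (fun C' => ¬ succ b i s m r C'), hL _ g1 b i s C hCf ?_ ?_, ?_⟩
      · refine ((cl_fin hCf).image _).union (((cl_fin hCf).prod (finite_univ (α := Fin (K + 1)))).subset ?_)
        exact fun x hx => ⟨hx.1, mem_univ _⟩
      · exact (((LamF_fin b i s m r).subset diff_subset).image _).union (((LamF_fin b i s m r).subset inter_subset_right).image _)
      · rw [disjoint_left]
        rintro ⟨v, c⟩ h1 h2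
        rcases h1 with ⟨v', h1, e1⟩ | ⟨h1, j, hj, a, h3, h4, h5⟩ <;> rcases h2 with ⟨v'', h2, e2⟩ | ⟨v'', h2, e2⟩ <;>
          simp only [Prod.mk.injEq] at * <;> obtain ⟨rfl, rfl⟩ := e2
        · exact h2.2 (e1.1 ▸ h1)
        · exact g1 e1.2.symm
        · exact h2.2 h1
        · exact ((g4 j hj a h3).2 _ h2.2 (.inl h4)).2 h5.symm
      · intro ω1 ω2 h h1
        simp only [mem_setOf_eq] at *
        have hr : ∀ j < k, pol j (res B pol m r col ω1) = pol j (res B pol m r col ω) := fun j hj => by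
          rw [← pol_res hl ω k j hj.le, ← h1, pol_res hl ω1 k j hj.le]
        rw [← St_det hl ?_, h1]
        rw [h1]; exact fun j hj a ha v hv hv' => ⟨h _ (.inl ⟨v, hv, rfl⟩), h _ (.inr ⟨hv, j, hj, a, hr j hj ▸ ha, hv', rfl⟩)⟩
      · rcases g2 with h | ⟨j, hj, ⟨a', ha'⟩, h⟩
        · exact h.trans (St_mono hl ω (Nat.zero_le k))
        · exact seed_mem hl ω hj ha' h
      · intro z hz hz'
        rcases cl_St hl ω k hz' with h | ⟨j, hj, a', h1, h2⟩
        · exact g3 z hz h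
        · exact (g4 j hj a' h1).1 z hz h2
      · rintro ω1 ⟨h1, h2⟩ h3
        simp only [mem_setOf_eq] at *
        have h4 : pol k (res B pol m r col ω1) = .inr (b, i, s) := by
          rw [← pol_res hl ω1 k k le_rfl, h1, pol_res hl ω k k le_rfl]; exact ha
        have h5 := St_inr hl h4
        rw [h5.2, h5.1, h1] at h2
        unfold sel at h2
        rw [dif_pos (by exact h3)] at h2
        simp at h2

def ball (B Q : Set (Vtx d)) (ω : Bits d K) : ℕ → Set (Vtx d)
  | 0 => B
  | n + 1 => ball B Q ω n ∪ {v | v ∈ Q ∧ ∃ u ∈ ball B Q ω n, adj u v ∧ ∃ c, ω (v, c) = true}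

theorem ball_mono {Q : Set (Vtx d)} (ω : Bits d K) {a b : ℕ} (h : a ≤ b) : ball B Q ω a ⊆ ball B Q ω b := by
  induction b, h using Nat.le_induction with
  | base => exact subset_rfl
  | succ b _ ih => exact ih.trans subset_union_left

theorem Rch_ball {ω : Bits d K} {Q L S O : Set (Vtx d)} (hQ : L ⊆ Q) (hL : L.Finite) (hSL : S ⊆ L) (hOL : O ⊆ L) (hO : O ⊆ O0 ω) {n : ℕ}
    (hS : S ⊆ ball B Q ω n) : ∀ v, Rch O S v → v ∈ ball B Q ω (n + L.ncard) := by
  have key : ∀ k, (∀ v, Rch O S v → v ∈ ball B Q ω (n + k)) ∨ k ≤ ({v | Rch O S v} ∩ ball B Q ω (n + k)).ncard := by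
    intro k
    have fin : ∀ k, ({v | Rch O S v} ∩ ball B Q ω (n + k)).Finite := fun k => hL.subset fun v hv => by
      rcases Rch.mem hv.1 with h | h
      exacts [hSL h, hOL h]
    induction k with
    | zero => right; omega
    | succ k ih =>
      by_cases h : ∀ v, Rch O S v → v ∈ ball B Q ω (n + k)
      · left; exact fun v hv => ball_mono ω (by omega) (h v hv)
      · right
        have ih := ih.resolve_left h
        have : ∃ v, Rch O S v ∧ v ∈ ball B Q ω (n + (k + 1)) ∧ v ∉ ball B Q ω (n + k) := by
          by_contra hc
          push Not at hc
          refine h fun v hv => ?_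
          induction hv with
          | base h => exact ball_mono ω (by omega) (hS h)
          | @step u v h a ho ih => exact hc v (.step h a ho) (.inr ⟨hQ (hOL ho), u, ih, a, 0, hO ho⟩)
        obtain ⟨v, h1, h2, h3⟩ := this
        refine Nat.succ_le_of_lt (lt_of_le_of_lt ih (ncard_lt_ncard ⟨?_, fun h => h3 (h ⟨h1, h2⟩).2⟩ (fin _)))
        exact fun v hv => ⟨hv.1, ball_mono ω (by omega) hv.2⟩
  intro v hv
  rcases key L.ncard with h | h
  · exact h v hv
  · have e : {v | Rch O S v} ∩ ball B Q ω (n + L.ncard) = L := by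
      refine eq_of_subset_of_ncard_le (fun v hv => ?_) h hL
      rcases Rch.mem hv.1 with h | h
      exacts [hSL h, hOL h]
    have : v ∈ L := by
      rcases Rch.mem hv with h | h
      exacts [hSL h, hOL h]
    rw [← e] at this
    exact this.2

theorem LamA_card (a : Vtx d × Fin d × (Fin d → ℤˣ)) : (LamA m r a).ncard = (Lam0 d m r).ncard := by
  exact ncard_image_of_injective _ (fr a.1 a.2.1 a.2.2).injective

theorem St_ball (hl : PLoc pol) {lev : ℕ → ℕ} (hg : Geo B pol m r col lev) {Q : Set (Vtx d)}
    (hQ : ∀ ρ, Legal m r pol ρ → ∀ k a, pol k ρ = .inr a → LamA m r a ⊆ Q) (ω : Bits d K) (k : ℕ) :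
    ∀ v ∈ (St B pol m r col ω k).1, v ∈ B ∨ ∃ j < k, ∃ a, pol j (res B pol m r col ω) = .inr a ∧ v ∈ LamA m r a ∧
      v ∈ ball B Q ω ((lev j + 1) * ((Lam0 d m r).ncard + 1)) := by
  induction k with
  | zero => exact fun v hv => .inl hv
  | succ k ih =>
    intro v hv
    rcases h : pol k (res B pol m r col ω) with o | a
    · rw [(St_inl hl h).1] at hv
      exact (ih v hv).imp_right fun ⟨j, h, h'⟩ => ⟨j, by omega, h'⟩
    · rw [(St_inr hl h).1] at hv
      rcases hv with hv | hv
      · exact (ih v hv).imp_right fun ⟨j, h, h'⟩ => ⟨j, by omega, h'⟩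
      · right
        refine ⟨k, by omega, a, h, ?_, ?_⟩
        · rcases Rch.mem hv with h | h
          exacts [h.1.2, h.1.2]
        · have := Rch_ball (B := B) (n := lev k * ((Lam0 d m r).ncard + 1) + 1) (hQ _ (legal_res hl ω) k a h) (LamA_fin (m := m) (r := r) a)
            (fun w hw => hw.1.2) (fun w hw => hw.1.2) (fun w hw => hw.1.1) ?_ v hv
          · rw [LamA_card] at this
            exact ball_mono ω (by ring_nf; omega) this
          · rintro w ⟨⟨⟨_, u, hu, ad⟩, hw⟩, hc⟩
            refine .inr ⟨hQ _ (legal_res hl ω) k a h hw, u, ?_, ad, _, hc⟩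
            rcases ih u hu with hu | ⟨j, hj, a', h1, h2, h3⟩
            · exact ball_mono ω (Nat.zero_le _) hu
            · have := ((hg _ (legal_res hl ω) k a h).2.2.2 j hj a' h1).2 w hw (adj_cl h2 ad)
              exact ball_mono ω (Nat.mul_le_mul_right _ this.1) h3

end D1
section D2a
variable {d : ℕ} [NeZero d] {m r : ℕ}

def sg (i : Fin d) (τ : ℤˣ) (L b : Vtx d) : Fin d → ℤˣ :=
  fun j => if j = i then τ else if j = 0 then 1 else if L j < b j then -1 else 1

theorem fr_at (b : Vtx d) (i : Fin d) (s : Fin d → ℤˣ) (x : Vtx d) : fr b i s x i = b i + s i * x 0 := by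
  simp [fr]

theorem fr_ne (b : Vtx d) (i : Fin d) (s : Fin d → ℤˣ) {j : Fin d} (hj : j ≠ i) :
    ∃ j' ≠ 0, ∀ x : Vtx d, fr b i s x j = b j + s j * x j' := by
  refine ⟨Equiv.swap i 0 j, fun h => hj ?_, fun x => by simp [fr]⟩
  rw [Equiv.swap_apply_eq_iff] at h
  simpa using h

theorem unit_sq (τ : ℤˣ) (x : ℤ) : (τ : ℤ) * (τ * x) = x := by
  rcases Int.units_eq_one_or τ with h | h <;> simp [h]

theorem grid_at {i : Fin d} {τ : ℤˣ} {L b c : Vtx d} (hc : c ∈ grid0 d m r) :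
    (τ : ℤ) * (fr b i (sg i τ L b) c i - b i) = hh m r := by
  rw [fr_at]; simp [sg, unit_sq, hc.1]

theorem grid_rg {c : Vtx d} (hc : c ∈ grid0 d m r) {j} (hj : j ≠ 0) : 0 ≤ c j ∧ c j ≤ rho m r - m := by
  obtain ⟨k, h1, h2, h3⟩ := hc.2 j hj
  rw [h3, rho]
  push_cast
  constructor
  · positivity
  · have := mul_le_mul_of_nonneg_left h2 (show (0 : ℤ) ≤ 2 * m + 1 by positivity)
    linarith

theorem grid_zero {i : Fin d} (hi : i ≠ 0) {τ : ℤˣ} {L b c : Vtx d} (hc : c ∈ grid0 d m r) :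
    b 0 ≤ fr b i (sg i τ L b) c 0 ∧ fr b i (sg i τ L b) c 0 ≤ b 0 + (rho m r - m) := by
  obtain ⟨j', h0, h⟩ := fr_ne b i (sg i τ L b) hi.symm
  have := grid_rg hc h0
  rw [h]
  simp only [sg, hi.symm, if_false, if_true, Units.val_one, one_mul]
  omega

theorem grid_ne {i : Fin d} {τ : ℤˣ} {L b c : Vtx d} (hc : c ∈ grid0 d m r) {j} (hj : j ≠ i) (h0 : j ≠ 0)
    (hb : |b j - L j| ≤ hh m r) : |fr b i (sg i τ L b) c j - L j| ≤ hh m r := by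
  obtain ⟨j', h0', h⟩ := fr_ne b i (sg i τ L b) hj
  have := grid_rg hc h0'
  have : (hh m r : ℤ) = rho m r + 2 + m := by simp [hh]
  rw [h]
  rw [abs_le] at *
  simp only [sg, hj, h0, if_false]
  split_ifs <;> simp <;> omega

theorem zone_at {i : Fin d} {τ : ℤˣ} {L b z : Vtx d} (hz : z ∈ zone0 d m r) :
    (rho m r : ℤ) + 2 ≤ τ * (fr b i (sg i τ L b) z i - b i) ∧ τ * (fr b i (sg i τ L b) z i - b i) ≤ hh m r + m := by
  rw [fr_at]
  have := hz.1
  have e : (hh m r : ℤ) = rho m r + 2 + m := by simp [hh]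
  simp only [sg, if_true, add_sub_cancel_left, unit_sq]
  omega

theorem zone_zero {i : Fin d} (hi : i ≠ 0) {τ : ℤˣ} {L b z : Vtx d} (hz : z ∈ zone0 d m r) :
    b 0 - m ≤ fr b i (sg i τ L b) z 0 := by
  obtain ⟨j', h0, h⟩ := fr_ne b i (sg i τ L b) hi.symm
  have := hz.2 j' h0
  rw [h]
  simp only [sg, hi.symm, if_false, if_true, Units.val_one, one_mul]
  omega

theorem zone_lam {z : Vtx d} (hz : z ∈ zone0 d m r) (a : Vtx d × Fin d × (Fin d → ℤˣ)) : fr a.1 a.2.1 a.2.2 z ∈ LamA m r a :=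
  ⟨z, .inr hz, rfl⟩

theorem lam_all {i : Fin d} {s : Fin d → ℤˣ} {b u : Vtx d} (hu : u ∈ LamA m r (b, i, s)) (j) : |u j - b j| ≤ hh m r + m := by
  obtain ⟨x, hx, rfl⟩ := hu
  have := Lam0_sub _ _ _ hx (Equiv.swap i 0 j)
  simp only [fr, Equiv.coe_fn_mk, add_sub_cancel_left, unit_abs, hh]
  simp only [Pi.zero_apply, sub_zero] at this
  push_cast at *
  linarith

theorem lam_at {i : Fin d} {τ : ℤˣ} {L b u : Vtx d} (hu : u ∈ LamA m r (b, i, sg i τ L b)) :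
    -(rho m r : ℤ) ≤ τ * (u i - b i) := by
  obtain ⟨x, hx, rfl⟩ := hu
  simp only [fr_at, sg, if_true, add_sub_cancel_left, unit_sq]
  rcases hx with (hx | hx) | hx
  · have := abs_le.1 (hx 0); simpa using this.1
  · rw [hx.1]; omega
  · have := hx.1.1; omega

theorem lam_ne {i : Fin d} {τ : ℤˣ} {L b u : Vtx d} (hu : u ∈ LamA m r (b, i, sg i τ L b)) (hmr : m ≤ rho m r) {j} (hj : j ≠ i) :
    |u j - b j| ≤ rho m r := by
  obtain ⟨x, hx, rfl⟩ := hu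
  obtain ⟨j', h0, h⟩ := fr_ne b i (sg i τ L b) hj
  simp only [h, add_sub_cancel_left, unit_abs]
  rcases hx with (hx | hx) | hx
  · simpa using hx j'
  · have := hx.2 j' h0; rw [abs_le]; omega
  · have := hx.2 j' h0; rw [abs_le]; omega

theorem lam_or {i : Fin d} {τ : ℤˣ} {L b u c : Vtx d} (hu : u ∈ LamA m r (b, i, sg i τ L b)) (hc : c ∈ grid0 d m r) :
    τ * (u i - b i) ≤ rho m r ∨ ∀ j ≠ i, |u j - fr b i (sg i τ L b) c j| ≤ rho m r := by
  obtain ⟨x, hx, rfl⟩ := hu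
  rw [or_iff_not_imp_left]
  intro hn j hj
  obtain ⟨j', h0, h⟩ := fr_ne b i (sg i τ L b) hj
  have g := grid_rg hc h0
  simp only [h, add_sub_add_left_eq_sub, ← mul_sub, unit_abs]
  rcases hx with (hx | hx) | hx
  · exfalso; apply hn
    simp only [fr_at, sg, if_true, add_sub_cancel_left, unit_sq]
    have := abs_le.1 (hx 0); simpa using this.2
  · have := hx.2 j' h0; rw [abs_le]; omega
  · have := hx.2 j' h0; rw [abs_le]; omega

theorem far_cl {L : Set (Vtx d)} {z : Vtx d} (h : ∀ u ∈ L, ∃ j, 2 ≤ |z j - u j|) : z ∉ cl L := by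
  rintro (hz | ⟨_, u, hu, a⟩)
  · obtain ⟨j, hj⟩ := h z hz; simp at hj
  · obtain ⟨j, hj⟩ := h u hu
    have := adj_le a j
    rw [abs_sub_comm] at this; omega

end D2a
section D2b

structure Gm (d : ℕ) [NeZero d] where
  m : ℕ
  r : ℕ
  P : ℕ
  Tm : ℕ
  off : ℤ
  a1 : Fin d
  a2 : Fin d
  en : ℕ → ℤ × ℤ
  ix : ℤ × ℤ → ℕ
  Vr : Set (ℤ × ℤ)
  V0 : Set (ℤ × ℤ)
  h1 : a1 ≠ 0
  h2 : a2 ≠ 0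
  h12 : a1 ≠ a2
  hr : 1 ≤ r
  hP : 0 < P
  hen : ∀ i < P, en i ∈ Vr ∧ ix (en i) = i
  hix : ∀ v ∈ Vr, ix v < P ∧ en (ix v) = v

def mv (t : ℕ) (v : ℤ × ℤ) (σ : ℤˣ) : ℤ × ℤ := if t % 2 = 0 then (v.1 + σ, v.2) else (v.1, v.2 + σ)
def of (σ : ℤˣ) : ℕ := if σ = 1 then 0 else 22
def valid (t : ℕ) (v : ℤ × ℤ) : Prop := v.1 % 2 = (((t + 1) / 2 : ℕ) : ℤ) % 2 ∧ v.2 % 2 = ((t / 2 : ℕ) : ℤ) % 2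

namespace Gm
variable {d : ℕ} [NeZero d] (G : Gm d)
def h : ℤ := hh G.m G.r
def mk' (t : ℕ) : ℤ := 14 * G.h * t
def ax (t : ℕ) : Fin d := if t % 2 = 0 then G.a1 else G.a2
def lane (v : ℤ × ℤ) : Vtx d := fun j => if j = 0 then 0 else if j = G.a1 then 8 * G.h * v.1 else if j = G.a2 then 8 * G.h * v.2 + G.off else G.off
def kk (t : ℕ) (v : ℤ × ℤ) (s : ℕ) : ℕ := (t * G.P + G.ix v) * 44 + s
open Classical in
noncomputable def gt (ρ : ℕ → Option (Vtx d)) (t : ℕ) (v : ℤ × ℤ) (s : ℕ) : Option (Vtx d) := if v ∈ G.Vr then ρ (G.kk t v s) else none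
open Classical in
noncomputable def pos (ρ : ℕ → Option (Vtx d)) (t : ℕ) (v : ℤ × ℤ) : Option (Vtx d) :=
  if v ∈ G.Vr then
    match t with
    | 0 => if v.1 % 2 = 0 ∧ v.2 % 2 = 0 ∧ v ∈ G.V0 then some (G.lane v) else none
    | t + 1 => (G.gt ρ t (mv t v (-1)) 21).or (G.gt ρ t (mv t v 1) 43)
  else none
noncomputable def q (ρ : ℕ → Option (Vtx d)) (t : ℕ) (v : ℤ × ℤ) (σ : ℤˣ) : ℕ → Option (Vtx d)
  | 0 => G.pos ρ t v
  | p + 1 => G.gt ρ t v (of σ + p)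
def blk' (ρ : ℕ → Option (Vtx d)) (t : ℕ) (v : ℤ × ℤ) (σ : ℤˣ) : Prop :=
  G.Tm ≤ t ∨ (σ = -1 ∧ G.pos ρ t (mv t (mv t v (-1)) (-1)) ≠ none)
open Classical in
noncomputable def stepB (t : ℕ) (v : ℤ × ℤ) (σ : ℤˣ) (p : ℕ) (b : Vtx d) : Act d :=
  if p < 8 then .inr (b, G.ax t, sg (G.ax t) σ (G.lane (mv t v σ)) b)
  else if b 0 < G.mk' (t + 1) then .inr (b, 0, sg 0 1 (G.lane (mv t v σ)) b) else .inl (some b)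
open Classical in
noncomputable def stepA (ρ : ℕ → Option (Vtx d)) (t : ℕ) (v : ℤ × ℤ) (σ : ℤˣ) (p : ℕ) : Act d :=
  if G.blk' ρ t v σ then .inl none else
    match G.q ρ t v σ p with
    | none => .inl none
    | some b => G.stepB t v σ p b
noncomputable def pol : Pol d := fun k ρ =>
  G.stepA ρ (k / 44 / G.P) (G.en (k / 44 % G.P)) (if k % 44 < 22 then 1 else -1) (k % 44 % 22)

variable {G}

theorem of_lt (σ : ℤˣ) : of σ ≤ 22 := by unfold of; split_ifs <;> omega

theorem kk_dec (t : ℕ) {v : ℤ × ℤ} (hv : v ∈ G.Vr) {s : ℕ} (hs : s < 44) :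
    G.kk t v s / 44 / G.P = t ∧ G.en (G.kk t v s / 44 % G.P) = v ∧ G.kk t v s % 44 = s := by
  obtain ⟨h1, h2⟩ := G.hix v hv
  have e : G.kk t v s / 44 = t * G.P + G.ix v := by unfold kk; omega
  refine ⟨?_, ?_, by unfold kk; omega⟩
  · rw [e, Nat.div_eq_iff G.hP]; generalize t * G.P = z; constructor <;> omega
  · rw [e, Nat.mul_add_mod', Nat.mod_eq_of_lt h1, h2]

theorem pol_kk (ρ) (t : ℕ) {v : ℤ × ℤ} (hv : v ∈ G.Vr) (σ : ℤˣ) {p : ℕ} (hp : p < 22) :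
    G.pol (G.kk t v (of σ + p)) ρ = G.stepA ρ t v σ p := by
  have := of_lt σ
  obtain ⟨e1, e2, e3⟩ := kk_dec (G := G) t hv (show of σ + p < 44 by omega)
  unfold pol
  rw [e1, e2, e3]
  rcases Int.units_eq_one_or σ with rfl | rfl
  · simp [of, hp]; congr 1; omega
  · simp [of]; congr 1; omega

theorem kk_ex (k : ℕ) : ∃ t, ∃ v ∈ G.Vr, ∃ σ, ∃ p < 22, k = G.kk t v (of σ + p) ∧ t = k / 44 / G.P ∧ of σ + p = k % 44 := by
  have h := G.hen (k / 44 % G.P) (Nat.mod_lt _ G.hP)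
  refine ⟨k / 44 / G.P, _, h.1, if k % 44 < 22 then 1 else -1, k % 44 % 22, by omega, ?_, rfl, ?_⟩
  · unfold kk
    rw [h.2, Nat.div_add_mod']
    unfold of; split_ifs <;> simp_all <;> omega
  · unfold of; split_ifs <;> simp_all <;> omega

theorem pos_mem {ρ t v} (h : G.pos ρ t v ≠ none) : v ∈ G.Vr := by
  by_contra hn; simp [pos, hn] at h

theorem q_mem {ρ t v σ p} (h : G.q ρ t v σ p ≠ none) : v ∈ G.Vr := by
  rcases p with _ | p
  · exact pos_mem h
  · by_contra hn; simp [q, gt, hn] at h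

def Leg (G : Gm d) (ρ : ℕ → Option (Vtx d)) : Prop := Legal G.m G.r G.pol ρ

theorem act_q {ρ t v σ p a} (h : G.stepA ρ t v σ p = .inr a) :
    ¬ G.blk' ρ t v σ ∧ ∃ b, G.q ρ t v σ p = some b ∧ G.stepB t v σ p b = .inr a := by
  unfold stepA at h
  split_ifs at h with hb
  refine ⟨hb, ?_⟩
  split at h
  · simp at h
  · rename_i b hb; exact ⟨b, hb, h⟩

theorem chain {ρ} (hL : G.Leg ρ) {t v σ p x} (hp : p < 22) (hx : G.q ρ t v σ (p + 1) = some x) :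
    ¬ G.blk' ρ t v σ ∧ ∃ b, G.q ρ t v σ p = some b ∧ ((∃ a c, c ∈ grid0 d G.m G.r ∧ G.stepB t v σ p b = .inr a ∧
      x = fr a.1 a.2.1 a.2.2 c) ∨ (G.stepB t v σ p b = .inl (some b) ∧ x = b)) := by
  have hv : v ∈ G.Vr := q_mem (by rw [hx]; simp)
  have hl := hL (G.kk t v (of σ + p))
  rw [pol_kk ρ t hv σ hp] at hl
  have hx' : ρ (G.kk t v (of σ + p)) = some x := by simpa [q, gt, hv] using hx
  unfold stepA at hl
  split_ifs at hl with hb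
  · have := hl.1 none rfl; rw [hx'] at this; simp at this
  refine ⟨hb, ?_⟩
  split at hl
  · have := hl.1 none rfl; rw [hx'] at this; simp at this
  · rename_i b hq
    refine ⟨b, hq, ?_⟩
    rcases hs : G.stepB t v σ p b with o | a
    · right
      rw [hs] at hl
      have := hl.1 o rfl
      unfold stepB at hs
      split_ifs at hs
      simp only [Sum.inl.injEq] at hs
      subst hs
      rw [hx'] at this
      exact ⟨rfl, by simpa using this⟩
    · left
      obtain ⟨c, h1, h2⟩ := hl.2 a hs x (by rw [hx']; simp)
      exact ⟨a, c, h1, rfl, h2⟩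

theorem stepB_cases {t v σ p b a} (h : G.stepB t v σ p b = .inr a) :
    (p < 8 ∧ a = (b, G.ax t, sg (G.ax t) σ (G.lane (mv t v σ)) b)) ∨
    (8 ≤ p ∧ b 0 < G.mk' (t + 1) ∧ a = (b, 0, sg 0 1 (G.lane (mv t v σ)) b)) := by
  unfold stepB at h
  split_ifs at h with h1 h2
  · left; exact ⟨h1, by simpa using h.symm⟩
  · right; exact ⟨by omega, h2, by simpa using h.symm⟩

theorem chain' {ρ} (hL : G.Leg ρ) {t v σ p x} (hp : p < 22) (hx : G.q ρ t v σ (p + 1) = some x) :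
    ¬ G.blk' ρ t v σ ∧ ∃ b, G.q ρ t v σ p = some b ∧ ((p < 8 ∧ ∃ c ∈ grid0 d G.m G.r,
      x = fr b (G.ax t) (sg (G.ax t) σ (G.lane (mv t v σ)) b) c) ∨
     (8 ≤ p ∧ b 0 < G.mk' (t + 1) ∧ ∃ c ∈ grid0 d G.m G.r, x = fr b 0 (sg 0 1 (G.lane (mv t v σ)) b) c) ∨
     (8 ≤ p ∧ G.mk' (t + 1) ≤ b 0 ∧ x = b)) := by
  obtain ⟨h1, b, h2, h3⟩ := chain hL hp hx
  refine ⟨h1, b, h2, ?_⟩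
  rcases h3 with ⟨a, c, hc, ha, e⟩ | ⟨h3, rfl⟩
  · rcases stepB_cases ha with ⟨k1, rfl⟩ | ⟨k1, k2, rfl⟩
    · exact .inl ⟨k1, c, hc, e⟩
    · exact .inr (.inl ⟨k1, k2, c, hc, e⟩)
  · unfold stepB at h3
    split_ifs at h3 with h4 h5
    exact .inr (.inr ⟨by omega, by omega, rfl⟩)

theorem pos_succ {ρ t w x} (h : G.pos ρ (t + 1) w = some x) :
    w ∈ G.Vr ∧ (G.q ρ t (mv t w (-1)) 1 22 = some x ∨
      (G.q ρ t (mv t w (-1)) 1 22 = none ∧ G.q ρ t (mv t w 1) (-1) 22 = some x)) := by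
  have hw := pos_mem (by rw [h]; simp)
  refine ⟨hw, ?_⟩
  simp only [pos, hw, if_true, Option.or_eq_some_iff] at h
  exact h

theorem mv_mv (t v) (σ : ℤˣ) : mv t (mv t v (-σ)) σ = v := by
  unfold mv; split_ifs <;> simp

theorem mv_mv' (t v) (σ : ℤˣ) : mv t (mv t v σ) (-σ) = v := by
  unfold mv; split_ifs <;> simp

theorem ax_ne (t : ℕ) : G.ax t ≠ 0 := by unfold ax; split_ifs; exacts [G.h1, G.h2]

theorem h_pos : 2 ≤ G.h := by unfold h hh; push_cast; omega
theorem h_eq : G.h = rho G.m G.r + 2 + G.m := by unfold h hh; push_cast; rfl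
theorem rho_m : 3 * (G.m : ℤ) + 1 ≤ rho G.m G.r := by
  have := G.hr
  unfold rho
  push_cast
  have : (1 : ℤ) ≤ G.r := by exact_mod_cast this
  nlinarith
theorem mk_succ (t : ℕ) : G.mk' (t + 1) = G.mk' t + 14 * G.h := by unfold mk'; push_cast; ring
theorem lane_ax (t v) (σ : ℤˣ) : G.lane (mv t v σ) (G.ax t) = G.lane v (G.ax t) + σ * (8 * G.h) := by
  have := G.h1; have := G.h2; have := G.h12.symm
  unfold lane mv ax
  split_ifs <;> simp_all <;> ring
theorem lane_ne (t v) (σ : ℤˣ) {j} (hj : j ≠ G.ax t) : G.lane (mv t v σ) j = G.lane v j := by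
  unfold lane mv ax at *
  split_ifs at * <;> simp_all

theorem valid_mv {t v} (σ : ℤˣ) (h : valid t v) : valid (t + 1) (mv t v σ) := by
  unfold valid mv at *
  rcases Int.units_eq_one_or σ with rfl | rfl <;> split_ifs <;> simp <;> omega

/-- invariant at layer `t` -/
def Inv (G : Gm d) (ρ : ℕ → Option (Vtx d)) (t : ℕ) : Prop := ∀ v b, G.pos ρ t v = some b →
  valid t v ∧ G.mk' t ≤ b 0 ∧ b 0 < G.mk' t + G.h ∧ ∀ j ≠ 0, |b j - G.lane v j| ≤ G.h

theorem att {ρ} (hL : G.Leg ρ) {t} (hI : G.Inv ρ t) {v σ} : ∀ {p x}, p ≤ 22 → G.q ρ t v σ p = some x →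
    ∃ b, G.pos ρ t v = some b ∧ b 0 ≤ x 0 ∧ (0 < p → ¬ G.blk' ρ t v σ) ∧
    (p ≤ 8 → σ * (x (G.ax t) - b (G.ax t)) = G.h * p ∧ x 0 ≤ b 0 + G.h * p ∧ ∀ j ≠ 0, j ≠ G.ax t → |x j - G.lane v j| ≤ G.h) ∧
    (8 ≤ p → (∀ j ≠ 0, |x j - G.lane (mv t v σ) j| ≤ G.h) ∧ x 0 < G.mk' (t + 1) + G.h ∧
      (G.mk' (t + 1) ≤ x 0 ∨ G.mk' t + G.h * (p - 8) ≤ x 0)) := by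
  have hp := h_pos (G := G)
  have he := h_eq (G := G)
  have hr := rho_m (G := G)
  have h1 := mk_succ (G := G) t
  intro p
  induction p with
  | zero =>
    intro x _ hx
    refine ⟨x, hx, le_rfl, by simp, fun _ => ⟨by simp, by simp, fun j hj _ => (hI v x hx).2.2.2 j hj⟩, by omega⟩
  | succ p ih =>
    intro x h22 hx
    obtain ⟨hb, y, hy, hc⟩ := chain' hL (by omega) hx
    obtain ⟨b, b1, b2, -, b4, b5⟩ := ih (by omega) hy
    obtain ⟨i1, i2, i3, i4⟩ := hI v b b1
    refine ⟨b, b1, ?_⟩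
    rcases hc with ⟨k1, c, hc, rfl⟩ | ⟨k1, k2, c, hc, rfl⟩ | ⟨k1, k2, rfl⟩
    · have g0 := grid_zero (ax_ne (G := G) t) (τ := σ) (L := G.lane (mv t v σ)) (b := y) hc
      have g1 := grid_at (i := G.ax t) (τ := σ) (L := G.lane (mv t v σ)) (b := y) hc
      obtain ⟨c1, c2, c3⟩ := b4 (by omega)
      have g2 : ∀ j ≠ 0, j ≠ G.ax t → |fr y (G.ax t) (sg (G.ax t) σ (G.lane (mv t v σ)) y) c j - G.lane v j| ≤ G.h := by
        intro j j0 j1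
        rw [← lane_ne t v σ j1]
        exact grid_ne hc j1 j0 (by rw [lane_ne t v σ j1]; exact c3 j j0 j1)
      set x := fr y (G.ax t) (sg (G.ax t) σ (G.lane (mv t v σ)) y) c
      have e1 : (σ : ℤ) * (x (G.ax t) - b (G.ax t)) = G.h * (p + 1 : ℕ) := by
        push_cast
        have : (σ : ℤ) * (x (G.ax t) - b (G.ax t)) = σ * (x (G.ax t) - y (G.ax t)) + σ * (y (G.ax t) - b (G.ax t)) := by ring
        rw [this, c1, g1]; unfold h; ring
      have e2 : x 0 ≤ b 0 + G.h * (p + 1 : ℕ) := by push_cast; linarith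
      refine ⟨by omega, fun _ => hb, fun _ => ⟨e1, e2, g2⟩, fun h8 => ?_⟩
      have p8 : p = 7 := by omega
      subst p8
      refine ⟨fun j j0 => ?_, ?_, .inr ?_⟩
      · by_cases j1 : j = G.ax t
        · subst j1
          rw [lane_ax]
          have := i4 _ j0
          rw [abs_le] at *
          rcases Int.units_eq_one_or σ with rfl | rfl <;> simp at e1 ⊢ <;> omega
        · rw [lane_ne _ _ _ j1]; exact g2 j j0 j1
      · simp at e2; omega
      · simp; omega
    · have g1 := grid_at (i := 0) (τ := 1) (L := G.lane (mv t v σ)) (b := y) hc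
      obtain ⟨c1, c2, c3⟩ := b5 k1
      simp only [Units.val_one, one_mul] at g1
      have e1 : fr y 0 (sg 0 1 (G.lane (mv t v σ)) y) c 0 = y 0 + G.h := by unfold h; omega
      refine ⟨by omega, fun _ => hb, fun h => by omega, fun _ => ⟨fun j j0 => grid_ne hc j0 j0 (c1 j j0), by omega, ?_⟩⟩
      right
      rw [e1]; push_cast
      rcases c3 with c3 | c3
      · omega
      · linarith
    · obtain ⟨c1, c2, c3⟩ := b5 k1
      exact ⟨b2, fun _ => hb, fun h => by omega, fun _ => ⟨c1, c2, .inl k2⟩⟩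

theorem inv {ρ} (hL : G.Leg ρ) (t : ℕ) : G.Inv ρ t := by
  have hp := h_pos (G := G)
  induction t with
  | zero =>
    intro v b hb
    have hv := pos_mem (by rw [hb]; simp)
    simp only [pos, hv, if_true] at hb
    split_ifs at hb with he
    simp only [Option.some.injEq] at hb
    subst hb
    refine ⟨⟨by simpa using he.1, by simpa using he.2.1⟩, by simp [mk', lane], by simp [mk', lane]; omega, fun j _ => by simp; omega⟩
  | succ t ih =>
    have key : ∀ w v σ b, mv t v σ = w → G.q ρ t v σ 22 = some b → valid (t + 1) w ∧ G.mk' (t + 1) ≤ b 0 ∧ b 0 < G.mk' (t + 1) + G.h ∧ ∀ j ≠ 0, |b j - G.lane w j| ≤ G.h := by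
      rintro w v σ b rfl hb
      obtain ⟨c, c1, -, -, -, c5⟩ := att hL ih le_rfl hb
      obtain ⟨d1, d2, d3⟩ := c5 (by omega)
      refine ⟨valid_mv σ (ih _ _ c1).1, ?_, d2, d1⟩
      rw [mk_succ] at *
      push_cast at d3
      rcases d3 with h | h <;> linarith
    intro w b hb
    rcases (pos_succ hb).2 with h | ⟨_, h⟩
    · exact key _ _ _ _ (mv_mv t w 1) h
    · exact key _ _ _ _ (by simpa using mv_mv t w (-1)) h

theorem mono {ρ} (hL : G.Leg ρ) {t v σ p p' x y} (hpp : p ≤ p') (hp : p' ≤ 22) (hx : G.q ρ t v σ p = some x)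
    (hy : G.q ρ t v σ p' = some y) : x 0 ≤ y 0 ∧ (8 ≤ p → y = x ∨ x 0 + G.h ≤ y 0) := by
  have h2 := h_pos (G := G)
  induction p', hpp using Nat.le_induction generalizing y with
  | base => rw [hx] at hy; simp at hy; subst hy; simp
  | succ p' hle ih =>
    obtain ⟨hb, z, hz, hc⟩ := chain' hL (by omega) hy
    have := ih (by omega) hz
    rcases hc with ⟨k1, c, hc, rfl⟩ | ⟨k1, k2, c, hc, rfl⟩ | ⟨k1, k2, rfl⟩
    · have g0 := grid_zero (ax_ne (G := G) t) (τ := σ) (L := G.lane (mv t v σ)) (b := z) hc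
      have hr := rho_m (G := G)
      exact ⟨by omega, by omega⟩
    · have g1 := grid_at (i := 0) (τ := 1) (L := G.lane (mv t v σ)) (b := z) hc
      simp only [Units.val_one, one_mul] at g1
      have e1 : fr z 0 (sg 0 1 (G.lane (mv t v σ)) z) c 0 = z 0 + G.h := by unfold h; omega
      exact ⟨by omega, by omega⟩
    · exact this

end Gm
end D2b
section D2c
namespace Gm
variable {d : ℕ} [NeZero d] {G : Gm d}

theorem q_down {ρ} (hL : G.Leg ρ) {t v σ p p' x} (hpp : p ≤ p') (hp : p' ≤ 22) (hx : G.q ρ t v σ p' = some x) :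
    ∃ y, G.q ρ t v σ p = some y := by
  induction p', hpp using Nat.le_induction generalizing x with
  | base => exact ⟨x, hx⟩
  | succ p' hle ih =>
    obtain ⟨-, z, hz, -⟩ := chain' hL (by omega) hx
    exact ih (by omega) hz

theorem fwd {ρ} (hL : G.Leg ρ) {t v σ p p' x y} (h8 : 8 ≤ p) (hpp : p < p') (hp : p' ≤ 22) (hx : G.q ρ t v σ p = some x)
    (hy : G.q ρ t v σ p' = some y) (hm : x 0 < G.mk' (t + 1)) :
    ∃ c ∈ grid0 d G.m G.r, G.q ρ t v σ (p + 1) = some (fr x 0 (sg 0 1 (G.lane (mv t v σ)) x) c) ∧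
      fr x 0 (sg 0 1 (G.lane (mv t v σ)) x) c 0 = x 0 + G.h := by
  obtain ⟨z, hz⟩ := q_down hL (show p + 1 ≤ p' by omega) hp hy
  obtain ⟨hb, x', hx', hc⟩ := chain' hL (by omega) hz
  rw [hx] at hx'
  obtain rfl := Option.some.inj hx'
  rcases hc with ⟨k1, -⟩ | ⟨k1, k2, c, hc, rfl⟩ | ⟨k1, k2, rfl⟩
  · omega
  · have g1 := grid_at (i := 0) (τ := 1) (L := G.lane (mv t v σ)) (b := x) hc
    simp only [Units.val_one, one_mul] at g1
    exact ⟨c, hc, hz, by unfold h; omega⟩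
  · omega

theorem idle {ρ} (hL : G.Leg ρ) {t v σ p p' x y} (h8 : 8 ≤ p) (hpp : p ≤ p') (hp : p' ≤ 22) (hx : G.q ρ t v σ p = some x)
    (hy : G.q ρ t v σ p' = some y) (hm : G.mk' (t + 1) ≤ x 0) : y = x := by
  induction p', hpp using Nat.le_induction generalizing y with
  | base => rw [hx] at hy; exact (Option.some.inj hy).symm
  | succ p' hle ih =>
    obtain ⟨-, z, hz, hc⟩ := chain' hL (by omega) hy
    obtain rfl := ih (by omega) hz
    rcases hc with ⟨k1, -⟩ | ⟨k1, k2, -⟩ | ⟨k1, k2, rfl⟩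
    · omega
    · omega
    · rfl

theorem inf {ρ} (hL : G.Leg ρ) {t v σ p a} (hp : p < 22) (ha : G.stepA ρ t v σ p = .inr a) :
    ∃ x b, G.pos ρ t v = some x ∧ G.q ρ t v σ p = some b ∧ ¬ G.blk' ρ t v σ ∧ valid t v ∧ G.mk' t ≤ x 0 ∧ x 0 < G.mk' t + G.h ∧
    (∀ j ≠ 0, |x j - G.lane v j| ≤ G.h) ∧ x 0 ≤ b 0 ∧
    ((p < 8 ∧ a = (b, G.ax t, sg (G.ax t) σ (G.lane (mv t v σ)) b) ∧ σ * (b (G.ax t) - x (G.ax t)) = G.h * p ∧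
      b 0 ≤ x 0 + 7 * G.h ∧ ∀ j ≠ 0, j ≠ G.ax t → |b j - G.lane v j| ≤ G.h) ∨
     (8 ≤ p ∧ a = (b, 0, sg 0 1 (G.lane (mv t v σ)) b) ∧ b 0 < G.mk' (t + 1) ∧ ∀ j ≠ 0, |b j - G.lane (mv t v σ) j| ≤ G.h)) := by
  have h2 := h_pos (G := G)
  obtain ⟨h1, b, hb, hs⟩ := act_q ha
  obtain ⟨x, a1, a2, -, a4, a5⟩ := att hL (inv hL t) (by omega) hb
  obtain ⟨i1, i2, i3, i4⟩ := inv hL t v x a1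
  refine ⟨x, b, a1, hb, h1, i1, i2, i3, i4, a2, ?_⟩
  rcases stepB_cases hs with ⟨k1, rfl⟩ | ⟨k1, k2, rfl⟩
  · obtain ⟨c1, c2, c3⟩ := a4 k1.le
    refine .inl ⟨k1, rfl, c1, ?_, c3⟩
    have : (p : ℤ) ≤ 7 := by omega
    nlinarith
  · exact .inr ⟨k1, rfl, k2, (a5 k1).1⟩

theorem ext {ρ} (hL : G.Leg ρ) {t v σ p a} (hp : p < 22) (ha : G.stepA ρ t v σ p = .inr a) {u} (hu : u ∈ LamA G.m G.r a) :
    G.mk' t - G.h ≤ u 0 ∧ u 0 ≤ G.mk' (t + 1) + 2 * G.h ∧ -(2 * G.h) ≤ σ * (u (G.ax t) - G.lane v (G.ax t)) ∧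
      σ * (u (G.ax t) - G.lane v (G.ax t)) ≤ 10 * G.h ∧ (∀ j ≠ 0, j ≠ G.ax t → |u j - G.lane v j| ≤ 2 * G.h) ∧
    (8 ≤ p → ∀ j ≠ 0, |u j - G.lane (mv t v σ) j| ≤ 2 * G.h) ∧ (p < 8 → u 0 ≤ G.mk' (t + 1) - 5 * G.h) := by
  have h2 := h_pos (G := G)
  have he := h_eq (G := G)
  have hr := rho_m (G := G)
  have hmr : G.m ≤ rho G.m G.r := by omega
  have hh' : (hh G.m G.r : ℤ) = G.h := rfl
  have hm := mk_succ (G := G) t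
  obtain ⟨x, b, i1, i2, i3, i4, i5, i6, i7, i8, ⟨k1, rfl, k2, k3, k4⟩ | ⟨k1, rfl, k3, k4⟩⟩ := inf hL hp ha
  · have l0 := abs_le.1 (lam_ne hu hmr (ax_ne t).symm)
    have l1 := lam_at hu
    have l2 := abs_le.1 (lam_all hu (G.ax t))
    have l3 := abs_le.1 (i7 (G.ax t) (ax_ne t))
    have k5 : G.h * p ≤ 7 * G.h := by have : (p : ℤ) ≤ 7 := by omega
                                      nlinarith
    have k6 : 0 ≤ G.h * p := by positivity
    refine ⟨by omega, by omega, ?_, ?_, fun j j0 j1 => ?_, fun h => by omega, fun _ => by omega⟩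
    · rcases Int.units_eq_one_or σ with rfl | rfl <;> simp at k2 l1 ⊢ <;> omega
    · rcases Int.units_eq_one_or σ with rfl | rfl <;> simp at k2 l1 ⊢ <;> omega
    · have := abs_le.1 (k4 j j0 j1)
      have := abs_le.1 (lam_ne hu hmr j1)
      rw [abs_le]; omega
  · have l0 := abs_le.1 (lam_all hu 0)
    have l1 := lam_at hu
    simp only [Units.val_one, one_mul] at l1
    have l2 : ∀ j ≠ 0, |u j - G.lane (mv t v σ) j| ≤ 2 * G.h := fun j j0 => by
      have := abs_le.1 (k4 j j0)
      have := abs_le.1 (lam_ne hu hmr j0)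
      rw [abs_le]; omega
    have l3 := abs_le.1 (l2 (G.ax t) (ax_ne t))
    rw [lane_ax] at l3
    refine ⟨by omega, by omega, ?_, ?_, fun j j0 j1 => ?_, fun _ => l2, fun h => by omega⟩
    · rcases Int.units_eq_one_or σ with rfl | rfl <;> simp at l3 ⊢ <;> omega
    · rcases Int.units_eq_one_or σ with rfl | rfl <;> simp at l3 ⊢ <;> omega
    · rw [← lane_ne t v σ j1]; exact l2 j j0

theorem lane_sep {t v w} (hv : valid t v) (hw : valid t w) (hn : v ≠ w) :
    (∃ j ≠ 0, j ≠ G.ax t ∧ 16 * G.h ≤ |G.lane v j - G.lane w j|) ∨ w = mv t (mv t v 1) 1 ∨ v = mv t (mv t w 1) 1 ∨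
    32 * G.h ≤ |G.lane v (G.ax t) - G.lane w (G.ax t)| := by
  have h2 := h_pos (G := G)
  have h1 := G.h1; have h2' := G.h2; have h3 := G.h12; have h4 := G.h12.symm
  obtain ⟨v1, v2⟩ := v
  obtain ⟨w1, w2⟩ := w
  unfold valid at hv hw
  simp only at hv hw
  have key : ∀ k : ℤ, ∀ a b c : ℤ, k ≤ |a - b| → 8 * k * G.h ≤ |8 * G.h * a + c - (8 * G.h * b + c)| := by
    intro k a b c h
    have : 8 * G.h * a + c - (8 * G.h * b + c) = 8 * G.h * (a - b) := by ring
    rw [this, abs_mul, abs_of_pos (by linarith : 0 < 8 * G.h)]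
    nlinarith
  have par : ∀ a b : ℤ, a % 2 = b % 2 → a ≠ b → 2 ≤ |a - b| := by intro a b h1 h2; rw [le_abs]; omega
  have par4 : ∀ a b : ℤ, a % 2 = b % 2 → a ≠ b → b ≠ a + 1 + 1 → a ≠ b + 1 + 1 → 4 ≤ |a - b| := by
    intro a b h1 h2 h3 h4; rw [le_abs]; omega
  rcases Nat.mod_two_eq_zero_or_one t with ht | ht
  · have ea : G.ax t = G.a1 := by simp [ax, ht]
    by_cases c2 : v2 = w2
    · subst c2
      have c1 : v1 ≠ w1 := by rintro rfl; exact hn rfl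
      right
      simp only [mv, ht, if_true, Units.val_one, Prod.mk.injEq, and_true, ea]
      by_contra hc
      push Not at hc
      have := key 4 v1 w1 0 (par4 v1 w1 (by omega) c1 hc.1 hc.2.1)
      have h9 := hc.2.2
      simp only [lane, h1, if_false, if_true] at h9
      simp only [add_zero] at this
      linarith
    · left
      refine ⟨G.a2, h2', by rw [ea]; exact h4, ?_⟩
      have := key 2 v2 w2 G.off (par _ _ (by omega) c2)
      simp only [lane, h2', h4, if_false, if_true]
      linarith
  · have ea : G.ax t = G.a2 := by simp [ax, ht]
    by_cases c2 : v1 = w1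
    · subst c2
      have c1 : v2 ≠ w2 := by rintro rfl; exact hn rfl
      right
      simp only [mv, ht, one_ne_zero, if_false, Units.val_one, Prod.mk.injEq, true_and, ea]
      by_contra hc
      push Not at hc
      have := key 4 _ _ G.off (par4 v2 w2 (by omega) c1 hc.1 hc.2.1)
      have h9 := hc.2.2
      simp only [lane, h2', h4, if_false, if_true] at h9
      linarith
    · left
      refine ⟨G.a1, h1, by rw [ea]; exact h3, ?_⟩
      have := key 2 v1 w1 0 (par _ _ (by omega) c2)
      simp only [lane, h1, h3, if_false, if_true]
      simp only [add_zero] at this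
      linarith

/-- lane separation from a target column -/
theorem lane_far {t v w} (hv : valid t v) (hw : valid t w) (hn : v ≠ w) (σ : ℤˣ) {u u' : Vtx d}
    (h1 : -(2 * G.h) ≤ σ * (u (G.ax t) - G.lane v (G.ax t))) (h2 : σ * (u (G.ax t) - G.lane v (G.ax t)) ≤ 10 * G.h)
    (h3 : ∀ j ≠ 0, j ≠ G.ax t → |u j - G.lane v j| ≤ 2 * G.h) (h4 : ∀ j ≠ 0, |u' j - G.lane w j| ≤ 2 * G.h) :
    ∃ j, 2 ≤ |u j - u' j| := by
  have hp := h_pos (G := G)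
  have h5 := abs_le.1 (h4 (G.ax t) (ax_ne t))
  rcases lane_sep (G := G) hv hw hn with ⟨j, j0, j1, hj⟩ | rfl | rfl | hj
  · refine ⟨j, ?_⟩
    have := abs_le.1 (h3 j j0 j1)
    have := abs_le.1 (h4 j j0)
    rw [le_abs] at hj ⊢; omega
  · refine ⟨G.ax t, ?_⟩
    rw [lane_ax, lane_ax] at h5
    rw [le_abs]
    rcases Int.units_eq_one_or σ with rfl | rfl <;> simp at h1 h2 h5 <;> omega
  · refine ⟨G.ax t, ?_⟩
    rw [lane_ax, lane_ax] at h1 h2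
    rw [le_abs]
    rcases Int.units_eq_one_or σ with rfl | rfl <;> simp at h1 h2 h5 <;> omega
  · refine ⟨G.ax t, ?_⟩
    rw [le_abs] at *
    rcases Int.units_eq_one_or σ with rfl | rfl <;> simp at h1 h2 h5 <;> omega

theorem far2 {ρ} (hL : G.Leg ρ) {t v σ p a v' σ' p' a'} (hp : p < 22) (ha : G.stepA ρ t v σ p = .inr a) (hp' : p' < 22)
    (ha' : G.stepA ρ t v' σ' p' = .inr a') (hn : v ≠ v') {u u'} (hu : u ∈ LamA G.m G.r a) (hu' : u' ∈ LamA G.m G.r a') :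
    ∃ j, 2 ≤ |u j - u' j| := by
  have h2 := h_pos (G := G)
  obtain ⟨x, b, i1, i2, i3, i4, -⟩ := inf hL hp ha
  obtain ⟨x', b', i1', i2', i3', i4', -⟩ := inf hL hp' ha'
  obtain ⟨-, -, e1, e2, e3, -⟩ := ext hL hp ha hu
  obtain ⟨-, -, e1', e2', e3', -⟩ := ext hL hp' ha' hu'
  have m1 : ∀ w, mv t (mv t (mv t (mv t w 1) 1) (-1)) (-1) = w := fun w => by rw [mv_mv', mv_mv']
  rcases lane_sep (G := G) i4 i4' hn with ⟨j, j0, j1, hj⟩ | rfl | rfl | hj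
  · refine ⟨j, ?_⟩
    have := abs_le.1 (e3 j j0 j1)
    have := abs_le.1 (e3' j j0 j1)
    rw [le_abs] at hj ⊢; omega
  · refine ⟨G.ax t, ?_⟩
    rw [lane_ax, lane_ax] at e1' e2'
    rw [le_abs]
    rcases Int.units_eq_one_or σ with rfl | rfl <;> rcases Int.units_eq_one_or σ' with rfl | rfl <;> simp at e1 e2 e1' e2' <;> try omega
    exact (i3' (.inr ⟨rfl, by rw [m1, i1]; simp⟩)).elim
  · refine ⟨G.ax t, ?_⟩
    rw [lane_ax, lane_ax] at e1 e2
    rw [le_abs]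
    rcases Int.units_eq_one_or σ with rfl | rfl <;> rcases Int.units_eq_one_or σ' with rfl | rfl <;> simp at e1 e2 e1' e2' <;> try omega
    exact (i3 (.inr ⟨rfl, by rw [m1, i1']; simp⟩)).elim
  · refine ⟨G.ax t, ?_⟩
    rw [le_abs] at *
    rcases Int.units_eq_one_or σ with rfl | rfl <;> rcases Int.units_eq_one_or σ' with rfl | rfl <;> simp at e1 e2 e1' e2' <;> omega

theorem far1 {ρ} (hL : G.Leg ρ) {t v σ p a t' v' σ' p' a'} (hp : p < 22) (ha : G.stepA ρ t v σ p = .inr a) (hp' : p' < 22)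
    (ha' : G.stepA ρ t' v' σ' p' = .inr a') (hn : t' + 2 ≤ t) {u u'} (hu : u ∈ LamA G.m G.r a) (hu' : u' ∈ LamA G.m G.r a') :
    ∃ j, 2 ≤ |u j - u' j| := by
  have h2 := h_pos (G := G)
  obtain ⟨e1, -⟩ := ext hL hp ha hu
  obtain ⟨-, e2, -⟩ := ext hL hp' ha' hu'
  refine ⟨0, ?_⟩
  unfold mk' at *
  have : (t' : ℤ) + 2 ≤ t := by exact_mod_cast hn
  push_cast at *
  rw [le_abs]; left; nlinarith

theorem zone2 {ρ} (hL : G.Leg ρ) {t v σ p a σ' p' a'} (hp : p < 22) (ha : G.stepA ρ t v σ p = .inr a) (hp' : p' < 22)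
    (ha' : G.stepA ρ t v σ' p' = .inr a') (hs : of σ' + p' < of σ + p) {z u'} (hz : z ∈ zone0 d G.m G.r) (hu' : u' ∈ LamA G.m G.r a') :
    ∃ j, 2 ≤ |fr a.1 a.2.1 a.2.2 z j - u' j| := by
  have h2 := h_pos (G := G)
  have he := h_eq (G := G)
  have hr := rho_m (G := G)
  have hmr : G.m ≤ rho G.m G.r := by omega
  have hh' : (hh G.m G.r : ℤ) = G.h := rfl
  obtain ⟨x, b, i1, i2, i3, i4, i5, i6, i7, i8, k⟩ := inf hL hp ha
  obtain ⟨x', b', i1', i2', i3', i4', i5', i6', i7', i8', k'⟩ := inf hL hp' ha'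
  rw [i1] at i1'
  obtain rfl := Option.some.inj i1'
  have l3 := abs_le.1 (i7 (G.ax t) (ax_ne t))
  have ez := ext hL hp ha (zone_lam hz a)
  have eu := ext hL hp' ha' hu'
  have pp : ∀ p : ℕ, 0 ≤ G.h * p := fun p => by positivity
  by_cases hσ : σ = σ'
  · subst hσ
    have hlt : p' < p := by omega
    have hm := (mono hL hlt.le (by omega) i2' i2).1
    rcases k with ⟨k1, rfl, k2, k3, k4⟩ | ⟨k1, rfl, k3, k4⟩ <;> rcases k' with ⟨k1', rfl, k2', k3', k4'⟩ | ⟨k1', rfl, k3', k4'⟩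
    · refine ⟨G.ax t, ?_⟩
      have z1 := (zone_at (i := G.ax t) (τ := σ) (L := G.lane (mv t v σ)) (b := b) hz).1
      have l2 := abs_le.1 (lam_all hu' (G.ax t))
      have q1 : G.h * p' + G.h ≤ G.h * p := by
        have : (p' : ℤ) + 1 ≤ p := by exact_mod_cast hlt
        nlinarith
      generalize fr _ _ _ z (G.ax t) = Z at *
      rw [le_abs]
      rcases Int.units_eq_one_or σ with rfl | rfl <;> simp at z1 k2 k2' <;> omega
    · omega
    · refine ⟨0, ?_⟩
      have z1 := (zone_at (i := 0) (τ := 1) (L := G.lane (mv t v σ)) (b := b) hz).1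
      have l0 := abs_le.1 (lam_ne hu' hmr (ax_ne t).symm)
      simp at z1 ⊢
      rw [le_abs]; left; omega
    · refine ⟨0, ?_⟩
      have z1 := (zone_at (i := 0) (τ := 1) (L := G.lane (mv t v σ)) (b := b) hz).1
      have l0 := abs_le.1 (lam_all hu' 0)
      obtain ⟨c, -, c1, c2⟩ := fwd hL k1' hlt hp.le i2' i2 k3'
      have := (mono hL (show p' + 1 ≤ p by omega) (by omega) c1 i2).1
      simp at z1 ⊢
      rw [le_abs]; left; omega
  · have h1 : σ = -1 ∧ σ' = 1 := by
      rcases Int.units_eq_one_or σ with rfl | rfl <;> rcases Int.units_eq_one_or σ' with rfl | rfl <;> simp [of] at * ; omega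
    obtain ⟨rfl, rfl⟩ := h1
    refine ⟨G.ax t, ?_⟩
    rw [le_abs]; right
    rcases k with ⟨k1, rfl, k2, k3, k4⟩ | ⟨k1, rfl, k3, k4⟩
    · have z1 := (zone_at (i := G.ax t) (τ := -1) (L := G.lane (mv t v (-1))) (b := b) hz).1
      have := pp p
      have := pp p'
      rcases k' with ⟨k1', rfl, k2', k3', k4'⟩ | ⟨k1', rfl, k3', k4'⟩
      · have l1 := lam_at hu'
        simp at z1 k2 k2' l1 ⊢
        omega
      · have l1 := abs_le.1 (eu.2.2.2.2.2.1 k1' (G.ax t) (ax_ne t))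
        rw [lane_ax] at l1
        simp at z1 k2 l1 ⊢
        omega
    · have l1 := abs_le.1 (ez.2.2.2.2.2.1 k1 (G.ax t) (ax_ne t))
      rw [lane_ax] at l1
      have l2 := eu.2.2.1
      simp at l1 l2 ⊢
      omega

theorem zone1 {ρ} (hL : G.Leg ρ) {t v σ p a v' σ' p' a'} (hp : p < 22) (ha : G.stepA ρ (t + 1) v σ p = .inr a) (hp' : p' < 22)
    (ha' : G.stepA ρ t v' σ' p' = .inr a') {z u'} (hz : z ∈ zone0 d G.m G.r) (hu' : u' ∈ LamA G.m G.r a') :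
    ∃ j, 2 ≤ |fr a.1 a.2.1 a.2.2 z j - u' j| := by
  have h2 := h_pos (G := G)
  have he := h_eq (G := G)
  have hr := rho_m (G := G)
  have hmr : G.m ≤ rho G.m G.r := by omega
  have hh' : (hh G.m G.r : ℤ) = G.h := rfl
  have ez := ext hL hp ha (zone_lam hz a)
  have eu := ext hL hp' ha' hu'
  obtain ⟨x, b, i1, i2, i3, i4, i5, i6, i7, i8, k⟩ := inf hL hp ha
  obtain ⟨x', b', i1', i2', i3', i4', i5', i6', i7', i8', k'⟩ := inf hL hp' ha'
  by_cases hl : p' < 8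
  · refine ⟨0, ?_⟩
    have := eu.2.2.2.2.2.2 hl
    rw [le_abs]; left; omega
  by_cases hw : v = mv t v' σ'
  swap
  · exact lane_far i4 (valid_mv σ' i4') hw σ ez.2.2.1 ez.2.2.2.1 ez.2.2.2.2.1 (eu.2.2.2.2.2.1 (by omega))
  -- the same attempt
  have hq : G.q ρ t v' σ' 22 = some x := by
    have m1 : ∀ w, mv t (mv t (mv t (mv t w 1) 1) (-1)) (-1) = w := fun w => by rw [mv_mv', mv_mv']
    have m2 : ∀ w, mv t (mv t (mv t (mv t w (-1)) (-1)) 1) 1 = w := fun w => by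
      have := mv_mv' t (mv t w (-1)) (-1)
      have := mv_mv' t w (-1)
      simp_all
    rcases Int.units_eq_one_or σ' with rfl | rfl
    · have e1 : mv t v (-1) = v' := by rw [hw, mv_mv']
      rcases (pos_succ i1).2 with h | ⟨_, h⟩
      · rwa [e1] at h
      · obtain ⟨y, -, -, hb, -⟩ := att hL (inv hL t) le_rfl h
        refine (hb (by omega) (.inr ⟨rfl, ?_⟩)).elim
        rw [hw, m1, i1']; simp
    · have e1 : mv t v 1 = v' := by rw [hw]; simpa using mv_mv' t v' (-1)
      rcases (pos_succ i1).2 with h | ⟨_, h⟩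
      · obtain ⟨y, h3, -⟩ := att hL (inv hL t) le_rfl h
        refine (i3' (.inr ⟨rfl, ?_⟩)).elim
        rw [← hw, h3]; simp
      · rwa [e1] at h
  rcases k' with ⟨k1', -⟩ | ⟨k1', rfl, k3', k4'⟩
  · omega
  obtain ⟨c, hc, c1, c2⟩ := fwd hL k1' hp' le_rfl i2' hq k3'
  set y := fr b' 0 (sg 0 1 (G.lane (mv t v' σ')) b') c with hy
  have l0 := abs_le.1 (lam_all hu' 0)
  have hxy : x = y ∨ b' 0 + 2 * G.h ≤ x 0 := by
    by_cases hm : G.mk' (t + 1) ≤ y 0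
    · exact .inl (idle hL (by omega) hp' le_rfl c1 hq hm)
    rcases Nat.lt_or_ge (p' + 1) 22 with h | h
    · right
      obtain ⟨c', -, c3, c4⟩ := fwd hL (by omega) h le_rfl c1 hq (by omega)
      have := (mono hL (show p' + 1 + 1 ≤ 22 by omega) le_rfl c3 hq).1
      omega
    · left
      have : p' + 1 = 22 := by omega
      rw [this, hq] at c1
      exact Option.some.inj c1
  have key : b 0 - G.m ≤ fr a.1 a.2.1 a.2.2 z 0 := by
    rcases k with ⟨k1, rfl, k2, k3, k4⟩ | ⟨k1, rfl, k3, k4⟩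
    · exact zone_zero (ax_ne _) hz
    · have z1 := (zone_at (i := 0) (τ := 1) (L := G.lane (mv (t + 1) v σ)) (b := b) hz).1
      simp at z1 ⊢
      omega
  rcases hxy with hxy | hxy
  swap
  · refine ⟨0, ?_⟩
    rw [le_abs]; left; omega
  rcases k with ⟨k1, rfl, k2, k3, k4⟩ | ⟨k1, rfl, k3, k4⟩
  · rcases lam_or hu' hc with hl | hl
    · refine ⟨0, ?_⟩
      simp only [Units.val_one, one_mul] at hl
      rw [le_abs]; left
      rw [hxy] at i8
      omega
    · refine ⟨G.ax (t + 1), ?_⟩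
      have z1 := (zone_at (i := G.ax (t + 1)) (τ := σ) (L := G.lane (mv (t + 1) v σ)) (b := b) hz).1
      have l1 := abs_le.1 (hl (G.ax (t+1)) (ax_ne (t + 1)))
      rw [← hy, ← hxy] at l1
      have : 0 ≤ G.h * p := by positivity
      rw [le_abs]
      rcases Int.units_eq_one_or σ with rfl | rfl <;> simp at z1 k2 ⊢ <;> omega
  · refine ⟨0, ?_⟩
    have z1 := (zone_at (i := 0) (τ := 1) (L := G.lane (mv (t + 1) v σ)) (b := b) hz).1
    rw [hxy] at i8
    simp at z1 ⊢
    rw [le_abs]; left; omega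

def B0 (G : Gm d) : Set (Vtx d) := ⋃ v ∈ {v ∈ G.Vr | v.1 % 2 = 0 ∧ v.2 % 2 = 0 ∧ v ∈ G.V0}, bx (G.lane v) G.m

theorem zoneB {ρ} (hL : G.Leg ρ) {t v σ p a} (hp : p < 22) (ha : G.stepA ρ t v σ p = .inr a)
    {z u} (hz : z ∈ zone0 d G.m G.r) (hu : u ∈ G.B0) :
    ∃ j, 2 ≤ |fr a.1 a.2.1 a.2.2 z j - u j| := by
  have h2 := h_pos (G := G)
  have he := h_eq (G := G)
  have hr := rho_m (G := G)
  have hmr : G.m ≤ rho G.m G.r := by omega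
  have ez := ext hL hp ha (zone_lam hz a)
  obtain ⟨x, b, i1, i2, i3, i4, i5, i6, i7, i8, k⟩ := inf hL hp ha
  simp only [B0, mem_iUnion, exists_prop] at hu
  obtain ⟨w, ⟨w1, w2, w3, w4⟩, hu⟩ := hu
  have hu : ∀ j, |u j - G.lane w j| ≤ G.m := hu
  have l0 := abs_le.1 (hu 0)
  have e0 : G.lane w 0 = 0 := by simp [lane]
  rcases t with _ | t
  swap
  · refine ⟨0, ?_⟩
    have := ez.1
    have h3 := mk_succ (G := G) t
    have : 0 ≤ G.mk' t := by unfold mk'; positivity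
    rw [le_abs]; left; omega
  by_cases hw : v = w
  swap
  · exact lane_far i4 ⟨by simpa using w2, by simpa using w3⟩ hw σ ez.2.2.1 ez.2.2.2.1 ez.2.2.2.2.1 (fun j _ => (hu j).trans (by omega))
  subst hw
  have hx : x = G.lane v := by simp [pos, w1, w2, w3, w4] at i1; exact i1.symm
  rcases k with ⟨k1, rfl, k2, k3, k4⟩ | ⟨k1, rfl, k3, k4⟩
  · refine ⟨G.ax 0, ?_⟩
    have z1 := (zone_at (i := G.ax 0) (τ := σ) (L := G.lane (mv 0 v σ)) (b := b) hz).1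
    have l1 := abs_le.1 (hu (G.ax 0))
    have : 0 ≤ G.h * p := by positivity
    rw [hx] at k2
    rw [le_abs]
    rcases Int.units_eq_one_or σ with rfl | rfl <;> simp at z1 k2 ⊢ <;> omega
  · refine ⟨0, ?_⟩
    have z1 := (zone_at (i := 0) (τ := 1) (L := G.lane (mv 0 v σ)) (b := b) hz).1
    have : x 0 = 0 := by rw [hx, e0]
    simp at z1 ⊢
    rw [le_abs]; left; omega

end Gm
end D2c
section D2d
namespace Gm
variable {d : ℕ} [NeZero d] {G : Gm d}

theorem kk_lt {t : ℕ} {v} (hv : v ∈ G.Vr) {s n : ℕ} (hs : s < 44) (h : t < n) : G.kk t v s < n * G.P * 44 := by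
  have := (G.hix v hv).1
  have h2 : (t + 1) * G.P ≤ n * G.P := Nat.mul_le_mul_right _ h
  unfold kk
  rw [add_mul, one_mul] at h2
  omega

theorem kk_ge {t : ℕ} {v} (s : ℕ) : t * G.P * 44 ≤ G.kk t v s := by unfold kk; omega

theorem gt_loc {ρ ρ' : ℕ → Option (Vtx d)} {n t : ℕ} (h : ∀ j < n * G.P * 44, ρ j = ρ' j) (ht : t < n) {v s} (hs : s < 44) :
    G.gt ρ t v s = G.gt ρ' t v s := by
  unfold gt
  split_ifs with hv
  · exact h _ (kk_lt hv hs ht)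
  · rfl

theorem pos_loc {ρ ρ' : ℕ → Option (Vtx d)} {t : ℕ} (h : ∀ j < t * G.P * 44, ρ j = ρ' j) (v) : G.pos ρ t v = G.pos ρ' t v := by
  by_cases hv : v ∈ G.Vr
  · rcases t with _ | t
    · simp [pos, hv]
    · simp only [pos, hv, if_true]
      rw [gt_loc h (Nat.lt_succ_self t) (by omega), gt_loc h (Nat.lt_succ_self t) (by omega)]
  · simp [pos, hv]

theorem ploc : PLoc G.pol := by
  intro k ρ ρ' h
  obtain ⟨t, v, hv, σ, p, hp, rfl, -, -⟩ := kk_ex (G := G) k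
  rw [pol_kk _ t hv σ hp, pol_kk _ t hv σ hp]
  have h1 : ∀ w, G.pos ρ t w = G.pos ρ' t w := pos_loc fun j hj => h j (hj.trans_le (kk_ge _))
  have h2 : G.q ρ t v σ p = G.q ρ' t v σ p := by
    rcases p with _ | p
    · exact h1 v
    · simp only [q, gt, hv, if_true]
      exact h _ (by unfold kk; omega)
  have h3 : G.blk' ρ t v σ ↔ G.blk' ρ' t v σ := by unfold blk'; rw [h1]
  unfold stepA
  rw [h2]
  by_cases hb : G.blk' ρ t v σ
  · rw [if_pos hb, if_pos (h3.1 hb)]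
  · rw [if_neg hb, if_neg (hb ∘ h3.2)]

theorem source {ρ} (hL : G.Leg ρ) : ∀ t v σ p b, p ≤ 22 → G.q ρ t v σ p = some b → bx b G.m ⊆ G.B0 ∨
    ∃ j < G.kk t v (of σ + p), (∃ a, G.pol j ρ = .inr a) ∧ ρ j = some b := by
  intro t
  induction t with
  | zero =>
    intro v σ p
    induction p with
    | zero =>
      intro b _ hb
      left
      have hv := pos_mem (G := G) (ρ := ρ) (t := 0) (v := v) (by rw [show G.pos ρ 0 v = some b from hb]; simp)
      simp only [q, pos, hv, if_true] at hb
      split_ifs at hb with he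
      obtain rfl := Option.some.inj hb
      exact subset_biUnion_of_mem (u := fun v => bx (G.lane v) G.m) ⟨hv, he⟩
    | succ p ih =>
      intro b hp hb
      have hv : v ∈ G.Vr := q_mem (by rw [hb]; simp)
      obtain ⟨hn, c, hc, ⟨a, c', h1, h2, h3⟩ | ⟨h1, rfl⟩⟩ := chain hL (by omega) hb
      · right
        refine ⟨G.kk 0 v (of σ + p), by unfold kk; omega, ⟨a, ?_⟩, by simpa [q, gt, hv] using hb⟩
        rw [pol_kk _ _ hv _ (by omega), stepA, if_neg hn, hc]; exact h2
      · rcases ih b (by omega) hc with h | ⟨j, h1, h2⟩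
        · exact .inl h
        · exact .inr ⟨j, h1.trans_le (by unfold kk; omega), h2⟩
  | succ t iht =>
    intro v σ p
    induction p with
    | zero =>
      intro b _ hb
      have hv := pos_mem (G := G) (ρ := ρ) (t := t + 1) (v := v) (by rw [show G.pos ρ (t + 1) v = some b from hb]; simp)
      have key : ∀ w σ', G.q ρ t w σ' 22 = some b → bx b G.m ⊆ G.B0 ∨
          ∃ j < G.kk (t + 1) v (of σ + 0), (∃ a, G.pol j ρ = .inr a) ∧ ρ j = some b := by
        intro w σ' hw
        have hw' : w ∈ G.Vr := q_mem (by rw [hw]; simp)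
        rcases iht w σ' 22 b le_rfl hw with h | ⟨j, h1, h2⟩
        · exact .inl h
        · refine .inr ⟨j, h1.trans_le (le_trans ?_ (kk_ge _)), h2⟩
          have := (G.hix w hw').1
          have := of_lt σ'
          unfold kk
          have e : (t + 1) * G.P = t * G.P + G.P := by ring
          rw [e]; omega
      rcases (pos_succ hb).2 with h | ⟨_, h⟩
      · exact key _ _ h
      · exact key _ _ h
    | succ p ih =>
      intro b hp hb
      have hv : v ∈ G.Vr := q_mem (by rw [hb]; simp)
      obtain ⟨hn, c, hc, ⟨a, c', h1, h2, h3⟩ | ⟨h1, rfl⟩⟩ := chain hL (by omega) hb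
      · right
        refine ⟨G.kk (t + 1) v (of σ + p), by unfold kk; omega, ⟨a, ?_⟩, by simpa [q, gt, hv] using hb⟩
        rw [pol_kk _ _ hv _ (by omega), stepA, if_neg hn, hc]; exact h2
      · rcases ih b (by omega) hc with h | ⟨j, h1, h2⟩
        · exact .inl h
        · exact .inr ⟨j, h1.trans_le (by unfold kk; omega), h2⟩

def lev (G : Gm d) (k : ℕ) : ℕ := 44 * (k / 44 / G.P) + k % 44
def col (G : Gm d) (k : ℕ) : Fin (88 + 1) := ⟨(k / 44 / G.P) % 2 * 44 + k % 44 + 1, by omega⟩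

theorem geo : Geo G.B0 G.pol G.m G.r G.col G.lev := by
  intro ρ hL k a hk
  obtain ⟨t, v, hv, σ, p, hp, rfl, -, -⟩ := kk_ex (G := G) k
  have hσ := of_lt σ
  obtain ⟨e1, -, e3⟩ := kk_dec (G := G) t hv (show of σ + p < 44 by omega)
  rw [pol_kk _ t hv σ hp] at hk
  refine ⟨by simp [col, Fin.ext_iff], ?_, fun z hz => far_cl fun u hu => zoneB hL hp hk hz hu, ?_⟩
  · obtain ⟨x, b, -, h2, -, -, -, -, -, -, h⟩ := inf hL hp hk
    have : a.1 = b := by rcases h with ⟨-, rfl, -⟩ | ⟨-, rfl, -⟩ <;> rfl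
    rw [this]
    exact source hL t v σ p b hp.le h2
  · intro j hj a' ha'
    obtain ⟨t', v', hv', σ', p', hp', rfl, -, -⟩ := kk_ex (G := G) j
    have hσ' := of_lt σ'
    obtain ⟨e1', -, e3'⟩ := kk_dec (G := G) t' hv' (show of σ' + p' < 44 by omega)
    rw [pol_kk _ t' hv' σ' hp'] at ha'
    simp only [lev, col, e1, e3, e1', e3', ne_eq, Fin.mk.injEq]
    have ht : t' ≤ t := by
      by_contra hn
      have := kk_lt (G := G) hv (show of σ + p < 44 by omega) (show t < t' by omega)
      have := kk_ge (G := G) (t := t') (v := v') (of σ' + p')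
      omega
    have nc : (∀ u ∈ LamA G.m G.r a, ∀ u' ∈ LamA G.m G.r a', ∃ j, 2 ≤ |u j - u' j|) →
        (∀ z ∈ zone0 d G.m G.r, fr a.1 a.2.1 a.2.2 z ∉ cl (LamA G.m G.r a')) ∧
      ∀ u ∈ LamA G.m G.r a, u ∈ cl (LamA G.m G.r a') → 44 * t' + (of σ' + p') < 44 * t + (of σ + p) ∧
        ¬ t' % 2 * 44 + (of σ' + p') + 1 = t % 2 * 44 + (of σ + p) + 1 := fun h =>
      ⟨fun z hz => far_cl (h _ (zone_lam hz a)), fun u hu hu' => (far_cl (h u hu) hu').elim⟩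
    rcases Nat.lt_or_ge (t' + 1) t with h1 | h1
    · exact nc fun u hu u' hu' => far1 hL hp hk hp' ha' (by omega) hu hu'
    rcases Nat.lt_or_ge t' t with h2 | h2
    · obtain rfl : t = t' + 1 := by omega
      exact ⟨fun z hz => far_cl fun u hu => zone1 hL hp hk hp' ha' hz hu, fun u _ _ => ⟨by omega, by omega⟩⟩
    obtain rfl : t' = t := by omega
    by_cases hvv : v = v'
    · subst hvv
      have : of σ' + p' < of σ + p := by unfold kk at hj; omega
      exact ⟨fun z hz => far_cl fun u hu => zone2 hL hp hk hp' ha' this hz hu, fun u _ _ => ⟨by omega, by omega⟩⟩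
    · exact nc fun u hu u' hu' => far2 hL hp hk hp' ha' hvv hu hu'

noncomputable def tgt (G : Gm d) (k : ℕ) : ℕ × (ℤ × ℤ) :=
  (k / 44 / G.P + 1, mv (k / 44 / G.P) (G.en (k / 44 % G.P)) (if k % 44 < 22 then 1 else -1))
def BdG (G : Gm d) (ρ : ℕ → Option (Vtx d)) : Set (ℕ × (ℤ × ℤ)) :=
  {Z | ∃ k, G.tgt k = Z ∧ (∃ a, G.pol k ρ = .inr a) ∧ ρ k = none}
def RG (G : Gm d) (ρ : ℕ → Option (Vtx d)) (t : ℕ) : Set (ℤ × ℤ) := {v | G.Tm < t ∨ G.pos ρ t v ≠ none}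

theorem tgt_kk (t : ℕ) {v} (hv : v ∈ G.Vr) (σ : ℤˣ) {p : ℕ} (hp : p < 22) : G.tgt (G.kk t v (of σ + p)) = (t + 1, mv t v σ) := by
  have := of_lt σ
  obtain ⟨e1, e2, e3⟩ := kk_dec (G := G) t hv (show of σ + p < 44 by omega)
  unfold tgt
  rw [e1, e2, e3]
  rcases Int.units_eq_one_or σ with rfl | rfl <;> simp [of, hp]

theorem succ_q {ρ} (hL : G.Leg ρ) {t v σ} (hb : ¬ G.blk' ρ t v σ) (h0 : G.pos ρ t v ≠ none)
    (h : (t + 1, mv t v σ) ∉ G.BdG ρ) : ∀ p ≤ 22, G.q ρ t v σ p ≠ none := by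
  intro p
  have hv := pos_mem h0
  induction p with
  | zero => exact fun _ => h0
  | succ p ih =>
    intro hp hn
    obtain ⟨b, hb'⟩ := Option.ne_none_iff_exists'.1 (ih (by omega))
    have hn' : ρ (G.kk t v (of σ + p)) = none := by simpa [q, gt, hv] using hn
    have e : G.pol (G.kk t v (of σ + p)) ρ = G.stepB t v σ p b := by
      rw [pol_kk _ t hv σ (by omega), stepA, if_neg hb, hb']
    rcases hs : G.stepB t v σ p b with o | a
    · have := (hL _).1 o (e.trans hs)
      unfold stepB at hs
      split_ifs at hs
      obtain rfl := Sum.inl.inj hs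
      rw [hn'] at this; simp at this
    · exact h ⟨_, tgt_kk t hv σ (by omega), ⟨a, e.trans hs⟩, hn'⟩

theorem stepG {ρ} (hL : G.Leg ρ) : StepB G.Vr (G.RG ρ) (G.BdG ρ) := by
  intro t v w hv h0 h1 hw hb
  rcases Nat.lt_or_ge G.Tm (t + 1) with hT | hT
  · exact .inl hT
  have hv : G.pos ρ t v ≠ none := hv.resolve_left (by omega)
  have hσ : ∃ σ, mv t v σ = w := by
    obtain ⟨v1, v2⟩ := v
    obtain ⟨w1, w2⟩ := w
    rcases Nat.mod_two_eq_zero_or_one t with ht | ht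
    · have := h0 ht
      simp only [abs_eq zero_le_one] at this
      obtain ⟨h | h, rfl⟩ := this
      · exact ⟨-1, by simp [mv, ht]; omega⟩
      · exact ⟨1, by simp [mv, ht]; omega⟩
    · have := h1 ht
      simp only [abs_eq zero_le_one] at this
      obtain ⟨rfl, h | h⟩ := this
      · exact ⟨-1, by simp [mv, ht]; omega⟩
      · exact ⟨1, by simp [mv, ht]; omega⟩
  obtain ⟨σ, rfl⟩ := hσ
  have fin1 : ∀ v', mv t v' 1 = mv t v σ → G.pos ρ t v' ≠ none → mv t v σ ∈ G.RG ρ (t + 1) := by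
    intro v' e hv'
    refine .inr ?_
    have h3 := succ_q hL (t := t) (v := v') (σ := 1) (by rintro (h | h); omega; exact absurd h.1 (by decide)) hv' (by rwa [e]) 22 le_rfl
    rw [← e] at hw ⊢
    simp only [pos, hw, if_true, mv_mv']
    intro h
    rw [Option.or_eq_none_iff] at h
    exact h3 h.1
  rcases Int.units_eq_one_or σ with rfl | rfl
  · exact fin1 v rfl hv
  by_cases hbk : G.pos ρ t (mv t (mv t v (-1)) (-1)) ≠ none
  · exact fin1 _ (mv_mv t _ 1) hbk
  · refine .inr ?_
    have h3 := succ_q hL (t := t) (v := v) (σ := -1) (by rintro (h | h); omega; exact hbk h.2) hv hb 22 le_rfl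
    simp only [pos, hw, if_true]
    intro h
    rw [Option.or_eq_none_iff] at h
    have e : mv t (mv t v (-1)) 1 = v := by simpa using mv_mv' t v (-1)
    rw [e] at h
    exact h3 h.2

theorem bd_loc {ρ ρ' : ℕ → Option (Vtx d)} {τ : ℕ} (h : ∀ j < τ * G.P * 44, ρ j = ρ' j) :
    ∀ Z ∈ G.BdG ρ, Z.1 ≤ τ → Z ∈ G.BdG ρ' := by
  rintro Z ⟨k, rfl, ⟨a, ha⟩, hn⟩ hZ
  obtain ⟨t, v, hv, σ, p, hp, rfl, -, -⟩ := kk_ex (G := G) k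
  have := of_lt σ
  have hlt : G.kk t v (of σ + p) < τ * G.P * 44 := kk_lt hv (by omega) (by rw [tgt_kk t hv σ hp] at hZ; exact hZ)
  exact ⟨_, rfl, ⟨a, by rw [← ha]; exact (ploc _ _ _ fun j hj => h j (hj.trans hlt)).symm⟩, by rw [← h _ hlt]; exact hn⟩

theorem domG {Ω : Type*} [MeasurableSpace Ω] {μ : Measure Ω} [IsProbabilityMeasure μ] {ρ : Ω → ℕ → Option (Vtx d)} {e e' : ℕ}
    (h : Dom μ (fun ω => {k | (∃ a, G.pol k (ρ ω) = .inr a) ∧ ρ ω k = none}) ((1/2) ^ e)) (he : e' + 44 ≤ e) :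
    Dom μ (fun ω => G.BdG (ρ ω)) ((1/2) ^ e') := by
  classical
  refine coarse (j := 1) (r := 44) (κ := 1) h _ (fun Z => ((Finset.univ ×ˢ Finset.range 22).image
    fun x : ℤˣ × ℕ => G.kk (Z.1 - 1) (mv (Z.1 - 1) Z.2 (- x.1)) (of x.1 + x.2)).filter fun k => G.tgt k = Z) ?_ ?_ ?_ (by omega) (by norm_num)
  · rintro ω Z ⟨k, hk, h1, h2⟩
    refine ⟨{k}, ?_, by simpa only [Finset.coe_singleton, singleton_subset_iff] using ⟨h1, h2⟩, by simp⟩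
    simp only [Finset.singleton_subset_iff, Finset.mem_filter, hk, and_true, Finset.mem_image]
    obtain ⟨t, v, hv, σ, p, hp, rfl, -, -⟩ := kk_ex (G := G) k
    rw [tgt_kk t hv σ hp] at hk
    subst hk
    exact ⟨(σ, p), Finset.mem_product.2 ⟨Finset.mem_univ _, Finset.mem_range.2 hp⟩, by simp [mv_mv']⟩
  · intro Z
    refine (Finset.card_filter_le _ _).trans (Finset.card_image_le.trans ?_)
    simp
  · intro u
    exact ⟨{G.tgt u}, by simp, fun v hv => by rw [(Finset.mem_filter.1 hv).2.symm]; simp⟩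

def Q (G : Gm d) : Set (Vtx d) := {u | -G.h ≤ u 0 ∧ u 0 ≤ G.mk' G.Tm + 2 * G.h ∧ ∃ v ∈ G.Vr, ∀ j ≠ 0, |u j - G.lane v j| ≤ 10 * G.h}

theorem lam_Q : ∀ ρ, Legal G.m G.r G.pol ρ → ∀ k a, G.pol k ρ = .inr a → LamA G.m G.r a ⊆ G.Q := by
  intro ρ hL k a hk u hu
  have h2 := h_pos (G := G)
  obtain ⟨t, v, hv, σ, p, hp, rfl, -, -⟩ := kk_ex (G := G) k
  rw [pol_kk _ t hv σ hp] at hk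
  obtain ⟨e1, e2, e3, e4, e5, -⟩ := ext hL hp hk hu
  have ht : t < G.Tm := by
    obtain ⟨h, -⟩ := act_q hk
    by_contra hn
    exact h (.inl (by omega))
  have m0 : 0 ≤ G.mk' t := by unfold mk'; positivity
  have m1 : G.mk' (t + 1) ≤ G.mk' G.Tm := by
    unfold mk'
    have : ((t + 1 : ℕ) : ℤ) ≤ G.Tm := by exact_mod_cast ht
    nlinarith
  refine ⟨by omega, by omega, v, hv, fun j j0 => ?_⟩
  by_cases j1 : j = G.ax t
  · subst j1
    rw [abs_le]
    rcases Int.units_eq_one_or σ with rfl | rfl <;> simp at e3 e4 <;> omega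
  · exact (e5 j j0 j1).trans (by omega)

theorem Q_fin (hV : G.Vr.Finite) : G.Q.Finite := by
  have : G.Q ⊆ ⋃ v ∈ G.Vr, {u : Vtx d | ∀ j, u j ∈ Icc (if j = 0 then -G.h else G.lane v j - 10 * G.h)
      (if j = 0 then G.mk' G.Tm + 2 * G.h else G.lane v j + 10 * G.h)} := by
    rintro u ⟨h1, h2, v, hv, h3⟩
    refine mem_biUnion hv fun j => ?_
    by_cases j0 : j = 0
    · subst j0; simpa using ⟨h1, h2⟩
    · have := abs_le.1 (h3 j j0)
      simp only [j0, if_false, mem_Icc]; omega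
  refine (hV.biUnion fun v _ => ?_).subset this
  have := Set.Finite.pi' (fun j : Fin d => Set.finite_Icc (if j = 0 then -G.h else G.lane v j - 10 * G.h)
      (if j = 0 then G.mk' G.Tm + 2 * G.h else G.lane v j + 10 * G.h))
  exact this

theorem B0_fin (hV : G.Vr.Finite) : G.B0.Finite := (hV.subset (sep_subset _ _)).biUnion fun v _ => bx_fin _ _

end Gm
end D2d
section F1

section cpl
variable {Y : Type} [Fintype Y] [DecidableEq Y] [MeasurableSpace Y] [DiscreteMeasurableSpace Y]

def Yf (y0 : Y) (a : Bool) (z : Bool × Y) : Y := if z.1 = a then z.2 else y0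

/-- real weights of the coupled vertex variable -/
def wz (p : ℝ) (g : Y → ℝ) (y0 : Y) (z : Bool × Y) : ℝ :=
  if z.2 = y0 then (if z.1 then p else 1 - p) - (1 - g y0) else g z.2

theorem wz_sum {p : ℝ} {g : Y → ℝ} {y0 : Y} (hg : ∑ y, g y = 1) (a : Bool) :
    ∑ y, wz p g y0 (a, y) = if a then p else 1 - p := by
  rw [← Finset.add_sum_erase _ _ (Finset.mem_univ y0)] at hg ⊢
  rw [Finset.sum_congr rfl (g := g) fun y hy => by simp [wz, (Finset.mem_erase.1 hy).1]]
  simp only [wz, if_true]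
  linarith

theorem wz_nn {p : ℝ} {g : Y → ℝ} {y0 : Y} (h0 : ∀ y, 0 ≤ g y) (h1 : 1 - g y0 ≤ p) (h2 : 1 - g y0 ≤ 1 - p) (z) :
    0 ≤ wz p g y0 z := by
  unfold wz
  split_ifs <;> first | linarith | exact h0 _

theorem cpl_ex (p : unitInterval) {g : Y → ℝ} {y0 : Y} (hg : ∑ y, g y = 1) (h0 : ∀ y, 0 ≤ g y) (h1 : 1 - g y0 ≤ p)
    (h2 : 1 - g y0 ≤ 1 - p) : ∃ w : PMF (Bool × Y),
    (∀ a : Bool, w.toMeasure {z | z.1 = a} = ENNReal.ofReal (if a then (p : ℝ) else 1 - p)) ∧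
    ∀ a y, w.toMeasure {z | Yf y0 a z = y} = ENNReal.ofReal (g y) := by
  have nn := wz_nn h0 h1 h2
  have tot : ∑ z, wz (p : ℝ) g y0 z = 1 := by
    rw [Fintype.sum_prod_type]
    simp only [wz_sum hg]
    simp
  refine ⟨PMF.ofFintype (fun z => ENNReal.ofReal (wz p g y0 z)) ?_, ?_, ?_⟩
  · rw [← ENNReal.ofReal_sum_of_nonneg fun z _ => nn z, tot, ENNReal.ofReal_one]
  · intro a
    rw [PMF.toMeasure_apply_fintype]
    simp only [indicator_apply, mem_setOf_eq, PMF.ofFintype_apply]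
    rw [Fintype.sum_prod_type, ← wz_sum (y0 := y0) hg a, ENNReal.ofReal_sum_of_nonneg fun z _ => nn _]
    rw [Finset.sum_eq_single a]
    · simp
    · intro b _ hb; simp [hb]
    · simp
  · intro a y
    rw [PMF.toMeasure_apply_fintype]
    simp only [indicator_apply, mem_setOf_eq, PMF.ofFintype_apply]
    rw [Fintype.sum_prod_type]
    by_cases hy : y = y0
    · subst hy
      rw [Finset.sum_congr rfl (g := fun b => ENNReal.ofReal (if b = a then wz p g y (a, y) else if b then (p : ℝ) else 1 - p))]
      · have e := nn (a, y)
        have p0 := p.2.1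
        have p1 := p.2.2
        rw [Fintype.sum_bool]
        cases a
        · simp only [reduceCtorEq, if_false, if_true]
          rw [← ENNReal.ofReal_add p0 e]; congr 1; simp [wz]
        · simp only [reduceCtorEq, if_false, if_true]
          rw [← ENNReal.ofReal_add e (by simpa using p1)]; congr 1; simp [wz]
      · intro b _
        by_cases hb : b = a
        · subst hb
          rw [Finset.sum_eq_single y]
          · simp [Yf]
          · intro y' _ h'; simp [Yf, h']
          · simp
        · simp only [Yf, hb, if_false, if_true]
          rw [← wz_sum (y0 := y) hg b, ENNReal.ofReal_sum_of_nonneg fun z _ => nn _]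
    · rw [Finset.sum_eq_single a, Finset.sum_eq_single y]
      · simp [Yf, wz, hy]
      · intro y' _ h'; simp [Yf, h']
      · simp
      · intro b _ hb; simp [Yf, hb, Ne.symm hy]
      · simp

theorem Pm_rect {ι Z : Type} [Fintype Z] [MeasurableSpace Z] [DiscreteMeasurableSpace Z] (w : PMF Z) (s : Finset ι) (T : ι → Set Z) :
    (Pm fun _ : ι => w) {z | ∀ v ∈ s, z v ∈ T v} = ∏ v ∈ s, w.toMeasure (T v) :=
  Measure.infinitePi_pi (fun _ : ι => w.toMeasure) (s := s) (t := T) (fun _ _ => by measurability)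
end cpl

variable {d : ℕ} [NeZero d] {K : ℕ}

def tch (S : Set (Vtx d)) (v : Vtx d) : Prop := v ∈ S ∨ ∃ u ∈ S, adj u v

noncomputable def Nn (B Q : Set (Vtx d)) (η : Bits d K) (v : Vtx d) : ℕ := sInf {n | tch (ball B Q η n) v}

abbrev Zc (d K : ℕ) := Vtx d → Bool × (Fin (K + 1) → Bool)

def Cons (B Q : Set (Vtx d)) (z : Zc d K) (ξ : ℕ → Bool) (η : Bits d K) : Prop :=
  (∀ v ∈ Q, (fun c => η (v, c)) = Yf (fun _ => false) (ξ (Nn B Q η v)) (z v)) ∧ ∀ v ∉ Q, ∀ c, η (v, c) = false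

open Classical in
noncomputable def SE (B Q : Set (Vtx d)) (z : Zc d K) (ξ : ℕ → Bool) : ℕ → Set (Vtx d) × Set (Vtx d)
  | 0 => (B, ∅)
  | n + 1 => ((SE B Q z ξ n).1 ∪ {v | v ∈ Q ∧ tch (SE B Q z ξ n).1 v ∧ v ∉ (SE B Q z ξ n).2 ∧
      ∃ c, Yf (fun _ => false) (ξ n) (z v) c = true}, {v | tch (SE B Q z ξ n).1 v})

theorem SE_mono {B Q : Set (Vtx d)} {z : Zc d K} {ξ : ℕ → Bool} {a b : ℕ} (h : a ≤ b) : (SE B Q z ξ a).1 ⊆ (SE B Q z ξ b).1 := by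
  induction b, h using Nat.le_induction with
  | base => exact subset_rfl
  | succ b _ ih => exact ih.trans subset_union_left

theorem cons_ex (B Q : Set (Vtx d)) (z : Zc d K) (ξ : ℕ → Bool) : ∃ η, Cons B Q z ξ η := by
  classical
  set S := fun n => (SE B Q z ξ n).1 with hS
  set N : Vtx d → ℕ := fun v => sInf {n | tch (S n) v} with hN
  set η : Bits d K := fun x => if x.1 ∈ Q then Yf (fun _ => false) (ξ (N x.1)) (z x.1) x.2 else false with hη
  have key : ∀ n, ball B Q η n = S n := by
    intro n
    induction n with
    | zero => rfl
    | succ n ih =>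
      simp only [ball, ih]
      simp only [hS, SE]
      ext v
      simp only [mem_union, mem_setOf_eq]
      constructor
      · rintro (h | ⟨hQ, u, hu, ha, c, hc⟩)
        · exact .inl h
        · have hne : {n | tch (S n) v}.Nonempty := ⟨n, .inr ⟨u, hu, ha⟩⟩
          have hmin : N v ≤ n := Nat.sInf_le (.inr ⟨u, hu, ha⟩)
          have hmem : tch (S (N v)) v := Nat.sInf_mem hne
          simp only [hη, hQ, if_true] at hc
          have hfirst : v ∉ (SE B Q z ξ (N v)).2 := by
            rcases e : N v with _ | k
            · simp [SE]
            · intro h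
              have : N v ≤ k := Nat.sInf_le h
              omega
          have : v ∈ S (N v + 1) := .inr ⟨hQ, hmem, hfirst, c, hc⟩
          rcases hmin.lt_or_eq with h | h
          · exact .inl (SE_mono (show N v + 1 ≤ n from h) this)
          · rw [h] at this; exact this
      · rintro (h | ⟨hQ, h | ⟨u, hu, ha⟩, hE, c, hc⟩)
        · exact .inl h
        · exact .inl h
        · refine .inr ⟨hQ, u, hu, ha, c, ?_⟩
          have : N v = n := by
            have hmin : N v ≤ n := Nat.sInf_le (.inr ⟨u, hu, ha⟩)
            by_contra hne
            have ht := Nat.sInf_mem (show {n | tch (S n) v}.Nonempty from ⟨n, .inr ⟨u, hu, ha⟩⟩)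
            obtain ⟨k, rfl⟩ : ∃ k, n = k + 1 := ⟨n - 1, by omega⟩
            have hm := SE_mono (B := B) (Q := Q) (z := z) (ξ := ξ) (show N v ≤ k by omega)
            exact hE (ht.imp (fun h => hm h) fun ⟨u', hu', ha'⟩ => ⟨u', hm hu', ha'⟩)
          simpa only [hη, hQ, if_true, this] using hc
  refine ⟨η, fun v hv => ?_, fun v hv c => by simp [hη, hv]⟩
  have : Nn B Q η v = N v := by simp only [Nn, key, hN]
  rw [this]
  funext c
  simp [hη, hv]

theorem cons_loc {B Q : Set (Vtx d)} {z : Zc d K} {ξ ξ' : ℕ → Bool} {η η' : Bits d K} (h : Cons B Q z ξ η) (h' : Cons B Q z ξ' η')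
    {n : ℕ} (hn : ∀ i ≤ n, ξ i = ξ' i) : ∀ v ∈ Q, tch (ball B Q η n) v → ∀ c, η (v, c) = η' (v, c) := by
  have key : ∀ k ≤ n, (∀ j ≤ k, ball B Q η j = ball B Q η' j) → ∀ v ∈ Q, tch (ball B Q η k) v → ∀ c, η (v, c) = η' (v, c) := by
    intro k hk hb v hv hu c
    have e : Nn B Q η v = Nn B Q η' v := by
      have hu' := hu
      rw [hb k le_rfl] at hu'
      have m1 : Nn B Q η v ≤ k := Nat.sInf_le hu
      have m2 : Nn B Q η' v ≤ k := Nat.sInf_le hu'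
      have i1 : tch (ball B Q η (Nn B Q η v)) v := Nat.sInf_mem (s := {n | tch (ball B Q η n) v}) ⟨k, hu⟩
      have i2 : tch (ball B Q η' (Nn B Q η' v)) v := Nat.sInf_mem (s := {n | tch (ball B Q η' n) v}) ⟨k, hu'⟩
      rw [hb _ m1] at i1
      rw [← hb _ m2] at i2
      exact le_antisymm (Nat.sInf_le i2) (Nat.sInf_le i1)
    have m1 : Nn B Q η v ≤ k := Nat.sInf_le hu
    have a1 := congrFun (h.1 v hv) c
    have a2 := congrFun (h'.1 v hv) c
    beta_reduce at a1 a2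
    rw [a1, a2, ← e, hn _ (by omega)]
  have balls : ∀ k ≤ n, ∀ j ≤ k, ball B Q η j = ball B Q η' j := by
    intro k
    induction k with
    | zero => intro _ j hj; obtain rfl : j = 0 := by omega
              rfl
    | succ k ih =>
      intro hk j hj
      have ihk := ih (by omega)
      rcases Nat.lt_or_ge j (k + 1) with h1 | h1
      · exact ihk j (by omega)
      obtain rfl : j = k + 1 := by omega
      have kk := key k (by omega) ihk
      simp only [ball]
      rw [← ihk k le_rfl]
      congr 1
      ext v
      constructor
      · rintro ⟨hv, u, hu, a, c, hc⟩; exact ⟨hv, u, hu, a, c, by rw [← kk v hv (.inr ⟨u, hu, a⟩)]; exact hc⟩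
      · rintro ⟨hv, u, hu, a, c, hc⟩; exact ⟨hv, u, hu, a, c, by rw [kk v hv (.inr ⟨u, hu, a⟩)]; exact hc⟩
  exact key n le_rfl (balls n le_rfl)

theorem cons_path {B Q : Set (Vtx d)} {z : Zc d K} {ξ : ℕ → Bool} {η : Bits d K} (h : Cons B Q z ξ η) (n : ℕ) :
    ∀ v, v ∈ ball B Q η (n + 1) → v ∉ ball B Q η n → ∃ γ : ℕ → Vtx d, γ n = v ∧ (∃ u ∈ B, adj u (γ 0)) ∧
      (∀ i ≤ n, γ i ∈ ball B Q η (i + 1) ∧ γ i ∉ ball B Q η i ∧ γ i ∈ Q ∧ (z (γ i)).1 = ξ i) ∧ ∀ i < n, adj (γ i) (γ (i + 1)) := by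
  have letter : ∀ n v, v ∈ ball B Q η (n + 1) → v ∉ ball B Q η n → v ∈ Q ∧ (z v).1 = ξ n ∧ ∃ u ∈ ball B Q η n, adj u v ∧ ∃ c, η (v, c) = true := by
    intro n v h1 h2
    rcases h1 with h1 | ⟨hv, u, hu, a, c, hc⟩
    · exact absurd h1 h2
    refine ⟨hv, ?_, u, hu, a, c, hc⟩
    have m1 : Nn B Q η v ≤ n := Nat.sInf_le (.inr ⟨u, hu, a⟩)
    have ht : tch (ball B Q η (Nn B Q η v)) v := Nat.sInf_mem (s := {n | tch (ball B Q η n) v}) ⟨n, .inr ⟨u, hu, a⟩⟩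
    have e : Nn B Q η v = n := by
      by_contra hne
      exact h2 (ball_mono η (show Nn B Q η v + 1 ≤ n by omega) (ht.imp id fun ⟨u', hu', a'⟩ => ⟨hv, u', hu', a', c, hc⟩))
    have a1 := congrFun (h.1 v hv) c
    simp only [e, hc, Yf] at a1
    by_contra hne
    simp [hne] at a1
  induction n with
  | zero =>
    intro v h1 h2
    obtain ⟨l1, l2, u, hu, a, -⟩ := letter 0 v h1 h2
    refine ⟨fun _ => v, rfl, ⟨u, hu, a⟩, fun i hi => ?_, fun i hi => by omega⟩
    obtain rfl : i = 0 := by omega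
    exact ⟨h1, h2, l1, l2⟩
  | succ n ih =>
    intro v h1 h2
    obtain ⟨l1, l2, u, hu, a, c, hc⟩ := letter (n + 1) v h1 h2
    obtain ⟨γ, g1, g2, g3, g4⟩ := ih u hu fun hu' => h2 (.inr ⟨l1, u, hu', a, c, hc⟩)
    refine ⟨fun i => if i ≤ n then γ i else v, by simp, by simpa using g2, fun i hi => ?_, fun i hi => ?_⟩
    · by_cases h : i ≤ n
      · simpa only [h, if_true] using g3 i h
      · obtain rfl : i = n + 1 := by omega
        simpa using ⟨h1, h2, l1, l2⟩
    · by_cases h : i + 1 ≤ n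
      · simpa [h, show i ≤ n by omega] using g4 i (by omega)
      · obtain rfl : i = n := by omega
        simpa [g1] using a

end F1
section F2
variable {d : ℕ} [NeZero d] {K : ℕ}

noncomputable def g0 (K : ℕ) (q s : unitInterval) (y : Fin (K + 1) → Bool) : ℝ := ∏ c, (bern (if c = 0 then q else s) (y c)).toReal

theorem g0_nn (q s : unitInterval) (y) : 0 ≤ g0 K q s y := Finset.prod_nonneg fun _ _ => ENNReal.toReal_nonneg

theorem g0_sum (q s : unitInterval) : ∑ y, g0 K q s y = 1 := by
  unfold g0
  have := Finset.prod_univ_sum (fun _ : Fin (K + 1) => (Finset.univ : Finset Bool)) (fun c b => (bern (if c = 0 then q else s) b).toReal)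
  rw [Fintype.piFinset_univ] at this
  rw [← this]
  refine Finset.prod_eq_one fun c _ => ?_
  rw [Fintype.sum_bool, bern_true, bern_false]; ring

theorem g0_zero (q s : unitInterval) : g0 K q s (fun _ => false) = (1 - q) * (1 - s) ^ K := by
  unfold g0
  rw [Fin.prod_univ_succ]
  simp [bern_false]

theorem tr_meas {B Q : Set (Vtx d)} (hQ : Q.Finite) {ξ : ℕ → Bool} {q s : unitInterval} {w : PMF (Bool × (Fin (K + 1) → Bool))}
    (hw : ∀ a y, w.toMeasure {z | Yf (fun _ => false) a z = y} = ENNReal.ofReal (g0 K q s y)) {e : Zc d K → Bits d K}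
    (he : ∀ z, Cons B Q z ξ (e z)) {F : Set (Bits d K)} (hF : dep F (Q ×ˢ univ)) :
    (Pm fun _ : Vtx d => w).real {z | e z ∈ F} ≤ (Pm (wt d K q s)).real F := by
  classical
  lift Q to Finset (Vtx d) using hQ
  obtain ⟨S, hS⟩ : ∃ S : Finset (Vtx d × Fin (K + 1)), S = Q ×ˢ Finset.univ := ⟨_, rfl⟩
  have hF' : dep F (S : Set (Vtx d × Fin (K + 1))) := hF.mono (by simp [hS])
  rw [Pm_sum (wt d K q s) false hF']
  obtain ⟨ex, hex⟩ : ∃ ex : (S → Bool) → Bits d K, ex = fun f v => if h : v ∈ S then f ⟨v, h⟩ else false := ⟨_, rfl⟩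
  obtain ⟨Tf, hTf⟩ : ∃ Tf : (S → Bool) → Set (Zc d K), ∀ f, Tf f = {z : Zc d K | ∀ v ∈ Q, z v ∈ {y | Yf (fun _ => false) (ξ (Nn B Q (ex f) v)) y = fun c => ex f (v, c)}} := ⟨_, fun _ => rfl⟩
  obtain ⟨I, hI⟩ : ∃ I : Finset (S → Bool), I = Finset.univ.filter fun f => ex f ∈ F := ⟨_, rfl⟩
  have cov : {z | e z ∈ F} ⊆ ⋃ f ∈ I, Tf f := by
    intro z hz
    have h := he z
    have e1 : ex (fun x => e z x) = e z := by
      funext x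
      by_cases hx : x ∈ S
      · simp [hex, hx]
      · have : x.1 ∉ Q := fun hn => hx (by simp [hS, hn])
        simp only [hex, hx, dif_neg, not_false_iff]
        exact (h.2 x.1 (by simpa using this) x.2).symm
    simp only [mem_iUnion]
    refine ⟨fun x : S => e z x, by rw [hI, Finset.mem_filter, e1]; exact ⟨Finset.mem_univ _, hz⟩, ?_⟩
    rw [hTf]
    intro v hv
    rw [e1]
    exact (h.1 v hv).symm
  have key : ∀ f ∈ I, (Pm fun _ : Vtx d => w).real (Tf f) = ∏ x : S, (wt d K q s x (f x)).toReal := by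
    intro f _
    rw [hTf, measureReal_def, Pm_rect]
    simp only [hw, ENNReal.toReal_prod, mem_setOf_eq]
    have e2 : ∏ x : S, (wt d K q s x (f x)).toReal = ∏ x ∈ S, (wt d K q s x (ex f x)).toReal := by
      rw [← Finset.prod_coe_sort S]
      refine Finset.prod_congr rfl fun x _ => ?_
      simp [hex]
    rw [e2, hS, Finset.prod_product]
    refine Finset.prod_congr rfl fun v _ => ?_
    rw [ENNReal.toReal_ofReal (g0_nn q s _)]; rfl
  refine (measureReal_mono cov (measure_ne_top _ _)).trans ((measureReal_biUnion_finset_le _ _).trans (le_of_eq ?_))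
  rw [Finset.sum_congr rfl key, ← Finset.sum_filter]
  refine Finset.sum_congr ?_ fun _ _ => rfl
  ext f
  simp only [hI, hex, Finset.mem_filter, Finset.mem_univ, true_and]
  have : ∀ a b : Bits d K, a = b → (a ∈ F ↔ b ∈ F) := fun a b h => by rw [h]
  refine this _ _ ?_
  funext v; by_cases h : v ∈ S <;> simp [h]

theorem tr_dom {α : Type*} {B Q : Set (Vtx d)} (hQ : Q.Finite) {ξ : ℕ → Bool} {q s : unitInterval} {w : PMF (Bool × (Fin (K + 1) → Bool))}
    (hw : ∀ a y, w.toMeasure {z | Yf (fun _ => false) a z = y} = ENNReal.ofReal (g0 K q s y)) {e : Zc d K → Bits d K}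
    (he : ∀ z, Cons B Q z ξ (e z)) {Bd : Bits d K → Set α} (hB : ∀ D : Finset α, dep {η | (D : Set α) ⊆ Bd η} (Q ×ˢ univ)) {ε : ℝ}
    (h : Dom (Pm (wt d K q s)) Bd ε) : Dom (Pm fun _ : Vtx d => w) (fun z => Bd (e z)) ε :=
  fun D => (tr_meas hQ hw he (hB D)).trans (h D)

theorem tr_fst {p : unitInterval} {w : PMF (Bool × (Fin (K + 1) → Bool))} (hw : ∀ a : Bool, w.toMeasure {z | z.1 = a} = ENNReal.ofReal (if a then (p : ℝ) else 1 - p)) :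
    (Pm fun _ : Vtx d => w).map (fun z v => (z v).1) = PB d p := by
  refine eq_Pm (fun s f => ?_) ⟨true⟩
  rw [Measure.map_apply]
  · have := Pm_rect w s (fun v => {z | z.1 = f v})
    refine this.trans (Finset.prod_congr rfl fun v _ => ?_)
    rw [hw]; simp [bern]
  · exact measurable_pi_iff.2 fun v => measurable_fst.comp (measurable_pi_apply v)
  · have : {ω : Config d | ∀ v ∈ s, ω v = f v} = (s : Set (Vtx d)).pi fun v => {f v} := by ext; simp [Set.pi]
    rw [this]
    exact MeasurableSet.pi s.countable_toSet fun _ _ => measurableSet_singleton _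

end F2
section F3
namespace Gm
variable {d : ℕ} [NeZero d] {G : Gm d}

noncomputable def ro (G : Gm d) (η : Bits d 88) : ℕ → Option (Vtx d) := res G.B0 G.pol G.m G.r G.col η
noncomputable def cc (G : Gm d) : ℕ := (Lam0 d G.m G.r).ncard + 1

theorem leg_ro (η : Bits d 88) : G.Leg (G.ro η) := legal_res ploc η

theorem lev_lt {j τ : ℕ} (h : j < τ * G.P * 44) : G.lev j + 1 ≤ 44 * τ := by
  have : j / 44 / G.P < τ := by
    rw [Nat.div_div_eq_div_mul, Nat.div_lt_iff_lt_mul (by have := G.hP; positivity)]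
    calc j < τ * G.P * 44 := h
      _ = τ * (44 * G.P) := by ring
  unfold lev
  omega

theorem in_ball (η : Bits d 88) {τ : ℕ} {v} (hv : v ∈ (St G.B0 G.pol G.m G.r G.col η (τ * G.P * 44)).1) :
    v ∈ ball G.B0 G.Q η (44 * τ * G.cc) := by
  rcases St_ball ploc geo lam_Q η _ v hv with h | ⟨j, hj, a, -, -, h⟩
  · exact ball_mono η (Nat.zero_le _) h
  · exact ball_mono η (Nat.mul_le_mul_right _ (lev_lt hj)) h

theorem res_of_St {η η' : Bits d 88} {k : ℕ} (h : St G.B0 G.pol G.m G.r G.col η k = St G.B0 G.pol G.m G.r G.col η' k) :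
    ∀ j < k, G.ro η j = G.ro η' j := by
  intro j hj
  unfold ro
  rw [← St_res η hj, ← St_res η' hj, h]

theorem ro_loc {z : Zc d 88} {ξ ξ' : ℕ → Bool} {η η' : Bits d 88} (h : Cons G.B0 G.Q z ξ η) (h' : Cons G.B0 G.Q z ξ' η')
    {τ : ℕ} (hn : ∀ i ≤ 44 * τ * G.cc, ξ i = ξ' i) : ∀ j < τ * G.P * 44, G.ro η j = G.ro η' j := by
  refine res_of_St (St_det ploc fun j hj a ha v hv hv' => ?_)
  have hQ : v ∈ G.Q := lam_Q _ (leg_ro η) j a ha hv'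
  have ht : tch (ball G.B0 G.Q η (44 * τ * G.cc)) v := by
    rcases hv with hv | ⟨-, u, hu, hau⟩
    · exact .inl (in_ball η hv)
    · exact .inr ⟨u, in_ball η hu, hau⟩
  exact ⟨cons_loc h h' hn v hQ ht _, cons_loc h h' hn v hQ ht _⟩

theorem ro_dep {η η' : Bits d 88} (h : ∀ x ∈ G.Q ×ˢ (univ : Set (Fin 89)), η x = η' x) : G.ro η = G.ro η' := by
  funext j
  refine res_of_St (k := j + 1) (St_det ploc fun i hi a ha v hv hv' => ?_) j (Nat.lt_succ_self j)
  have hQ : v ∈ G.Q := lam_Q _ (leg_ro η) i a ha hv'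
  exact ⟨h _ ⟨hQ, mem_univ _⟩, h _ ⟨hQ, mem_univ _⟩⟩

def BL (G : Gm d) (n : ℕ) (η : Bits d 88) : Set (ℕ × (ℤ × ℤ)) := (Bd' 8000)^[n] (Bd0 (G.BdG (G.ro η)))

theorem BL_dom (hV : G.Vr.Finite) {q s : unitInterval}
    (hL : ∀ (c : Fin 89), c ≠ 0 → ∀ (b : Vtx d) (i : Fin d) (s' : Fin d → ℤˣ) (C : Set (Vtx d)), C.Finite →
    bx b G.m ⊆ C → (∀ z ∈ zone0 d G.m G.r, fr b i s' z ∉ cl C) →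
    (Pm (wt d 88 q s)).real {ω | ¬ succ b i s' G.m G.r (newC C (LamF b i s' G.m G.r) c ω)} ≤ (1/2) ^ 500000005044)
    {ξ : ℕ → Bool} {w : PMF (Bool × (Fin 89 → Bool))}
    (hw : ∀ a y, w.toMeasure {z | Yf (fun _ => false) a z = y} = ENNReal.ofReal (g0 88 q s y)) {e : Zc d 88 → Bits d 88}
    (he : ∀ z, Cons G.B0 G.Q z ξ (e z)) (n : ℕ) :
    Dom (Pm fun _ : Vtx d => w) (fun z => G.BL n (e z)) ((1/2) ^ (1728000 ^ n * 10000000000)) := by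
  refine tr_dom (Q_fin hV) hw he (Bd := G.BL n) (fun D η η' h => ?_) ?_
  · have : G.BL n η = G.BL n η' := by unfold BL; rw [ro_dep h]
    simp [this]
  · have h1 := St_dom (K := 88) q s (ε := (1/2) ^ 500000005044) (by positivity) ploc (B0_fin hV) geo hL
    have h2 := domG (ρ := G.ro) h1 (e' := 500000005000) (by norm_num)
    exact dom_levels (base_dom h2 (e' := 10000000000) (by norm_num)) le_rfl n

theorem BL_loc {z : Zc d 88} {ξ ξ' : ℕ → Bool} {η η' : Bits d 88} (h : Cons G.B0 G.Q z ξ η) (h' : Cons G.B0 G.Q z ξ' η') (n : ℕ)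
    {τ : ℕ} (hn : ∀ i < 176 * 864000 ^ n * G.cc * (τ + 1), ξ i = ξ' i) : ∀ Z ∈ G.BL n η, Z.1 ≤ τ → Z ∈ G.BL n η' := by
  refine levels_local (b := 8000) n (base_local (bd_loc (ro_loc h h' fun i hi => hn i (hi.trans_lt ?_))))
  have : 0 < G.cc := Nat.succ_pos _
  calc 44 * (4 * ((108 * 8000) ^ n * τ)) * G.cc = 176 * 864000 ^ n * G.cc * τ := by ring
    _ < _ := by rw [mul_add, mul_one]; exact Nat.lt_add_of_pos_right (by positivity)

theorem bf_le (n : ℕ) {a b : ℕ} (h : a ≤ b) : bf^[n] a ≤ bf^[n] b :=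
  (show Monotone bf from fun a b h => by unfold bf; omega).iterate n h

theorem surv {n W H : ℕ} (hV0 : box2 (2 * bf^[n] W) (2 * bf^[n] 0) ⊆ G.V0)
    (hVr : box2 (2 * bf^[n] (W + H) + 2) (2 * bf^[n] 0 + 2) ⊆ G.Vr) (hT : G.Tm = 4 * ((108 * 8000) ^ n * H)) {η : Bits d 88}
    (hS : ¬ Sd {P | (P.1, (P.2, (0 : ℤ))) ∈ G.BL n η} (0, W)) : ∃ v b, G.pos (G.ro η) G.Tm v = some b := by
  have h1 := levels (base_king (stepG (leg_ro (G := G) η)) hVr) 8000 n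
  have hm : ((bf^[n] W : ℕ) : ℤ) ≤ (bf^[n] (W + H) : ℕ) := by exact_mod_cast bf_le n (by omega)
  have h0 : box2 (bf^[n] W) (bf^[n] 0) ⊆ R0 (G.RG (G.ro η)) 0 := by
    rintro v ⟨v1, v2⟩
    rw [abs_le] at v1 v2
    have m1 : (2 * v.1, 2 * v.2) ∈ G.V0 := hV0 ⟨by rw [abs_le]; push_cast; constructor <;> omega, by rw [abs_le]; push_cast; constructor <;> omega⟩
    have m2 : (2 * v.1, 2 * v.2) ∈ G.Vr := hVr ⟨by rw [abs_le]; push_cast; constructor <;> omega, by rw [abs_le]; push_cast; constructor <;> omega⟩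
    refine .inr ?_
    simp [pos, m1, m2]
  have h2 := lip h1 W H (fun x x0 x1 => r_box n h0 ⟨by simpa [abs_le] using ⟨by omega, x1⟩, by simp⟩)
    (fun x x0 x1 => rg_box n subset_rfl ⟨by simpa [abs_le] using ⟨by omega, x1⟩, by simp⟩) hS
  obtain ⟨v, hv⟩ := r_nonempty n h2
  have hv : G.Tm < 4 * ((108 * 8000) ^ n * H) ∨ G.pos (G.ro η) (4 * ((108 * 8000) ^ n * H)) (2 * v.1, 2 * v.2) ≠ none := hv
  rw [← hT] at hv
  obtain ⟨b, hb⟩ := Option.ne_none_iff_exists'.1 (hv.resolve_left (lt_irrefl _))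
  exact ⟨_, b, hb⟩

theorem ball_h {η : Bits d 88} (n : ℕ) : ∀ v ∈ ball G.B0 G.Q η n, v 0 ≤ G.m + n := by
  induction n with
  | zero =>
    intro v hv
    simp only [ball, B0, mem_iUnion, exists_prop] at hv
    obtain ⟨w, -, hv⟩ := hv
    have := abs_le.1 (hv 0)
    have e0 : G.lane w 0 = 0 := by simp [lane]
    push_cast; omega
  | succ n ih =>
    rintro v (hv | ⟨-, u, hu, a, -⟩)
    · have := ih v hv; push_cast; omega
    · have := ih u hu
      have := abs_le.1 (adj_le a 0)
      push_cast; omega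

theorem long {n W H : ℕ} (hH : 1 ≤ H) (hV0 : box2 (2 * bf^[n] W) (2 * bf^[n] 0) ⊆ G.V0)
    (hVr : box2 (2 * bf^[n] (W + H) + 2) (2 * bf^[n] 0 + 2) ⊆ G.Vr) (hT : G.Tm = 4 * ((108 * 8000) ^ n * H)) {z : Zc d 88} {ξ : ℕ → Bool} {η : Bits d 88}
    (hc : Cons G.B0 G.Q z ξ η)
    (hS : ¬ Sd {P | (P.1, (P.2, (0 : ℤ))) ∈ G.BL n η} (0, W)) : ∃ γ : ℕ → Vtx d, (∃ u ∈ G.B0, adj u (γ 0)) ∧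
      (∀ i ≤ H, γ i ∈ G.Q ∧ (z (γ i)).1 = ξ i) ∧ (∀ i < H, adj (γ i) (γ (i + 1))) ∧ ∀ i ≤ H, ∀ j ≤ H, γ i = γ j → i = j := by
  classical
  obtain ⟨v, b, hb⟩ := surv hV0 hVr hT hS
  have hL := leg_ro (G := G) η
  have hh := h_pos (G := G)
  have he := h_eq (G := G)
  have hr := rho_m (G := G)
  have b0 := (inv hL G.Tm v b hb).2.1
  have hTH : (H : ℤ) ≤ G.Tm := by
    have : H ≤ G.Tm := by
      rw [hT]
      have : 1 * H ≤ (108 * 8000) ^ n * H := Nat.mul_le_mul_right _ (Nat.one_le_pow _ _ (by norm_num))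
      omega
    exact_mod_cast this
  have hH' : (1 : ℤ) ≤ H := by exact_mod_cast hH
  have b1 : 12 * G.h + 2 * H ≤ b 0 := by
    unfold mk' at b0
    nlinarith
  have hN : ∃ N, b ∈ ball G.B0 G.Q η N := by
    rcases source hL G.Tm v 1 0 b (by omega) hb with h | ⟨j, -, ⟨a, ha⟩, hj⟩
    · exact ⟨0, h (bx_self _ _)⟩
    · have := seed_mem ploc η (Nat.lt_succ_self j) ha hj (bx_self b G.m)
      rcases St_ball ploc geo lam_Q η _ b this with h | ⟨j, hj, a, -, -, h⟩
      exacts [⟨0, h⟩, ⟨_, h⟩]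
  have f1 := Nat.find_spec hN
  have f2 := fun k => Nat.find_min hN (m := k)
  generalize Nat.find hN = N at f1 f2
  have f3 := ball_h N b f1
  obtain ⟨k, rfl⟩ : ∃ k, N = k + 1 := by
    rcases N with _ | k
    · push_cast at f3; omega
    · exact ⟨k, rfl⟩
  push_cast at f3
  obtain ⟨γ, g1, g2, g3, g4⟩ := cons_path hc k b f1 (f2 k (Nat.lt_succ_self k))
  have hk : H ≤ k := by omega
  refine ⟨γ, g2, fun i hi => ⟨(g3 i (by omega)).2.2.1, (g3 i (by omega)).2.2.2⟩, fun i hi => g4 i (by omega), ?_⟩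
  have key : ∀ i j, i < j → j ≤ H → γ i ≠ γ j := fun i j h1 h2 h3 =>
    (g3 j (by omega)).2.1 (h3 ▸ ball_mono η (by omega) (g3 i (by omega)).1)
  intro i hi j hj hij
  by_contra hne
  rcases Nat.lt_or_gt_of_ne hne with h | h
  exacts [key i j h hj hij, key j i h hi hij.symm]

end Gm
end F3
section F4
variable {d : ℕ}

def Fp (ω : Config d) (ξ : ℕ → Bool) (A : Set (Vtx d)) (S : Set (Vtx d)) (H : ℕ) (γ : ℕ → Vtx d) : Prop :=
  γ 0 ∈ S ∧ (∀ i ≤ H, γ i ∈ A ∧ ω (γ i) = ξ i) ∧ (∀ i < H, adj (γ i) (γ (i + 1))) ∧ ∀ i ≤ H, ∀ j ≤ H, γ i = γ j → i = j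

def Ev (A : Set (Vtx d)) (S : Set (Vtx d)) (H : ℕ) : Set (Config d) := {ω | ∀ ξ, ∃ γ, Fp ω ξ A S H γ}

def NS (S : Set (Vtx d)) (n : ℕ) : Set (Vtx d) := ⋃ u ∈ S, bx u n

theorem NS_fin {S : Set (Vtx d)} (hS : S.Finite) (n : ℕ) : (NS S n).Finite := hS.biUnion fun u _ => bx_fin u n

theorem NS_mono {S : Set (Vtx d)} {a b : ℕ} (h : a ≤ b) : NS S a ⊆ NS S b := biUnion_mono subset_rfl fun u _ => bx_mono u h

theorem Fp.ns {ω : Config d} {ξ A S H γ} (h : Fp ω ξ A S H γ) : ∀ i ≤ H, γ i ∈ NS S i := by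
  intro i
  induction i with
  | zero => exact fun _ => mem_biUnion h.1 (bx_self _ _)
  | succ i ih =>
    intro hi
    obtain ⟨u, hu, hb⟩ := mem_iUnion₂.1 (ih (by omega))
    exact mem_biUnion hu (bx_adj hb (h.2.2.1 i (by omega)))

theorem Ev_meas (A : Set (Vtx d)) {S : Set (Vtx d)} (hS : S.Finite) (H : ℕ) : MeasurableSet (Ev A S H) := by
  refine dep.meas (s := NS S H) (fun ω ω' h h' ξ => ?_) (NS_fin hS H)
  obtain ⟨γ, hγ⟩ := h' ξ
  exact ⟨γ, hγ.1, fun i hi => ⟨(hγ.2.1 i hi).1, by rw [← h _ (NS_mono hi (hγ.ns i hi))]; exact (hγ.2.1 i hi).2⟩, hγ.2.2⟩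

theorem Ev_anti (A S : Set (Vtx d)) : Antitone (Ev A S) := by
  intro a b hab ω h ξ
  obtain ⟨γ, h1, h2, h3, h4⟩ := h ξ
  exact ⟨γ, h1, fun i hi => h2 i (by omega), fun i hi => h3 i (by omega), fun i hi j hj => h4 i (by omega) j (by omega)⟩

theorem konig (A : Set (Vtx d)) {S : Set (Vtx d)} (hS : S.Finite) :
    ⋂ H, Ev A S H ⊆ {ω | ∀ ξ : ℕ → Bool, ∃ v ∈ A, seesWordIn ω ξ A v} := by
  intro ω hω ξ
  have hK : IsCompact (univ.pi fun i => NS S i : Set (ℕ → Vtx d)) := isCompact_univ_pi fun i => (NS_fin hS i).isCompact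
  have cl1 : ∀ (i : ℕ) (U : Set (Vtx d)), IsClosed {γ : ℕ → Vtx d | γ i ∈ U} := fun i U =>
    (isClosed_discrete U).preimage (continuous_apply i)
  have cl2 : ∀ (i j : ℕ) (U : Set (Vtx d × Vtx d)), IsClosed {γ : ℕ → Vtx d | (γ i, γ j) ∈ U} := fun i j U =>
    (isClosed_discrete U).preimage ((continuous_apply i).prodMk (continuous_apply j))
  have hcl : ∀ H, IsClosed {γ | Fp ω ξ A S H γ} := by
    intro H
    refine (cl1 0 S).inter (IsClosed.inter ?_ (IsClosed.inter ?_ ?_))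
    · have : {γ : ℕ → Vtx d | ∀ i ≤ H, γ i ∈ A ∧ ω (γ i) = ξ i} = ⋂ i, ⋂ (_ : i ≤ H), {γ | γ i ∈ {v | v ∈ A ∧ ω v = ξ i}} := by ext; simp
      refine (congrArg IsClosed this).mpr ?_; exact isClosed_iInter fun i => isClosed_iInter fun _ => cl1 _ _
    · have : {γ : ℕ → Vtx d | ∀ i < H, adj (γ i) (γ (i + 1))} = ⋂ i, ⋂ (_ : i < H), {γ | (γ i, γ (i + 1)) ∈ {v : Vtx d × Vtx d | adj v.1 v.2}} := by ext; simp
      refine (congrArg IsClosed this).mpr ?_; exact isClosed_iInter fun i => isClosed_iInter fun _ => cl2 _ _ _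
    · have : {γ : ℕ → Vtx d | ∀ i ≤ H, ∀ j ≤ H, γ i = γ j → i = j} = ⋂ i, ⋂ (_ : i ≤ H), ⋂ j, ⋂ (_ : j ≤ H), {γ | (γ i, γ j) ∈ {v : Vtx d × Vtx d | v.1 = v.2 → i = j}} := by ext; simp
      refine (congrArg IsClosed this).mpr ?_; exact isClosed_iInter fun i => isClosed_iInter fun _ => isClosed_iInter fun j => isClosed_iInter fun _ => cl2 _ _ _
  have := IsCompact.nonempty_iInter_of_sequence_nonempty_isCompact_isClosed
    (fun H => {γ | Fp ω ξ A S H γ} ∩ (univ.pi fun i => NS S i : Set (ℕ → Vtx d))) ?_ ?_ (hK.inter_left (hcl 0))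
    (fun H => (hcl H).inter hK.isClosed)
  · obtain ⟨γ, hγ⟩ := this
    have h : ∀ H, Fp ω ξ A S H γ := fun H => (mem_iInter.1 hγ H).1
    exact ⟨γ 0, ((h 0).2.1 0 le_rfl).1, γ, rfl, fun i j => (h (i + j)).2.2.2 i (by omega) j (by omega),
      fun i => (h (i + 1)).2.2.1 i (by omega), fun i => ((h i).2.1 i le_rfl).1, fun i => ((h i).2.1 i le_rfl).2⟩
  · rintro H γ ⟨⟨h1, h2, h3, h4⟩, hK⟩
    exact ⟨⟨h1, fun i hi => h2 i (by omega), fun i hi => h3 i (by omega), fun i hi j hj => h4 i (by omega) j (by omega)⟩, hK⟩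
  · intro H
    obtain ⟨γ, hγ⟩ := mem_iInter.1 hω H ξ
    have e : ∀ i ≤ H, γ (min i H) = γ i := fun i hi => by rw [min_eq_left hi]
    refine ⟨fun i => γ (min i H), ⟨?_, ?_, ?_, ?_⟩, fun i _ => NS_mono (min_le_left i H) (hγ.ns _ (min_le_right i H))⟩
    · simpa using hγ.1
    · intro i hi; simp only [e i hi]; exact hγ.2.1 i hi
    · intro i hi; simp only [e i hi.le, e (i + 1) hi]; exact hγ.2.2.1 i hi
    · intro i hi j hj; simp only [e i hi, e j hj]; exact hγ.2.2.2 i hi j hj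

theorem concl (A : Set (Vtx d)) (μ : Measure (Config d)) [IsProbabilityMeasure μ]
    (h : ∀ W : ℕ, 1 ≤ W → ∃ S : Set (Vtx d), S.Finite ∧ ∀ H, 1 ≤ H → μ (Ev A S H)ᶜ ≤ 2 * (1 / 2) ^ W) :
    μ {ω | ∀ ξ : ℕ → Bool, ∃ v ∈ A, seesWordIn ω ξ A v} = 1 := by
  have key : ∀ W : ℕ, 1 ≤ W → 1 - 2 * (1 / 2) ^ W ≤ μ {ω | ∀ ξ : ℕ → Bool, ∃ v ∈ A, seesWordIn ω ξ A v} := by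
    intro W hW
    obtain ⟨S, hS, hH⟩ := h W hW
    refine le_trans ?_ (measure_mono (konig A hS))
    rw [(Ev_anti A S).measure_iInter (fun H => (Ev_meas A hS H).nullMeasurableSet) ⟨0, measure_ne_top _ _⟩]
    refine le_iInf fun H => ?_
    refine le_trans ?_ (measure_mono (Ev_anti A S (Nat.le_succ H)))
    have := hH (H + 1) (by omega)
    rw [prob_compl_eq_one_sub (Ev_meas A hS _)] at this
    exact tsub_le_iff_tsub_le.1 this
  refine le_antisymm prob_le_one ?_
  have lim : Filter.Tendsto (fun W : ℕ => (1 : ENNReal) - 2 * (1 / 2) ^ W) Filter.atTop (nhds (1 - 2 * 0)) := by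
    refine ENNReal.Tendsto.sub tendsto_const_nhds (ENNReal.Tendsto.const_mul ?_ (.inr (by simp))) (.inl (by simp))
    exact ENNReal.tendsto_pow_atTop_nhds_zero_of_lt_one (by simp)
  rw [mul_zero, tsub_zero] at lim
  exact le_of_tendsto lim (Filter.eventually_atTop.2 ⟨1, fun W hW => key W hW⟩)

theorem box2_fin (X A : ℕ) : (box2 X A).Finite := by
  refine ((finite_Icc (-(X : ℤ)) X).prod (finite_Icc (-(A : ℤ)) A)).subset ?_
  rintro v ⟨h1, h2⟩
  rw [abs_le] at h1 h2
  exact ⟨h1, h2⟩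

theorem enum {α : Type} [Inhabited α] {V : Set α} (hV : V.Finite) (hn : V.Nonempty) : ∃ (P : ℕ) (en : ℕ → α) (ix : α → ℕ), 0 < P ∧
    (∀ i < P, en i ∈ V ∧ ix (en i) = i) ∧ ∀ v ∈ V, ix v < P ∧ en (ix v) = v := by
  classical
  lift V to Finset α using hV
  let E := V.equivFin
  refine ⟨V.card, fun i => if h : i < V.card then (E.symm ⟨i, h⟩ : α) else default, fun v => if h : v ∈ V then (E ⟨v, h⟩ : ℕ) else 0,
    Finset.card_pos.2 (by simpa using hn), fun i hi => ?_, fun v hv => ?_⟩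
  · simp [hi]
  · have hv : v ∈ V := hv
    simp [hv]

theorem arith (c : ℕ) : 2 * (176 * 864000 ^ c * c) + 3 ≤ 1728000 ^ c * 5000000000 := by
  have h1 : c < 2 ^ c := Nat.lt_two_pow_self
  have h2 : (1728000 : ℕ) ^ c = 864000 ^ c * 2 ^ c := by rw [← mul_pow]; norm_num
  have h3 : 864000 ^ c * c ≤ 1728000 ^ c := by rw [h2]; exact Nat.mul_le_mul_left _ h1.le
  have h4 : 1 ≤ 1728000 ^ c := Nat.one_le_pow _ _ (by norm_num)
  have h5 : 176 * 864000 ^ c * c = 176 * (864000 ^ c * c) := by ring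
  omega

theorem build (hd : 3 ≤ d) [NeZero d] (m r : ℕ) (hr : 1 ≤ r) (q s : unitInterval)
    (hL : ∀ (c : Fin 89), c ≠ 0 → ∀ (b : Vtx d) (i : Fin d) (s' : Fin d → ℤˣ) (C : Set (Vtx d)), C.Finite →
    bx b m ⊆ C → (∀ z ∈ zone0 d m r, fr b i s' z ∉ cl C) →
    (Pm (wt d 88 q s)).real {ω | ¬ succ b i s' m r (newC C (LamF b i s' m r) c ω)} ≤ (1/2) ^ 500000005044)
    {w : PMF (Bool × (Fin 89 → Bool))}
    (hw : ∀ a y, w.toMeasure {z | Yf (fun _ => false) a z = y} = ENNReal.ofReal (g0 88 q s y)) :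
    ∃ l : ℕ, ∀ W : ℕ, 1 ≤ W → ∃ S : Set (Vtx d), S.Finite ∧ ∀ H, 1 ≤ H →
      (Pm fun _ : Vtx d => w) {z | (fun v => (z v).1) ∉ Ev (slab2 d l) S H} ≤ 2 * (1 / 2) ^ W := by
  classical
  obtain ⟨n, hn⟩ : ∃ n, n = (Lam0 d m r).ncard + 1 := ⟨_, rfl⟩
  obtain ⟨A, hA⟩ : ∃ A, A = 2 * bf^[n] 0 + 2 := ⟨_, rfl⟩
  obtain ⟨off, ho⟩ : ∃ off : ℕ, off = 8 * hh m r * A + 10 * hh m r := ⟨_, rfl⟩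
  obtain ⟨a1, ha1⟩ : ∃ a1 : Fin d, a1 = ⟨1, by omega⟩ := ⟨_, rfl⟩
  obtain ⟨a2, ha2⟩ : ∃ a2 : Fin d, a2 = ⟨2, by omega⟩ := ⟨_, rfl⟩
  obtain ⟨ln, hln⟩ : ∃ ln : ℤ × ℤ → Vtx d, ln = fun v j => if j = 0 then 0 else if j = a1 then 8 * (hh m r : ℤ) * v.1 else if j = a2 then 8 * (hh m r : ℤ) * v.2 + off else off := ⟨_, rfl⟩
  refine ⟨2 * off, fun W hW => ⟨NS (⋃ v ∈ box2 (2 * bf^[n] W) (2 * bf^[n] 0), bx (ln v) m) 1,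
    NS_fin ((box2_fin _ _).biUnion fun v _ => bx_fin _ _) _, fun H hH => ?_⟩⟩
  obtain ⟨P, en, ix, hP, hen, hix⟩ := enum (box2_fin (2 * bf^[n] (W + H) + 2) A) ⟨(0, 0), by constructor <;> rw [abs_zero] <;> positivity⟩
  have k1 : a1 ≠ 0 := by rw [ha1]; intro h; simpa using congrArg Fin.val h
  have k2 : a2 ≠ 0 := by rw [ha2]; intro h; simpa using congrArg Fin.val h
  have k12 : a1 ≠ a2 := by rw [ha1, ha2]; intro h; simpa using congrArg Fin.val h
  let G : Gm d := ⟨m, r, P, 4 * ((108 * 8000) ^ n * H), off, a1, a2, en, ix, box2 (2 * bf^[n] (W + H) + 2) A,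
    box2 (2 * bf^[n] W) (2 * bf^[n] 0), k1, k2, k12, hr, hP, hen, hix⟩
  have hlane : G.lane = ln := hln.symm
  choose e he using fun (ξ : ℕ → Bool) (z : Zc d 88) => cons_ex G.B0 G.Q z ξ
  have h1 := words_lip (Pm fun _ : Vtx d => w) (fun ξ z => G.BL n (e ξ z)) (176 * 864000 ^ n * G.cc) (1728000 ^ n * 5000000000)
    (by have : G.cc = n := hn.symm
        rw [this]; exact arith n)
    (fun ξ => by
      have := G.BL_dom (box2_fin _ _) hL hw (he ξ) n
      rwa [show 1728000 ^ n * 10000000000 = 2 * (1728000 ^ n * 5000000000) by ring] at this)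
    (fun ξ ξ' τ h z => Gm.BL_loc (he ξ z) (he ξ' z) n h) W hW
  refine (measure_mono fun z hz => ?_).trans h1
  by_contra hno
  refine hz fun ξ => ?_
  have hno : ∀ ξ, ¬ Sd {P | (P.1, (P.2, (0 : ℤ))) ∈ G.BL n (e ξ z)} (0, W) := fun ξ h => hno ⟨ξ, h⟩
  obtain ⟨γ, ⟨u, hu, g1⟩, g2, g3, g4⟩ := G.long hH (subset_rfl : _ ⊆ G.V0) (by rw [← hA]) rfl (he ξ z) (hno ξ)
  refine ⟨γ, mem_biUnion (x := u) ?_ (bx_adj (bx_self u 0) g1), fun i hi => ⟨?_, (g2 i hi).2⟩, g3, g4⟩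
  · obtain ⟨v, hv, hu⟩ := mem_iUnion₂.1 hu
    exact mem_biUnion hv.2.2.2 (hlane ▸ hu)
  · obtain ⟨-, -, v, hv, hj⟩ := (g2 i hi).1
    intro j j2
    have j0 : j ≠ 0 := by rintro rfl; simp at j2
    have j1 : j ≠ a1 := by rintro rfl; simp [ha1] at j2
    have := hj j j0
    have e1 : G.h = (hh m r : ℤ) := rfl
    rw [hlane, hln, e1] at this
    simp only [j0, j1, if_false] at this
    have hv2 := abs_le.1 hv.2
    have hoz : (off : ℤ) = 8 * hh m r * A + 10 * hh m r := by rw [ho]; push_cast; rfl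
    have k1 : (hh m r : ℤ) * v.2 ≤ hh m r * A := mul_le_mul_of_nonneg_left hv2.2 (by positivity)
    have k2 : (hh m r : ℤ) * (-A) ≤ hh m r * v.2 := mul_le_mul_of_nonneg_left hv2.1 (by positivity)
    have k3 : (0 : ℤ) ≤ hh m r * A := by positivity
    push_cast
    split_ifs at this <;> rw [abs_le] at this <;> constructor <;> nlinarith
end F4
section F5
variable {d : ℕ}

theorem fam_eq {q : unitInterval} {μ : Measure (Config d)} (h : IsBernoulliFam q μ) : μ = PB d q :=
  eq_Pm (fun s f => by rw [h.2]; rfl) ⟨true⟩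

theorem perc_Nx {ω : Config d} (h : PercolatesAt ω (fun _ => 0)) (n : ℕ) : Nx 0 0 n (op ω) ≠ ∅ := by
  classical
  obtain ⟨C, h0, hC, ho, hc⟩ := h
  obtain ⟨u, hu, hun⟩ := hC.exists_notMem_finset (bx_fin 0 n).toFinset
  obtain ⟨N, γ, g0, gN, ga, gC⟩ := hc _ h0 u hu
  have hex : ∃ i, i ≤ N ∧ γ i ∉ bx 0 n := ⟨N, le_rfl, by rw [gN]; simpa using hun⟩
  have f1 := Nat.find_spec hex
  have f2 := fun k => Nat.find_min hex (m := k)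
  generalize Nat.find hex = i at f1 f2
  have f3 : ∀ k < i, γ k ∈ bx 0 n := fun k hk => by
    have := f2 k hk
    simp only [not_and, not_not] at this
    exact this (by omega)
  have f4 : ∀ k < i, Rch (op ω ∩ bx 0 n) (bx 0 0) (γ k) := by
    intro k
    induction k with
    | zero => intro _; rw [g0]; exact .base (bx_self _ _)
    | succ k ih => exact fun hk => .step (ih (by omega)) (ga k (by omega)) ⟨ho _ (gC _ (by omega)), f3 _ hk⟩
  rcases i with _ | k
  · rw [g0] at f1; exact absurd (bx_self _ _) f1.2
  · exact nonempty_iff_ne_empty.1 ⟨γ (k + 1), f1.2, γ k, f3 k (by omega), ga k (by omega), f4 k (by omega)⟩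

theorem perc_one [NeZero d] (μ : Measure (Config d)) (h : IsBernoulliFam 1 μ) : 0 < μ {ω | PercolatesAt ω (fun _ => 0)} := by
  have := h.1
  have mt : ∀ v, MeasurableSet {ω : Config d | ω v = true} := fun v => measurableSet_eq_fun (measurable_pi_apply v) measurable_const
  have h1 : ∀ᵐ ω ∂μ, ∀ v, ω v = true := by
    refine ae_all_iff.2 fun v => ?_
    have := h.2 {v} (fun _ => true)
    simp only [Finset.mem_singleton, forall_eq, if_true, Finset.prod_singleton, ENNReal.ofReal_one] at this
    refine (prob_compl_eq_zero_iff ?_).2 this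
    exact mt v
  have h2 : {ω : Config d | ∀ v, ω v = true} ⊆ {ω | PercolatesAt ω (fun _ => 0)} := by
    intro ω hω
    let f : ℕ → Vtx d := fun k => Pi.single 0 (k : ℤ)
    have fa : ∀ k, adj (f k) (f (k + 1)) := fun k => adj_of 0 (by simp [f]) fun j hj => by simp [f, hj]
    refine ⟨range f, ⟨0, by simp [f]; rfl⟩, infinite_range_of_injective fun a b hab => ?_, fun u _ => hω u, ?_⟩
    · have := congrFun hab 0
      simpa [f] using this
    · rintro _ ⟨a, rfl⟩ _ ⟨b, rfl⟩
      rcases le_total a b with hab | hab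
      · exact ⟨b - a, fun i => f (a + i), rfl, by simp only; congr 1; omega, fun i _ => fa _, fun i _ => ⟨_, rfl⟩⟩
      · refine ⟨a - b, fun i => f (a - i), rfl, by simp only; congr 1; omega, fun i hi => ?_, fun i _ => ⟨_, rfl⟩⟩
        have := fa (a - (i + 1))
        rw [show a - (i + 1) + 1 = a - i by omega] at this
        exact adj_symm this
  have h3 : μ {ω : Config d | ∀ v, ω v = true}ᶜ = 0 := h1
  have h4 : μ {ω : Config d | ∀ v, ω v = true} = 1 := by
    refine (prob_compl_eq_zero_iff ?_).1 h3
    have : {ω : Config d | ∀ v, ω v = true} = ⋂ v, {ω | ω v = true} := by ext; simp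
    rw [this]
    exact MeasurableSet.iInter fun v => mt v
  exact lt_of_lt_of_le (by rw [h4]; exact one_pos) (measure_mono h2)

theorem final (hd : 3 ≤ d) (q0 p : unitInterval) (h : 0 < PB d q0 {ω | PercolatesAt ω (fun _ => 0)}) (h1 : (q0 : ℝ) < p) (h2 : (q0 : ℝ) < 1 - p) :
    ∃ l : ℕ, PB d p {ω | ∀ ξ : ℕ → Bool, ∃ v ∈ slab2 d l, seesWordIn ω ξ (slab2 d l) v} = 1 := by
  have : NeZero d := ⟨by omega⟩
  have q0' := q0.2.1
  have p1 := p.2.2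
  have p0 := p.2.1
  have hq1 : (q0 : ℝ) < 1 := by linarith
  have hq0 : 0 < (q0 : ℝ) := by
    refine lt_of_le_of_ne q0' fun hz => h.ne' (measure_mono_null (t := {ω | ∀ v ∈ ({fun _ => 0} : Finset (Vtx d)), ω v ∈ ({true} : Set Bool)}) ?_ ?_)
    · rintro ω ⟨C, hC, -, ho, -⟩
      simpa using ho _ hC
    · have e := Pm_rect (bern q0) ({fun _ => 0} : Finset (Vtx d)) (fun _ => {true})
      refine e.trans ?_
      rw [Finset.prod_singleton, PMF.toMeasure_apply_singleton _ _ (measurableSet_singleton _)]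
      simp [bern, ← hz]
  have hθ : 0 < (PB d q0).real {ω | PercolatesAt ω (fun _ => 0)} := ENNReal.toReal_pos h.ne' (measure_ne_top _ _)
  have h0 : ∀ n, fE q0 d 0 n ≤ 1 - (PB d q0).real {ω | PercolatesAt ω (fun _ => 0)} := by
    intro n
    have hm : MeasurableSet {ω : Config d | Nx 0 0 n (op ω) = ∅} := (Nx_dep 0 0 n (· = ∅)).meas (bx_fin 0 n)
    have e1 := probReal_compl_eq_one_sub (μ := PB d q0) hm
    have e2 : (PB d q0).real {ω | PercolatesAt ω (fun _ => 0)} ≤ (PB d q0).real {ω : Config d | Nx 0 0 n (op ω) = ∅}ᶜ :=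
      measureReal_mono (fun ω hω => perc_Nx hω n) (measure_ne_top _ _)
    unfold fE
    linarith
  obtain ⟨q, hqp, hqp', hq⟩ : ∃ q : ℝ, q ≤ p ∧ q ≤ 1 - p ∧ q0 < q := ⟨min p (1 - p), min_le_left _ _, min_le_right _ _, lt_min h1 h2⟩
  obtain ⟨s, hs⟩ : ∃ s : unitInterval, (s : ℝ) = (q - q0) / 88 := ⟨⟨(q - q0) / 88, by constructor <;> linarith⟩, rfl⟩
  have hg : 1 - g0 88 q0 s (fun _ => false) ≤ q := by
    rw [g0_zero]
    have := one_add_mul_le_pow (show (-2 : ℝ) ≤ -s by linarith [s.2.2]) 88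
    rw [← sub_eq_add_neg] at this
    generalize (1 - (s : ℝ)) ^ 88 = X at *
    push_cast at this
    have : 1 - (q - q0) ≤ X := by linarith
    nlinarith
  obtain ⟨m, r, hr, hL⟩ := lemma2 (d := d) q0 s hq0 hq1 (by rw [hs]; linarith) hθ h0 (show (0 : ℝ) < (1/2) ^ 500000005044 by positivity)
  obtain ⟨w, w1, w2⟩ := cpl_ex p (g0_sum q0 s) (g0_nn q0 s) (hg.trans hqp) (hg.trans hqp')
  obtain ⟨l, hl⟩ := build hd m r hr q0 s (hL 88) w2
  refine ⟨l, concl _ _ fun W hW => ?_⟩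
  obtain ⟨S, hS, hH⟩ := hl W hW
  refine ⟨S, hS, fun H h1 => ?_⟩
  have hm : Measurable (fun (z : Zc d 88) v => (z v).1) := measurable_pi_iff.2 fun v => measurable_fst.comp (measurable_pi_apply v)
  rw [← tr_fst w1, Measure.map_apply hm (Ev_meas _ hS H).compl]
  exact hH H h1
end F5

/-- **All words in a slab** : for `d ≥ 3` and `p ∈ (p_c^site(ℤ^d), 1 − p_c^site(ℤ^d))`,
there is an `l = l(d, p)` such that almost surely every word is seen from some vertex of
the slab `ℤ² × [0, l]^{d−2}`, along an infinite self-avoiding path contained in it. -/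
theorem all_words_in_slab
    (d : ℕ) (hd : 3 ≤ d)
    (ℙ : ℝ → Measure (Config d))
    (hP : ∀ q : ℝ, 0 ≤ q → q ≤ 1 → IsBernoulliFam q (ℙ q))
    (p : ℝ) (hp : pcSite d ℙ < p) (hp' : p < 1 - pcSite d ℙ) :
    ∃ l : ℕ,
      ℙ p {ω | ∀ ξ : ℕ → Bool, ∃ v ∈ slab2 d l, seesWordIn ω ξ (slab2 d l) v} = 1 := by
  have : NeZero d := ⟨by omega⟩
  have hc0 : 0 ≤ pcSite d ℙ := Real.sInf_nonneg fun x hx => hx.1.1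
  have hlt : pcSite d ℙ < min p (1 - p) := lt_min hp (by linarith)
  obtain ⟨q0, ⟨hq, hpos⟩, hq0⟩ := exists_lt_of_csInf_lt (s := {p : ℝ | p ∈ Set.Icc (0 : ℝ) 1 ∧ 0 < ℙ p {ω | PercolatesAt ω (fun _ => 0)}}) ⟨1, ⟨by simp, perc_one _ (hP 1 zero_le_one le_rfl)⟩⟩ hlt
  have hp0 : p ∈ unitInterval := ⟨by linarith, by linarith⟩
  rw [fam_eq (q := ⟨q0, hq⟩) (hP q0 hq.1 hq.2)] at hpos
  rw [fam_eq (q := ⟨p, hp0⟩) (hP p hp0.1 hp0.2)]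
  exact final hd ⟨q0, hq⟩ ⟨p, hp0⟩ hpos (lt_min_iff.1 hq0).1 (lt_min_iff.1 hq0).2

end PercWords
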